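/- arXiv:1401.5454 — 5 statements merged into one kernel-verified Lean document; each statement's English description precedes it below -/
import Mathlib

section
/- Let n ≥ 3, α ∈ [2,n), σ < α (σ any real, possibly negative) and 0 < p < (n + α − 2σ)/(n − α). Then there is no positive radially decreasing function u, continuous on ℝⁿ and continuously differentiable on ℝⁿ∖{0}, such that for every x ∈ ℝⁿ the integral ∫_{ℝⁿ} u(y)^p |x−y|^{α−n} |y|^{−σ} dy is finite and u(x) = ∫_{ℝⁿ} u(y)^p |x−y|^{α−n} |y|^{−σ} dy. -/
open MeasureTheory

noncomputable section

/-- `w : ℝⁿ → ℝ` is radially decreasing if `w(x) = W(‖x‖)` for some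
nonincreasing `W : [0,∞) → (0,∞)`. -/
def RadiallyDecreasing {n : ℕ} (w : EuclideanSpace ℝ (Fin n) → ℝ) : Prop :=
  ∃ W : ℝ → ℝ, AntitoneOn W (Set.Ici 0) ∧ (∀ r, 0 ≤ r → 0 < W r) ∧
    ∀ x, w x = W ‖x‖

theorem rpow_mul_add_le {p a b : ℝ} (hp : 1 < p) (hb : 0 < b) (hab : b ≤ a) :
    a ^ p * b + (p - 1) / (p + 1) * b ^ (p + 1) ≤ a * b ^ p + (p - 1) / (p + 1) * a ^ (p + 1) := by
  have hp1 : 0 < p + 1 := by linarith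
  -- The derivative of the difference in `a` is nonnegative by Bernoulli.
  let h : ℝ → ℝ := fun x => x * b ^ p + (p - 1) / (p + 1) * x ^ (p + 1) - x ^ p * b
  have hder : ∀ x, 0 < x → HasDerivAt h
      (b ^ p + (p - 1) * x ^ p - p * x ^ (p - 1) * b) x := by
    intro x hx
    have h1 := Real.hasDerivAt_rpow_const (x := x) (p := p) (Or.inl hx.ne')
    have h2 := Real.hasDerivAt_rpow_const (x := x) (p := p + 1) (Or.inl hx.ne')
    refine ((((hasDerivAt_id x).mul_const (b ^ p)).add
      (h2.const_mul ((p - 1) / (p + 1)))).sub (h1.mul_const b)).congr_deriv ?_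
    rw [show p + 1 - 1 = p by ring]
    field_simp
  have hmono : MonotoneOn h (Set.Ici b) := by
    refine monotoneOn_of_deriv_nonneg (convex_Ici b)
      (fun x hx => (hder x (hb.trans_le hx)).continuousAt.continuousWithinAt)
      (fun x hx => ?_) (fun x hx => ?_)
    · rw [interior_Ici] at hx
      exact (hder x (hb.trans hx)).differentiableAt.differentiableWithinAt
    · rw [interior_Ici] at hx
      have hx0 : 0 < x := hb.trans hx
      rw [(hder x hx0).deriv]
      have hB := one_add_mul_self_le_rpow_one_add (s := b / x - 1) (p := p)
        (by have := div_pos hb hx0; linarith) hp.le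
      rw [show 1 + (b / x - 1) = b / x by ring, Real.div_rpow hb.le hx0.le,
        le_div_iff₀ (Real.rpow_pos_of_pos hx0 p)] at hB
      have hxp : x ^ p = x ^ (p - 1) * x := by
        rw [← Real.rpow_add_one hx0.ne']; ring_nf
      have : (1 + p * (b / x - 1)) * x ^ p = p * x ^ (p - 1) * b - (p - 1) * x ^ p := by
        rw [hxp]; field_simp; ring
      linarith
  have := hmono Set.self_mem_Ici hab hab
  have e1 : b ^ (p + 1) = b ^ p * b := Real.rpow_add_one hb.ne' p
  simp only [h] at this
  nlinarith

theorem le_mul_of_forall_rpow_sub_one_le {c s N : ℝ}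
    (h : ∀ l : ℝ, 1 < l → l ^ s - 1 ≤ c * (l ^ N - 1)) : s ≤ c * N := by
  have h1 := Real.hasDerivAt_rpow_const (x := 1) (p := s) (Or.inl one_ne_zero)
  have h2 := Real.hasDerivAt_rpow_const (x := 1) (p := N) (Or.inl one_ne_zero)
  have hd := ((h2.const_mul c).sub h1).hasDerivWithinAt (s := Set.Ioi 1)
  rw [hasDerivWithinAt_iff_tendsto_slope' (by simp)] at hd
  have := ge_of_tendsto (b := 0) hd (by
    filter_upwards [self_mem_nhdsWithin] with l hl
    have hl : 1 < l := hl
    rw [slope_def_field]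
    refine div_nonneg ?_ (by linarith)
    have := h l hl
    simp only [Pi.sub_apply, Real.one_rpow]
    linarith)
  simp only [Real.one_rpow] at this
  linarith

theorem integral_mul_integral_kernel_symm {X : Type*} [MeasurableSpace X] {μ : Measure X}
    [SFinite μ] {k : X → X → ℝ} {f g : X → ℝ} (hk : Measurable (Function.uncurry k))
    (hk0 : ∀ x y, 0 ≤ k x y) (hks : ∀ x y, k x y = k y x)
    (hf : Measurable f) (hf0 : ∀ x, 0 ≤ f x) (hg : Measurable g) (hg0 : ∀ x, 0 ≤ g x)
    (hfk : ∀ x, Integrable (fun y => f y * k x y) μ)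
    (hgk : ∀ x, Integrable (fun y => g y * k x y) μ) :
    ∫ x, f x * ∫ y, g y * k x y ∂μ ∂μ = ∫ x, g x * ∫ y, f y * k x y ∂μ ∂μ := by
  have expand : ∀ {f g : X → ℝ}, Measurable f → (∀ x, 0 ≤ f x) → Measurable g →
      (∀ x, 0 ≤ g x) → (∀ x, Integrable (fun y => g y * k x y) μ) →
      ∫ x, f x * ∫ y, g y * k x y ∂μ ∂μ =
        (∫⁻ x, ∫⁻ y, ENNReal.ofReal (f x * (g y * k x y)) ∂μ ∂μ).toReal := by
    intro f g hf hf0 hg hg0 hgk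
    have hm : Measurable (fun x => ∫ y, g y * k x y ∂μ) := by
      have : StronglyMeasurable (Function.uncurry fun x y => g y * k x y) :=
        ((hg.comp measurable_snd).mul hk).stronglyMeasurable
      exact this.integral_prod_right.measurable
    rw [integral_eq_lintegral_of_nonneg_ae
      (.of_forall fun x => mul_nonneg (hf0 x)
        (integral_nonneg fun y => mul_nonneg (hg0 y) (hk0 x y)))
      (hf.mul hm).aestronglyMeasurable]
    congr 1
    refine lintegral_congr fun x => ?_
    rw [ENNReal.ofReal_mul (hf0 x), ofReal_integral_eq_lintegral_ofReal (hgk x)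
      (.of_forall fun y => mul_nonneg (hg0 y) (hk0 x y)),
      ← lintegral_const_mul' _ _ ENNReal.ofReal_ne_top]
    exact lintegral_congr fun y => (ENNReal.ofReal_mul (hf0 x)).symm
  rw [expand hf hf0 hg hg0 hgk, expand hg hg0 hf hf0 hfk, lintegral_lintegral_swap]
  · congr 1
    refine lintegral_congr fun x => lintegral_congr fun y => ?_
    rw [hks y x]
    ring_nf
  · exact (((hf.comp measurable_fst).mul
      ((hg.comp measurable_snd).mul hk)).ennreal_ofReal).aemeasurable

section Solution

variable {n : ℕ} {α σ p : ℝ} {u : EuclideanSpace ℝ (Fin n) → ℝ}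

theorem integrableOn_ball_norm_rpow (hn : 1 ≤ n) (hσ : σ < n) (r : ℝ) :
    IntegrableOn (fun y : EuclideanSpace ℝ (Fin n) => ‖y‖ ^ (-σ)) (Metric.ball 0 r) := by
  refine integrableOn_ball_of_norm_le_rpow (C := 1) (α := σ) (by simpa using hn)
    (by simpa using hσ) (.of_forall fun x => ?_)
    (measurable_norm.pow_const _).aestronglyMeasurable
  rw [one_mul, Real.norm_of_nonneg (by positivity)]

theorem setIntegral_ball_norm_rpow {r : ℝ} (hr : 0 < r) :
    ∫ y in Metric.ball (0 : EuclideanSpace ℝ (Fin n)) r, ‖y‖ ^ (-σ) =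
      r ^ (n - σ) * ∫ y in Metric.ball (0 : EuclideanSpace ℝ (Fin n)) 1, ‖y‖ ^ (-σ) := by
  have h := Measure.setIntegral_comp_smul_of_pos volume
    (fun y : EuclideanSpace ℝ (Fin n) => ‖y‖ ^ (-σ)) (Metric.ball 0 1) hr
  simp only [norm_smul, Real.norm_of_nonneg hr.le, Real.mul_rpow hr.le (norm_nonneg _),
    integral_const_mul, finrank_euclideanSpace, Fintype.card_fin, smul_eq_mul] at h
  rw [smul_unitBall_of_pos hr, ← Real.rpow_natCast] at h
  rw [sub_eq_add_neg, Real.rpow_add hr, mul_assoc, h, mul_inv_cancel_left₀ (by positivity)]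

theorem setIntegral_unitBall_norm_rpow_pos (hn : 1 ≤ n) (hσ : σ < n) :
    0 < ∫ y in Metric.ball (0 : EuclideanSpace ℝ (Fin n)) 1, ‖y‖ ^ (-σ) := by
  have : Nonempty (Fin n) := ⟨⟨0, hn⟩⟩
  rw [setIntegral_pos_iff_support_of_nonneg_ae (.of_forall fun y => by positivity)
    (integrableOn_ball_norm_rpow hn hσ 1)]
  have hball : 0 < volume (Metric.ball (0 : EuclideanSpace ℝ (Fin n)) 1 \ {0}) := by
    rw [measure_sdiff_null (measure_singleton _)]
    exact Metric.measure_ball_pos _ _ one_pos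
  refine hball.trans_le (measure_mono fun y hy => ⟨?_, hy.1⟩)
  exact (Real.rpow_pos_of_pos (norm_pos_iff.2 hy.2) _).ne'

/-- A radially decreasing solution satisfies `c |x|^(α-σ) u(x)^p ≤ u(x)`. -/
theorem exists_mul_rpow_le (hn : 1 ≤ n) (hαn : α < n) (hσ : σ < α) (hp0 : 0 < p)
    (hpos : ∀ x, 0 < u x) (hanti : ∀ x y, ‖x‖ ≤ ‖y‖ → u y ≤ u x)
    (hint : ∀ x, Integrable fun y => u y ^ p * ‖x - y‖ ^ (α - (n : ℝ)) * ‖y‖ ^ (-σ))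
    (heq : ∀ x, u x = ∫ y, u y ^ p * ‖x - y‖ ^ (α - (n : ℝ)) * ‖y‖ ^ (-σ)) :
    ∃ c > 0, ∀ x ≠ 0, c * ‖x‖ ^ (α - σ) * u x ^ p ≤ u x := by
  have hσn : σ < n := hσ.trans hαn
  refine ⟨2 ^ (α - (n : ℝ)) * ∫ y in Metric.ball (0 : EuclideanSpace ℝ (Fin n)) 1, ‖y‖ ^ (-σ),
    mul_pos (by positivity) (setIntegral_unitBall_norm_rpow_pos hn hσn), fun x hx => ?_⟩
  have hr : 0 < ‖x‖ := norm_pos_iff.2 hx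
  have hu := hpos x
  have hnn : ∀ y, 0 ≤ u y ^ p * ‖x - y‖ ^ (α - (n : ℝ)) * ‖y‖ ^ (-σ) := fun y => by
    have := hpos y
    positivity
  calc _ = u x ^ p * (2 * ‖x‖) ^ (α - (n : ℝ)) *
        ∫ y in Metric.ball (0 : EuclideanSpace ℝ (Fin n)) ‖x‖, ‖y‖ ^ (-σ) := by
        rw [setIntegral_ball_norm_rpow hr, Real.mul_rpow zero_le_two hr.le,
          show α - σ = (α - n) + (n - σ) by ring, Real.rpow_add hr]
        ring
    _ = ∫ y in Metric.ball (0 : EuclideanSpace ℝ (Fin n)) ‖x‖,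
          u x ^ p * (2 * ‖x‖) ^ (α - (n : ℝ)) * ‖y‖ ^ (-σ) := (integral_const_mul _ _).symm
    _ ≤ ∫ y in Metric.ball (0 : EuclideanSpace ℝ (Fin n)) ‖x‖,
          u y ^ p * ‖x - y‖ ^ (α - (n : ℝ)) * ‖y‖ ^ (-σ) := by
        refine setIntegral_mono_on ((integrableOn_ball_norm_rpow hn hσn _).const_mul _)
          (hint x).integrableOn Metric.isOpen_ball.measurableSet fun y hy => ?_
        rw [mem_ball_zero_iff] at hy
        have hxy : 0 < ‖x - y‖ := norm_sub_pos_iff.2 (by rintro rfl; exact lt_irrefl _ hy)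
        have h1 : u x ^ p ≤ u y ^ p := Real.rpow_le_rpow hu.le (hanti y x hy.le) hp0.le
        have h2 : (2 * ‖x‖) ^ (α - (n : ℝ)) ≤ ‖x - y‖ ^ (α - (n : ℝ)) :=
          Real.rpow_le_rpow_of_nonpos hxy (by linarith [norm_sub_le x y]) (by linarith)
        have := hpos y
        gcongr
    _ ≤ ∫ y, u y ^ p * ‖x - y‖ ^ (α - (n : ℝ)) * ‖y‖ ^ (-σ) :=
        setIntegral_le_integral (hint x) (.of_forall hnn)
    _ = u x := (heq x).symm

theorem one_lt_of_mul_rpow_le (hn : 1 ≤ n) (hσ : σ < α)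
    (hpos : ∀ x, 0 < u x) (hanti : ∀ x y, ‖x‖ ≤ ‖y‖ → u y ≤ u x) {c : ℝ} (hc : 0 < c)
    (hle : ∀ x ≠ 0, c * ‖x‖ ^ (α - σ) * u x ^ p ≤ u x) : 1 < p := by
  by_contra! hp1
  have : Nontrivial (EuclideanSpace ℝ (Fin n)) :=
    Module.nontrivial_of_finrank_pos (R := ℝ) (by simpa using Nat.pos_of_ne_zero (by omega))
  have htend : Filter.Tendsto (fun r : ℝ => c * r ^ (α - σ)) Filter.atTop Filter.atTop :=
    (tendsto_rpow_atTop (by linarith)).const_mul_atTop hc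
  obtain ⟨r, hr, hr0⟩ := ((htend.eventually_gt_atTop (u 0 ^ (1 - p))).and
    (Filter.eventually_gt_atTop 0)).exists
  obtain ⟨x, hx⟩ := exists_norm_eq (EuclideanSpace ℝ (Fin n)) hr0.le
  have hux := hpos x
  have h1 := hle x (norm_pos_iff.1 (hx ▸ hr0))
  rw [hx, ← le_div_iff₀ (by positivity)] at h1
  have h2 : u x / u x ^ p = u x ^ (1 - p) := by rw [Real.rpow_sub hux, Real.rpow_one]
  have h3 : u x ^ (1 - p) ≤ u 0 ^ (1 - p) :=
    Real.rpow_le_rpow hux.le (hanti 0 x (by simp)) (by linarith)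
  linarith

theorem integrable_rpow_add_one_mul (hn : 1 ≤ n) (hσn : σ < n) (hp1 : 1 < p)
    (hp : (p - 1) * (n - σ) < (p + 1) * (α - σ)) (hcont : Continuous u)
    (hpos : ∀ x, 0 < u x) (hanti : ∀ x y, ‖x‖ ≤ ‖y‖ → u y ≤ u x) {c : ℝ} (hc : 0 < c)
    (hle : ∀ x ≠ 0, c * ‖x‖ ^ (α - σ) * u x ^ p ≤ u x) :
    Integrable fun x => u x ^ (p + 1) * ‖x‖ ^ (-σ) := by
  have hmeas : AEStronglyMeasurable (fun x => u x ^ (p + 1) * ‖x‖ ^ (-σ)) volume :=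
    ((hcont.measurable.pow_const _).mul (measurable_norm.pow_const _)).aestronglyMeasurable
  have hin : IntegrableOn (fun x => u x ^ (p + 1) * ‖x‖ ^ (-σ)) (Metric.ball 0 1) := by
    refine ((integrableOn_ball_norm_rpow hn hσn 1).const_mul (u 0 ^ (p + 1))).mono'
      hmeas.restrict (.of_forall fun x => ?_)
    have hx := hpos x
    rw [Real.norm_of_nonneg (by positivity)]
    gcongr
    exact hanti 0 x (by simp)
  set q := (p + 1) / (p - 1) with hq
  have hq0 : 0 < q := div_pos (by linarith) (by linarith)
  have hqn : (n : ℝ) < (α - σ) * q + σ := by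
    rw [hq, ← sub_lt_iff_lt_add, mul_div_assoc', lt_div_iff₀ (by linarith)]
    linarith
  have hout : IntegrableOn (fun x => u x ^ (p + 1) * ‖x‖ ^ (-σ)) (Metric.ball 0 1)ᶜ := by
    refine (((integrable_one_add_norm (E := EuclideanSpace ℝ (Fin n)) (μ := volume)
      (r := (α - σ) * q + σ) (by simpa using hqn)).const_mul
      (c⁻¹ ^ q * 2 ^ ((α - σ) * q + σ))).integrableOn).mono' hmeas.restrict ?_
    refine (ae_restrict_iff' Metric.isOpen_ball.measurableSet.compl).2 (.of_forall fun x hx => ?_)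
    have hx1 : 1 ≤ ‖x‖ := by simpa using hx
    have hx0 : 0 < ‖x‖ := by linarith
    have hux := hpos x
    rw [Real.norm_of_nonneg (by positivity)]
    have h1 : u x ^ (p - 1) ≤ c⁻¹ * ‖x‖ ^ (-(α - σ)) := by
      have := hle x (norm_pos_iff.1 hx0)
      rw [Real.rpow_neg hx0.le, ← mul_inv, Real.rpow_sub hux, Real.rpow_one,
        div_le_iff₀ hux, ← div_eq_inv_mul, le_div_iff₀ (by positivity)]
      linarith
    have h2 : u x ^ (p + 1) ≤ c⁻¹ ^ q * ‖x‖ ^ (-((α - σ) * q)) := by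
      have h := Real.rpow_le_rpow (by positivity) h1 hq0.le
      rwa [← Real.rpow_mul hux.le, Real.mul_rpow (by positivity) (by positivity),
        ← Real.rpow_mul hx0.le, hq, mul_div_cancel₀ _ (by linarith : p - 1 ≠ 0), ← hq,
        neg_mul] at h
    have h3 : ‖x‖ ^ (-((α - σ) * q + σ)) ≤
        2 ^ ((α - σ) * q + σ) * (1 + ‖x‖) ^ (-((α - σ) * q + σ)) := by
      rw [Real.rpow_neg hx0.le, Real.rpow_neg (by positivity), ← div_eq_mul_inv,
        ← Real.div_rpow zero_le_two (by positivity), ← Real.inv_rpow hx0.le]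
      refine Real.rpow_le_rpow (by positivity) ?_
        (by linarith [(Nat.cast_nonneg n : (0 : ℝ) ≤ n)])
      rw [inv_eq_one_div, div_le_div_iff₀ hx0 (by positivity)]
      linarith
    calc u x ^ (p + 1) * ‖x‖ ^ (-σ)
        ≤ c⁻¹ ^ q * ‖x‖ ^ (-((α - σ) * q)) * ‖x‖ ^ (-σ) := by gcongr
      _ = c⁻¹ ^ q * ‖x‖ ^ (-((α - σ) * q + σ)) := by
        rw [neg_add, Real.rpow_add hx0, mul_assoc]
      _ ≤ _ := by
        rw [mul_assoc]
        gcongr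
  rw [← integrableOn_univ, ← Set.union_compl_self (Metric.ball 0 1)]
  exact hin.union hout

/-- The energy identity relating a solution to its dilations. -/
theorem integral_mul_dilation_eq (hcont : Continuous u) (hpos : ∀ x, 0 < u x)
    (hint : ∀ x, Integrable fun y => u y ^ p * ‖x - y‖ ^ (α - (n : ℝ)) * ‖y‖ ^ (-σ))
    (heq : ∀ x, u x = ∫ y, u y ^ p * ‖x - y‖ ^ (α - (n : ℝ)) * ‖y‖ ^ (-σ))
    {l : ℝ} (hl : 0 < l) :
    ∫ x, u x ^ p * u (l • x) * ‖x‖ ^ (-σ) =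
      l ^ (α - σ) * ∫ x, u x * u (l • x) ^ p * ‖x‖ ^ (-σ) := by
  have hscale : ∀ x y : EuclideanSpace ℝ (Fin n),
      u (l • y) ^ p * ‖l • x - l • y‖ ^ (α - (n : ℝ)) * ‖l • y‖ ^ (-σ) =
        l ^ (α - n - σ) * (u (l • y) ^ p * ‖y‖ ^ (-σ) * ‖x - y‖ ^ (α - (n : ℝ))) := by
    intro x y
    rw [← smul_sub, norm_smul, norm_smul, Real.norm_of_nonneg hl.le,
      Real.mul_rpow hl.le (norm_nonneg _), Real.mul_rpow hl.le (norm_nonneg _),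
      sub_eq_add_neg (α - n) σ, Real.rpow_add hl]
    ring
  have hg : ∀ x, Integrable fun y =>
      u (l • y) ^ p * ‖y‖ ^ (-σ) * ‖x - y‖ ^ (α - (n : ℝ)) := by
    intro x
    have h := (hint (l • x)).comp_smul hl.ne'
    simp only [hscale] at h
    exact (integrable_const_mul_iff (Real.rpow_pos_of_pos hl _).ne'.isUnit _).1 h
  have hf : ∀ x, Integrable fun y => u y ^ p * ‖y‖ ^ (-σ) * ‖x - y‖ ^ (α - (n : ℝ)) :=
    fun x => (hint x).congr (.of_forall fun y => mul_right_comm _ _ _)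
  have hdil : ∀ x, u (l • x) =
      l ^ (α - σ) * ∫ y, u (l • y) ^ p * ‖y‖ ^ (-σ) * ‖x - y‖ ^ (α - (n : ℝ)) := by
    intro x
    have h := Measure.integral_comp_smul_of_nonneg volume
      (fun y => u y ^ p * ‖l • x - y‖ ^ (α - (n : ℝ)) * ‖y‖ ^ (-σ)) l (hR := hl.le)
    simp only [hscale, integral_const_mul, finrank_euclideanSpace, Fintype.card_fin,
      smul_eq_mul] at h
    rw [← heq, ← Real.rpow_natCast] at h
    rw [show α - σ = n + (α - n - σ) by ring, Real.rpow_add hl, mul_assoc, h,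
      mul_inv_cancel_left₀ (by positivity)]
  have heq' : ∀ x, u x = ∫ y, u y ^ p * ‖y‖ ^ (-σ) * ‖x - y‖ ^ (α - (n : ℝ)) := fun x => by
    simp only [heq x, mul_right_comm]
  have hu := hcont.measurable
  have hul : Measurable fun x => u (l • x) := hu.comp (measurable_const_smul l)
  have hw : Measurable fun x : EuclideanSpace ℝ (Fin n) => ‖x‖ ^ (-σ) :=
    measurable_norm.pow_const _
  have hsymm := integral_mul_integral_kernel_symm (μ := volume)
    (k := fun x y : EuclideanSpace ℝ (Fin n) => ‖x - y‖ ^ (α - (n : ℝ)))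
    (f := fun y => u y ^ p * ‖y‖ ^ (-σ)) (g := fun y => u (l • y) ^ p * ‖y‖ ^ (-σ))
    ((measurable_fst.sub measurable_snd).norm.pow_const _) (fun x y => by positivity)
    (fun x y => by rw [norm_sub_rev]) ((hu.pow_const p).mul hw)
    (fun x => by have := hpos x; positivity) ((hul.pow_const p).mul hw)
    (fun x => by have := hpos (l • x); positivity) hf hg
  simp only [← heq'] at hsymm
  calc _ = ∫ x, l ^ (α - σ) * (u x ^ p * ‖x‖ ^ (-σ) *
        ∫ y, u (l • y) ^ p * ‖y‖ ^ (-σ) * ‖x - y‖ ^ (α - (n : ℝ))) := by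
        refine integral_congr_ae (.of_forall fun x => ?_)
        simp only
        rw [hdil x]
        ring
    _ = _ := by
        rw [integral_const_mul, hsymm]
        congr 1
        refine integral_congr_ae (.of_forall fun x => ?_)
        simp only
        ring

theorem rpow_sub_one_le_of_solution (hp1 : 1 < p)
    (hcont : Continuous u)
    (hpos : ∀ x, 0 < u x) (hanti : ∀ x y, ‖x‖ ≤ ‖y‖ → u y ≤ u x)
    (hint : ∀ x, Integrable fun y => u y ^ p * ‖x - y‖ ^ (α - (n : ℝ)) * ‖y‖ ^ (-σ))
    (heq : ∀ x, u x = ∫ y, u y ^ p * ‖x - y‖ ^ (α - (n : ℝ)) * ‖y‖ ^ (-σ))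
    (hJ : Integrable fun x => u x ^ (p + 1) * ‖x‖ ^ (-σ)) (hn : 1 ≤ n) (hσ : σ < α)
    {l : ℝ} (hl : 1 < l) :
    l ^ (α - σ) - 1 ≤ (p - 1) / (p + 1) * (l ^ (n - σ) - 1) := by
  have hl0 : 0 < l := by linarith
  have hu := hcont.measurable
  have hul : Measurable fun x => u (l • x) := hu.comp (measurable_const_smul l)
  have hw : Measurable fun x : EuclideanSpace ℝ (Fin n) => ‖x‖ ^ (-σ) :=
    measurable_norm.pow_const _
  have hba : ∀ x, u (l • x) ≤ u x := fun x => hanti _ _ (by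
    rw [norm_smul, Real.norm_of_nonneg hl0.le]
    exact le_mul_of_one_le_left (norm_nonneg _) hl.le)
  have hsucc : ∀ x, u x ^ (p + 1) = u x ^ p * u x := fun x => Real.rpow_add_one (hpos x).ne' p
  have hpow : ∀ x, u (l • x) ^ p ≤ u x ^ p := fun x =>
    Real.rpow_le_rpow (hpos _).le (hba x) (by linarith)
  have hA : Integrable fun x => u x ^ p * u (l • x) * ‖x‖ ^ (-σ) := by
    refine hJ.mono' (((hu.pow_const p).mul hul).mul hw).aestronglyMeasurable
      (.of_forall fun x => ?_)
    have := hpos x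
    have := hpos (l • x)
    rw [Real.norm_of_nonneg (by positivity), hsucc]
    gcongr
    exact hba x
  have hB : Integrable fun x => u x * u (l • x) ^ p * ‖x‖ ^ (-σ) := by
    refine hJ.mono' ((hu.mul (hul.pow_const p)).mul hw).aestronglyMeasurable
      (.of_forall fun x => ?_)
    have := hpos x
    have := hpos (l • x)
    rw [Real.norm_of_nonneg (by positivity), hsucc, mul_comm (u x)]
    gcongr
    exact hba x
  have hscale : ∀ x : EuclideanSpace ℝ (Fin n), u (l • x) ^ (p + 1) * ‖l • x‖ ^ (-σ) =
      l ^ (-σ) * (u (l • x) ^ (p + 1) * ‖x‖ ^ (-σ)) := fun x => by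
    rw [norm_smul, Real.norm_of_nonneg hl0.le, Real.mul_rpow hl0.le (norm_nonneg _)]
    ring
  have hD : Integrable fun x => u (l • x) ^ (p + 1) * ‖x‖ ^ (-σ) := by
    have h := hJ.comp_smul hl0.ne'
    simp only [hscale] at h
    exact (integrable_const_mul_iff (Real.rpow_pos_of_pos hl0 _).ne'.isUnit _).1 h
  have hDJ : l ^ (n - σ) * ∫ x, u (l • x) ^ (p + 1) * ‖x‖ ^ (-σ) =
      ∫ x, u x ^ (p + 1) * ‖x‖ ^ (-σ) := by
    have h := Measure.integral_comp_smul_of_nonneg volume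
      (fun x => u x ^ (p + 1) * ‖x‖ ^ (-σ)) l (hR := hl0.le)
    simp only [hscale, integral_const_mul, finrank_euclideanSpace, Fintype.card_fin,
      smul_eq_mul] at h
    rw [← Real.rpow_natCast] at h
    rw [sub_eq_add_neg, Real.rpow_add hl0, mul_assoc, h, mul_inv_cancel_left₀ (by positivity)]
  have hDB : ∫ x, u (l • x) ^ (p + 1) * ‖x‖ ^ (-σ) ≤
      ∫ x, u x * u (l • x) ^ p * ‖x‖ ^ (-σ) := by
    refine integral_mono hD hB fun x => ?_
    have := hpos (l • x)
    simp only
    rw [Real.rpow_add_one this.ne', mul_comm (u x)]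
    gcongr
    exact hba x
  have hDpos : 0 < ∫ x, u (l • x) ^ (p + 1) * ‖x‖ ^ (-σ) := by
    have : Nonempty (Fin n) := ⟨⟨0, hn⟩⟩
    rw [integral_pos_iff_support_of_nonneg (fun x => by have := hpos (l • x); positivity) hD]
    have hcompl : 0 < volume ({0}ᶜ : Set (EuclideanSpace ℝ (Fin n))) := by
      rw [measure_compl (measurableSet_singleton _) (by simp)]
      simp
    refine hcompl.trans_le (measure_mono fun x hx => ?_)
    exact (mul_pos (Real.rpow_pos_of_pos (hpos _) _)
      (Real.rpow_pos_of_pos (norm_pos_iff.2 hx) _)).ne'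
  have hmain : (∫ x, u x ^ p * u (l • x) * ‖x‖ ^ (-σ)) +
      (p - 1) / (p + 1) * ∫ x, u (l • x) ^ (p + 1) * ‖x‖ ^ (-σ) ≤
      (∫ x, u x * u (l • x) ^ p * ‖x‖ ^ (-σ)) +
      (p - 1) / (p + 1) * ∫ x, u x ^ (p + 1) * ‖x‖ ^ (-σ) := by
    rw [← integral_const_mul, ← integral_const_mul, ← integral_add hA (hD.const_mul _),
      ← integral_add hB (hJ.const_mul _)]
    refine integral_mono (hA.add (hD.const_mul _)) (hB.add (hJ.const_mul _)) fun x => ?_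
    have h := mul_le_mul_of_nonneg_right (rpow_mul_add_le hp1 (hpos (l • x)) (hba x))
      (by positivity : 0 ≤ ‖x‖ ^ (-σ))
    simp only
    linarith
  rw [integral_mul_dilation_eq hcont hpos hint heq hl0, ← hDJ] at hmain
  have hls : 1 ≤ l ^ (α - σ) := Real.one_le_rpow hl.le (by linarith)
  have := mul_le_mul_of_nonneg_left hDB (sub_nonneg.2 hls)
  refine le_of_mul_le_mul_right ?_ hDpos
  linarith

end Solution

theorem stmt_6 (n : ℕ) (hn : 3 ≤ n) (α σ p : ℝ)
    (hα2 : 2 ≤ α) (hαn : α < n) (hσ : σ < α)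
    (hp0 : 0 < p) (hp : p < ((n : ℝ) + α - 2 * σ) / ((n : ℝ) - α)) :
    ¬ ∃ u : EuclideanSpace ℝ (Fin n) → ℝ,
      (∀ x, 0 < u x) ∧ RadiallyDecreasing u ∧ Continuous u ∧
      ContDiffOn ℝ 1 u {(0 : EuclideanSpace ℝ (Fin n))}ᶜ ∧
      ∀ x : EuclideanSpace ℝ (Fin n),
        Integrable (fun y => u y ^ p * ‖x - y‖ ^ (α - (n : ℝ)) * ‖y‖ ^ (-σ)) ∧
        u x = ∫ y, u y ^ p * ‖x - y‖ ^ (α - (n : ℝ)) * ‖y‖ ^ (-σ) := by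
  rintro ⟨u, hpos, ⟨W, hW, -, huW⟩, hcont, -, hsol⟩
  have hint := fun x => (hsol x).1
  have heq := fun x => (hsol x).2
  have hn1 : 1 ≤ n := by omega
  have hanti : ∀ x y, ‖x‖ ≤ ‖y‖ → u y ≤ u x := fun x y hxy => by
    rw [huW, huW]
    exact hW (norm_nonneg x) (norm_nonneg y) hxy
  have hsub : (p - 1) * (n - σ) < (p + 1) * (α - σ) := by
    rw [lt_div_iff₀ (by linarith)] at hp
    linarith
  obtain ⟨c, hc, hle⟩ := exists_mul_rpow_le hn1 hαn hσ hp0 hpos hanti hint heq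
  have hp1 := one_lt_of_mul_rpow_le hn1 hσ hpos hanti hc hle
  have hJ := integrable_rpow_add_one_mul hn1 (hσ.trans hαn) hp1 hsub hcont hpos hanti hc hle
  have hfinal := le_mul_of_forall_rpow_sub_one_le fun l hl =>
    rpow_sub_one_le_of_solution hp1 hcont hpos hanti hint heq hJ hn1 hσ hl
  rw [div_mul_eq_mul_div, le_div_iff₀ (by linarith)] at hfinal
  linarith
end
end

section
/- Let n ≥ 3, α ∈ [2,n), σ₁, σ₂ < α (possibly negative) and p, q > 0. Suppose that either pq ∈ (0,1], or pq > 1 and (n−σ₁)/(1+q) + (n−σ₂)/(1+p) > n − α. Then there is no pair (u, v) of positive radially decreasing functions, each continuous on ℝⁿ and continuously differentiable on ℝⁿ∖{0}, such that for every x ∈ ℝⁿ the integrals ∫_{ℝⁿ} v(y)^q |x−y|^{α−n} |y|^{−σ₁} dy and ∫_{ℝⁿ} u(y)^p |x−y|^{α−n} |y|^{−σ₂} dy are finite and u(x) = ∫_{ℝⁿ} v(y)^q |x−y|^{α−n} |y|^{−σ₁} dy and v(x) = ∫_{ℝⁿ} u(y)^p |x−y|^{α−n} |y|^{−σ₂}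 dy. -/
open MeasureTheory

noncomputable section

open Metric Filter Topology
open scoped Pointwise

theorem rpow_mul_le_of_young {a b q : ℝ} (ha : 0 < a) (hb : 0 < b) (hq : 0 < q) :
    a ^ q * b ≤ (q * a ^ (q + 1) + b ^ (q + 1)) / (q + 1) := by
  have h := Real.geom_mean_le_arith_mean2_weighted (w₁ := q / (q + 1)) (w₂ := 1 / (q + 1))
    (p₁ := a ^ (q + 1)) (p₂ := b ^ (q + 1)) (by positivity) (by positivity) (by positivity)
    (by positivity) (by field_simp)
  rw [← Real.rpow_mul ha.le, ← Real.rpow_mul hb.le,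
    show (q + 1) * (q / (q + 1)) = q by field_simp,
    show (q + 1) * (1 / (q + 1)) = 1 by field_simp, Real.rpow_one] at h
  calc _ ≤ _ := h
    _ = _ := by ring

section
variable {n : ℕ}

local notation "𝔼" => EuclideanSpace ℝ (Fin n)

theorem comp_smul_mul_norm_rpow_eq (h : 𝔼 → ℝ) {c : ℝ} (hc : 0 < c) (σ : ℝ) (x : 𝔼) :
    h (c • x) * ‖x‖ ^ (-σ) = c ^ σ * (fun x => h x * ‖x‖ ^ (-σ)) (c • x) := by
  simp only [norm_smul, Real.norm_of_nonneg hc.le]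
  rw [Real.mul_rpow hc.le (norm_nonneg _), Real.rpow_neg hc.le]
  have := Real.rpow_pos_of_pos hc σ
  field_simp

theorem setIntegral_comp_smul_mul_norm_rpow (h : 𝔼 → ℝ) (s : Set 𝔼) {c : ℝ} (hc : 0 < c)
    (σ : ℝ) :
    ∫ x in s, h (c • x) * ‖x‖ ^ (-σ) =
      c ^ (σ - n) * ∫ x in c • s, h x * ‖x‖ ^ (-σ) := by
  simp_rw [comp_smul_mul_norm_rpow_eq h hc σ]
  rw [integral_const_mul, Measure.setIntegral_comp_smul_of_pos _ (fun x => h x * ‖x‖ ^ (-σ)) _ hc, smul_eq_mul,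
    finrank_euclideanSpace_fin, ← mul_assoc, Real.rpow_sub hc, Real.rpow_natCast, div_eq_mul_inv]

theorem setIntegral_closedBall_norm_rpow {R : ℝ} (hR : 0 < R) (σ : ℝ) :
    ∫ x in closedBall (0 : 𝔼) R, ‖x‖ ^ (-σ) =
      R ^ (n - σ) * ∫ x in closedBall (0 : 𝔼) 1, ‖x‖ ^ (-σ) := by
  have h := setIntegral_comp_smul_mul_norm_rpow (fun _ : 𝔼 => 1) (closedBall 0 1) hR σ
  simp only [one_mul] at h
  rw [smul_closedBall' hR.ne', smul_zero, Real.norm_of_nonneg hR.le, mul_one] at h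
  rw [h, ← mul_assoc, ← Real.rpow_add hR]
  simp

theorem integrable_comp_smul_mul_norm_rpow {h : 𝔼 → ℝ} {σ : ℝ}
    (hi : Integrable fun x => h x * ‖x‖ ^ (-σ)) {c : ℝ} (hc : 0 < c) :
    Integrable fun x => h (c • x) * ‖x‖ ^ (-σ) := by
  simp_rw [comp_smul_mul_norm_rpow_eq h hc σ]
  exact (hi.comp_smul hc.ne').const_mul _

theorem integrableOn_closedBall_norm_rpow (hn : 1 ≤ n) {σ : ℝ} (hσ : σ < n) (R : ℝ) :
    IntegrableOn (fun x : 𝔼 => ‖x‖ ^ (-σ)) (closedBall 0 R) := by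
  have : IntegrableOn (fun x : 𝔼 => ‖x‖ ^ (-σ)) (ball 0 (R + 1)) := by
    refine integrableOn_ball_of_norm_le_rpow (C := 1) (α := σ) (by simpa using hn)
      (by simpa using hσ) ?_ ?_
    · refine Eventually.of_forall fun x => ?_
      rw [one_mul, Real.norm_of_nonneg (by positivity)]
    · exact (by fun_prop : Measurable fun x : 𝔼 => ‖x‖ ^ (-σ)).aestronglyMeasurable
  exact this.mono_set (closedBall_subset_ball (by linarith))

theorem setIntegral_closedBall_mul_norm_rpow_pos (hn : 1 ≤ n) {σ R : ℝ} (hR : 0 < R) {h : 𝔼 → ℝ}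
    (hh : ∀ x, 0 < h x) (hi : IntegrableOn (fun x => h x * ‖x‖ ^ (-σ)) (closedBall 0 R)) :
    0 < ∫ x in closedBall (0 : 𝔼) R, h x * ‖x‖ ^ (-σ) := by
  have : Nonempty (Fin n) := ⟨⟨0, hn⟩⟩
  rw [setIntegral_pos_iff_support_of_nonneg_ae
    (Eventually.of_forall fun x => by have := hh x; positivity) hi]
  have hsub : closedBall (0 : 𝔼) R \ {0} ⊆
      Function.support (fun x : 𝔼 => h x * ‖x‖ ^ (-σ)) ∩ closedBall 0 R := fun x hx =>
    ⟨(mul_pos (hh x) (Real.rpow_pos_of_pos (norm_pos_iff.2 hx.2) _)).ne', hx.1⟩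
  refine lt_of_lt_of_le ?_ (measure_mono hsub)
  rw [measure_sdiff_null (by simp)]
  exact measure_closedBall_pos _ _ hR

theorem setIntegral_closedBall_norm_rpow_pos (hn : 1 ≤ n) {σ : ℝ} (hσ : σ < n) {R : ℝ}
    (hR : 0 < R) : 0 < ∫ x in closedBall (0 : 𝔼) R, ‖x‖ ^ (-σ) := by
  simpa using setIntegral_closedBall_mul_norm_rpow_pos hn hR (h := fun _ => 1)
    (fun _ => one_pos) (by simpa using integrableOn_closedBall_norm_rpow hn hσ R)

/-- Lower bound of a Riesz-type potential of a radially decreasing density. -/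
theorem riesz_potential_lower_bound (hn : 1 ≤ n) {α σ q : ℝ} (hαn : α < n) (hσ : σ < α)
    (hq : 0 < q) {v : 𝔼 → ℝ} (hv : ∀ x, 0 < v x) (hmono : ∀ x y, ‖x‖ ≤ ‖y‖ → v y ≤ v x)
    {x : 𝔼} (hx : x ≠ 0)
    (hi : Integrable (fun y => v y ^ q * ‖x - y‖ ^ (α - (n : ℝ)) * ‖y‖ ^ (-σ))) :
    2 ^ (α - n) * (∫ y in closedBall (0 : 𝔼) 1, ‖y‖ ^ (-σ)) * ‖x‖ ^ (α - σ) * v x ^ q ≤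
      ∫ y, v y ^ q * ‖x - y‖ ^ (α - (n : ℝ)) * ‖y‖ ^ (-σ) := by
  have : Nonempty (Fin n) := ⟨⟨0, hn⟩⟩
  have hx0 : 0 < ‖x‖ := norm_pos_iff.2 hx
  have key : ∫ y in closedBall (0 : 𝔼) ‖x‖, v x ^ q * (2 * ‖x‖) ^ (α - (n : ℝ)) * ‖y‖ ^ (-σ) ≤
      ∫ y, v y ^ q * ‖x - y‖ ^ (α - (n : ℝ)) * ‖y‖ ^ (-σ) := by
    refine le_trans (setIntegral_mono_ae_restrict ?_ hi.integrableOn ?_)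
      (setIntegral_le_integral hi (Eventually.of_forall fun y => ?_))
    · exact (integrableOn_closedBall_norm_rpow hn (hσ.trans hαn) _).const_mul _
    · filter_upwards [ae_restrict_mem measurableSet_closedBall,
        ae_restrict_of_ae (compl_mem_ae_iff.2 (measure_singleton x))] with y hy hyx
      have hy' : ‖y‖ ≤ ‖x‖ := by simpa using hy
      have h0 : 0 < ‖x - y‖ := norm_pos_iff.2 (sub_ne_zero.2 fun h => hyx h.symm)
      have h2 : ‖x - y‖ ≤ 2 * ‖x‖ := (norm_sub_le x y).trans (by linarith)
      have hvy := hv y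
      gcongr ?_ * ?_ * _
      · exact Real.rpow_le_rpow (hv x).le (hmono _ _ hy') hq.le
      · exact Real.rpow_le_rpow_of_nonpos h0 h2 (by linarith)
    · have := hv y
      positivity
  refine le_trans (le_of_eq ?_) key
  rw [integral_const_mul, setIntegral_closedBall_norm_rpow hx0, Real.mul_rpow (by norm_num) hx0.le,
    show α - σ = (α - n) + (n - σ) by ring, Real.rpow_add hx0]
  ring

/-- Symmetry of the Riesz kernel, combined with a dilation by `c`. -/
theorem lintegral_riesz_duality {β c : ℝ} (hc : 0 < c) {f g u v : 𝔼 → ℝ}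
    (hf : ∀ x, 0 ≤ f x) (hg : ∀ x, 0 ≤ g x) (hfm : Measurable f) (hgm : Measurable g)
    (hfi : ∀ x, Integrable fun y => f y * ‖x - y‖ ^ β)
    (hgi : ∀ x, Integrable fun y => g y * ‖x - y‖ ^ β)
    (hu : ∀ x, u x = ∫ y, f y * ‖x - y‖ ^ β) (hv : ∀ x, v x = ∫ y, g y * ‖x - y‖ ^ β) :
    ∫⁻ x, ENNReal.ofReal (u (c • x) * g x) =
      ENNReal.ofReal (c ^ β) * ∫⁻ y, ENNReal.ofReal (f y * v (c⁻¹ • y)) := by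
  have hu' : ∀ x, ENNReal.ofReal (u (c • x) * g x) =
      ∫⁻ y, ENNReal.ofReal (f y * ‖c • x - y‖ ^ β * g x) := by
    intro x
    rw [hu, ← integral_mul_const,
      ofReal_integral_eq_lintegral_ofReal ((hfi _).mul_const _)
        (Eventually.of_forall fun y => by have := hf y; have := hg x; positivity)]
  have hv' : ∀ y, ENNReal.ofReal (c ^ β) * ENNReal.ofReal (f y * v (c⁻¹ • y)) =
      ∫⁻ x, ENNReal.ofReal (f y * ‖c • x - y‖ ^ β * g x) := by
    intro y
    rw [hv, ← ENNReal.ofReal_mul (by positivity), ← integral_const_mul, ← integral_const_mul,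
      ofReal_integral_eq_lintegral_ofReal (((hgi _).const_mul _).const_mul _)
        (Eventually.of_forall fun x => by have := hf y; have := hg x; positivity)]
    congr 1 with x
    have : ‖c • x - y‖ = c * ‖c⁻¹ • y - x‖ := by
      rw [norm_sub_rev (c⁻¹ • y), ← Real.norm_of_nonneg hc.le, ← norm_smul, smul_sub,
        Real.norm_of_nonneg hc.le, smul_inv_smul₀ hc.ne']
    rw [this, Real.mul_rpow hc.le (norm_nonneg _)]
    ring_nf
  simp_rw [hu']
  rw [lintegral_lintegral_swap (by fun_prop), ← lintegral_const_mul' _ _ ENNReal.ofReal_ne_top]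
  simp_rw [hv']

theorem integral_riesz_duality {β c : ℝ} (hc : 0 < c) {f g u v : 𝔼 → ℝ}
    (hf : ∀ x, 0 ≤ f x) (hg : ∀ x, 0 ≤ g x) (hfm : Measurable f) (hgm : Measurable g)
    (hfi : ∀ x, Integrable fun y => f y * ‖x - y‖ ^ β)
    (hgi : ∀ x, Integrable fun y => g y * ‖x - y‖ ^ β)
    (hu : ∀ x, u x = ∫ y, f y * ‖x - y‖ ^ β) (hv : ∀ x, v x = ∫ y, g y * ‖x - y‖ ^ β)
    (hum : Measurable u) (hi : Integrable fun y => f y * v (c⁻¹ • y)) :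
    Integrable (fun x => u (c • x) * g x) ∧
      ∫ x, u (c • x) * g x = c ^ β * ∫ y, f y * v (c⁻¹ • y) := by
  have hu0 : ∀ x, 0 ≤ u x := fun x => by
    rw [hu]; exact integral_nonneg fun y => mul_nonneg (hf y) (by positivity)
  have hv0 : ∀ x, 0 ≤ v x := fun x => by
    rw [hv]; exact integral_nonneg fun y => mul_nonneg (hg y) (by positivity)
  have h := lintegral_riesz_duality hc hf hg hfm hgm hfi hgi hu hv
  rw [← ofReal_integral_eq_lintegral_ofReal hi
    (Eventually.of_forall fun y => mul_nonneg (hf y) (hv0 _)),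
    ← ENNReal.ofReal_mul (by positivity)] at h
  have hm : AEStronglyMeasurable (fun x => u (c • x) * g x) volume :=
    (by fun_prop : Measurable fun x => u (c • x) * g x).aestronglyMeasurable
  have h0 : 0 ≤ᵐ[volume] fun x => u (c • x) * g x :=
    Eventually.of_forall fun x => mul_nonneg (hu0 _) (hg x)
  refine ⟨⟨hm, ?_⟩, ?_⟩
  · rw [hasFiniteIntegral_iff_ofReal h0, h]
    exact ENNReal.ofReal_lt_top
  · rw [integral_eq_lintegral_of_nonneg_ae h0 hm, h, ENNReal.toReal_ofReal]
    exact mul_nonneg (by positivity) (integral_nonneg fun y => mul_nonneg (hf y) (hv0 _))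

/-- Finite weighted energy of a function with power decay. -/
theorem integrable_rpow_mul_norm_rpow_of_decay (hn : 1 ≤ n) {σ m a C : ℝ} (hσ : σ < n)
    (hm : 0 < m) (ham : n < m * a + σ) {u : 𝔼 → ℝ} (hu : ∀ x, 0 < u x) (hc : Continuous u)
    (hmono : ∀ x y, ‖x‖ ≤ ‖y‖ → u y ≤ u x) (hC : 0 < C)
    (hdec : ∀ x, x ≠ 0 → u x ≤ C * ‖x‖ ^ (-a)) :
    Integrable fun x => u x ^ m * ‖x‖ ^ (-σ) := by
  have hmeas : Measurable fun x => u x ^ m * ‖x‖ ^ (-σ) := by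
    have := hc.measurable
    fun_prop
  have h1 : IntegrableOn (fun x => u x ^ m * ‖x‖ ^ (-σ)) (closedBall 0 1) := by
    refine Integrable.mono' ((integrableOn_closedBall_norm_rpow hn hσ 1).const_mul (u 0 ^ m))
      hmeas.aestronglyMeasurable (Eventually.of_forall fun x => ?_)
    have := hu x
    rw [Real.norm_of_nonneg (by positivity)]
    gcongr
    exact hmono _ _ (by simp)
  have h2 : IntegrableOn (fun x => u x ^ m * ‖x‖ ^ (-σ)) (closedBall 0 1)ᶜ := by
    have hr := (integrable_one_add_norm (E := 𝔼) (μ := volume) (r := m * a + σ)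
      (by simpa using ham)).const_mul (C ^ m * 2 ^ (m * a + σ))
    refine Integrable.mono' hr.integrableOn hmeas.aestronglyMeasurable ?_
    filter_upwards [ae_restrict_mem measurableSet_closedBall.compl] with x hx
    have hx1 : 1 < ‖x‖ := by simpa using hx
    have hx0 : 0 < ‖x‖ := by linarith
    have hux := hu x
    have hpos : 0 < m * a + σ := lt_of_le_of_lt (by positivity) ham
    rw [Real.norm_of_nonneg (by positivity)]
    calc u x ^ m * ‖x‖ ^ (-σ) ≤ (C * ‖x‖ ^ (-a)) ^ m * ‖x‖ ^ (-σ) := by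
          gcongr
          exact hdec x (norm_pos_iff.1 hx0)
      _ = C ^ m * ‖x‖ ^ (-(m * a + σ)) := by
          rw [Real.mul_rpow hC.le (by positivity), ← Real.rpow_mul hx0.le, mul_assoc,
            ← Real.rpow_add hx0]
          ring_nf
      _ = C ^ m * 2 ^ (m * a + σ) * (2 * ‖x‖) ^ (-(m * a + σ)) := by
          rw [Real.mul_rpow (by norm_num) hx0.le, Real.rpow_neg (by norm_num : (0 : ℝ) ≤ 2)]
          field_simp
      _ ≤ C ^ m * 2 ^ (m * a + σ) * (1 + ‖x‖) ^ (-(m * a + σ)) := by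
          gcongr ?_ * ?_
          exact Real.rpow_le_rpow_of_nonpos (by linarith) (by linarith) (by linarith)
  rw [← integrableOn_univ, ← Set.union_compl_self (closedBall (0 : 𝔼) 1)]
  exact h1.union h2

theorem integral_rpow_mul_comp_inv_smul_le {q σ c : ℝ} (hq : 0 < q) (hc : 0 < c) {v : 𝔼 → ℝ}
    (hv : ∀ x, 0 < v x) (hcont : Continuous v)
    (hi : Integrable fun x => v x ^ (q + 1) * ‖x‖ ^ (-σ)) :
    Integrable (fun x => v x ^ q * ‖x‖ ^ (-σ) * v (c⁻¹ • x)) ∧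
    ∫ x, v x ^ q * ‖x‖ ^ (-σ) * v (c⁻¹ • x) ≤
      (q + c ^ (n - σ)) / (q + 1) * ∫ x, v x ^ (q + 1) * ‖x‖ ^ (-σ) := by
  have hi' : Integrable fun x => v (c⁻¹ • x) ^ (q + 1) * ‖x‖ ^ (-σ) :=
    integrable_comp_smul_mul_norm_rpow (h := fun x => v x ^ (q + 1)) hi (inv_pos.2 hc)
  have hle : ∀ x, v x ^ q * ‖x‖ ^ (-σ) * v (c⁻¹ • x) ≤ (q + 1)⁻¹ *
      (q * (v x ^ (q + 1) * ‖x‖ ^ (-σ)) + v (c⁻¹ • x) ^ (q + 1) * ‖x‖ ^ (-σ)) := by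
    intro x
    have := mul_le_mul_of_nonneg_right (rpow_mul_le_of_young (hv x) (hv (c⁻¹ • x)) hq)
      (by positivity : 0 ≤ ‖x‖ ^ (-σ))
    calc _ = v x ^ q * v (c⁻¹ • x) * ‖x‖ ^ (-σ) := by ring
      _ ≤ _ := this
      _ = _ := by ring
  have hint := ((hi.const_mul q).add hi').const_mul (q + 1)⁻¹
  have hI : Integrable (fun x => v x ^ q * ‖x‖ ^ (-σ) * v (c⁻¹ • x)) := by
    refine Integrable.mono' hint ?_ (Eventually.of_forall fun x => ?_)
    · have := hcont.measurable
      exact (by fun_prop : Measurable _).aestronglyMeasurable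
    · have := hv x
      have := hv (c⁻¹ • x)
      rw [Real.norm_of_nonneg (by positivity)]
      exact hle x
  refine ⟨hI, (integral_mono hI hint hle).trans (le_of_eq ?_)⟩
  have h := setIntegral_comp_smul_mul_norm_rpow (fun x => v x ^ (q + 1)) Set.univ (inv_pos.2 hc) σ
  rw [Set.smul_set_univ₀ (inv_pos.2 hc).ne', setIntegral_univ, setIntegral_univ] at h
  simp only [Pi.add_apply]
  rw [integral_const_mul, integral_add (hi.const_mul q) hi', integral_const_mul, h,
    Real.inv_rpow hc.le, ← Real.rpow_neg hc.le, neg_sub]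
  ring

theorem le_integral_comp_smul_mul_rpow (hn : 1 ≤ n) {p σ c R κ D : ℝ} (hp : 0 < p)
    (hσ : σ < n) (hc : 0 < c) (hc1 : c < 1) (hR : 0 < R) (hκ : 0 < κ) {u : 𝔼 → ℝ}
    (hu : ∀ x, 0 < u x) (hmono : ∀ x y, ‖x‖ ≤ ‖y‖ → u y ≤ u x)
    (hi : Integrable fun x => u x ^ (p + 1) * ‖x‖ ^ (-σ))
    (hF : Integrable fun x => u (c • x) * (u x ^ p * ‖x‖ ^ (-σ)))
    (hκu : ∀ x ∈ closedBall (0 : 𝔼) R, κ * u (c • x) ^ p ≤ u x ^ p)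
    (hD : ∀ x, c * R < ‖x‖ → u x ^ (p + 1) ≤ D) :
    κ / (p + 1) * ((c ^ (σ - n) - 1) *
      ((∫ x in closedBall (0 : 𝔼) R, u x ^ (p + 1) * ‖x‖ ^ (-σ)) -
        D * (R ^ (n - σ) * ∫ x in closedBall (0 : 𝔼) 1, ‖x‖ ^ (-σ)))) ≤
      (∫ x, u (c • x) * (u x ^ p * ‖x‖ ^ (-σ))) - ∫ x, u x ^ (p + 1) * ‖x‖ ^ (-σ) := by
  have hcR : 0 < c * R := mul_pos hc hR
  have hlt : c * R ≤ R := by nlinarith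
  have hsub : closedBall (0 : 𝔼) (c * R) ⊆ closedBall 0 R := closedBall_subset_closedBall hlt
  have hpow : ∀ x, u x ^ (p + 1) = u x ^ p * u x := fun x => by
    rw [Real.rpow_add (hu x), Real.rpow_one]
  have hcmono : ∀ x, u x ≤ u (c • x) := fun x => hmono _ _ (by
    rw [norm_smul, Real.norm_of_nonneg hc.le]
    nlinarith [norm_nonneg x])
  have hic : Integrable fun x => u (c • x) ^ (p + 1) * ‖x‖ ^ (-σ) :=
    integrable_comp_smul_mul_norm_rpow (h := fun x => u x ^ (p + 1)) hi hc
  have hannulus : (∫ x in closedBall (0 : 𝔼) R, u x ^ (p + 1) * ‖x‖ ^ (-σ)) -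
      (∫ x in closedBall (0 : 𝔼) (c * R), u x ^ (p + 1) * ‖x‖ ^ (-σ)) ≤
      D * ((R ^ (n - σ) - (c * R) ^ (n - σ)) * ∫ x in closedBall (0 : 𝔼) 1, ‖x‖ ^ (-σ)) := by
    have hw := integrableOn_closedBall_norm_rpow hn hσ R
    rw [sub_mul, ← setIntegral_closedBall_norm_rpow hR, ← setIntegral_closedBall_norm_rpow hcR,
      ← setIntegral_sdiff measurableSet_closedBall hi.integrableOn hsub,
      ← setIntegral_sdiff measurableSet_closedBall hw hsub, ← integral_const_mul]
    refine setIntegral_mono_on hi.integrableOn ((hw.mono_set Set.sdiff_subset).const_mul D)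
      (measurableSet_closedBall.diff measurableSet_closedBall) fun x hx => ?_
    gcongr
    exact hD x (by simpa using hx.2)
  have hscale : ∫ x in closedBall (0 : 𝔼) R, u (c • x) ^ (p + 1) * ‖x‖ ^ (-σ) =
      c ^ (σ - n) * ∫ x in closedBall (0 : 𝔼) (c * R), u x ^ (p + 1) * ‖x‖ ^ (-σ) := by
    rw [setIntegral_comp_smul_mul_norm_rpow (fun x => u x ^ (p + 1)) _ hc σ,
      smul_closedBall' hc.ne', smul_zero, Real.norm_of_nonneg hc.le]
  have hlower : κ / (p + 1) *
      ((∫ x in closedBall (0 : 𝔼) R, u (c • x) ^ (p + 1) * ‖x‖ ^ (-σ)) -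
        ∫ x in closedBall (0 : 𝔼) R, u x ^ (p + 1) * ‖x‖ ^ (-σ)) ≤
      (∫ x, u (c • x) * (u x ^ p * ‖x‖ ^ (-σ))) - ∫ x, u x ^ (p + 1) * ‖x‖ ^ (-σ) := by
    rw [← integral_sub hic.integrableOn hi.integrableOn, ← integral_const_mul,
      ← integral_sub hF hi]
    refine le_trans (setIntegral_mono_on ((hic.sub hi).const_mul _).integrableOn
      (hF.sub hi).integrableOn measurableSet_closedBall fun x hx => ?_)
      (setIntegral_le_integral (hF.sub hi) (Eventually.of_forall fun x => ?_))
    · have hy := rpow_mul_le_of_young (hu (c • x)) (hu x) hp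
      have hk := hκu x hx
      rw [hpow, hpow] at *
      have hdiff := sub_nonneg.2 (hcmono x)
      have hmain : κ / (p + 1) * (u (c • x) ^ p * u (c • x) - u x ^ p * u x) ≤
          (u (c • x) - u x) * u x ^ p := by
        refine le_trans ?_ (mul_le_mul_of_nonneg_left hk hdiff)
        rw [le_div_iff₀ (by positivity)] at hy
        rw [div_mul_eq_mul_div, div_le_iff₀ (by positivity)]
        nlinarith
      calc _ = κ / (p + 1) * (u (c • x) ^ p * u (c • x) - u x ^ p * u x) * ‖x‖ ^ (-σ) := by ring
        _ ≤ (u (c • x) - u x) * u x ^ p * ‖x‖ ^ (-σ) := by gcongr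
        _ = _ := by simp only [Pi.sub_apply]; rw [hpow]; ring
    · have hdiff := sub_nonneg.2 (hcmono x)
      have hux := hu x
      have : 0 ≤ (u (c • x) - u x) * (u x ^ p * ‖x‖ ^ (-σ)) := by positivity
      simp only [Pi.zero_apply, Pi.sub_apply]
      rw [hpow]
      linarith
  refine le_trans ?_ hlower
  rw [hscale]
  gcongr
  set J := ∫ x in closedBall (0 : 𝔼) R, u x ^ (p + 1) * ‖x‖ ^ (-σ)
  set J' := ∫ x in closedBall (0 : 𝔼) (c * R), u x ^ (p + 1) * ‖x‖ ^ (-σ)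
  set W := ∫ x in closedBall (0 : 𝔼) 1, ‖x‖ ^ (-σ)
  have hcs : 0 < c ^ (σ - n) := Real.rpow_pos_of_pos hc _
  have hinv : c ^ (σ - n) * c ^ (n - σ) = 1 := by
    rw [← Real.rpow_add hc]; simp
  rw [Real.mul_rpow hc.le hR.le] at hannulus
  have := mul_le_mul_of_nonneg_left hannulus hcs.le
  have e : c ^ (σ - n) * (D * ((R ^ (n - σ) - c ^ (n - σ) * R ^ (n - σ)) * W)) =
      (c ^ (σ - n) - c ^ (σ - n) * c ^ (n - σ)) * (D * (R ^ (n - σ) * W)) := by ring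
  rw [e, hinv] at this
  nlinarith

end

theorem eventually_lt_of_hasDerivAt_pos {φ : ℝ → ℝ} {d x : ℝ} (h : HasDerivAt φ d x)
    (hd : 0 < d) : ∀ᶠ y in 𝓝[<] x, φ y < φ x := by
  have h1 := (hasDerivAt_iff_tendsto_slope.1 h).eventually (lt_mem_nhds hd)
  have h2 := h1.filter_mono (nhdsWithin_mono x (fun y (hy : y < x) => hy.ne))
  filter_upwards [h2, self_mem_nhdsWithin] with y hy hyx
  rw [slope_def_field] at hy
  have hyx' : y - x < 0 := sub_neg.2 hyx
  by_contra! hle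
  exact absurd hy (not_lt.2 (div_nonpos_of_nonneg_of_nonpos (by linarith) hyx'.le))

theorem eventually_left_lt_of_exponents {β s₁ s₂ p q κ : ℝ} (hq : 0 < q)
    (h : 0 < β + s₁ / (q + 1) + κ * s₂ / (p + 1)) :
    ∀ᶠ c : ℝ in 𝓝[<] 1,
      c ^ β * ((q + c ^ s₁) / (q + 1)) - 1 < κ / (p + 1) * (c ^ (-s₂) - 1) := by
  have hr : ∀ t : ℝ, HasDerivAt (fun c : ℝ => c ^ t) t 1 := fun t => by
    simpa using Real.hasDerivAt_rpow_const (x := 1) (p := t) (Or.inl one_ne_zero)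
  have hd := (((hr β).mul (((hr s₁).const_add q).div_const (q + 1))).sub_const 1).sub
    (((hr (-s₂)).sub_const 1).const_mul (κ / (p + 1)))
  have hq1 : q + 1 ≠ 0 := by positivity
  have := eventually_lt_of_hasDerivAt_pos hd (by
    simp only [Real.one_rpow, div_self hq1]
    calc _ < _ := h
      _ = _ := by ring)
  filter_upwards [this] with c hc
  simp [div_self hq1] at hc
  linarith

theorem exists_power_lower_bound {n : ℕ} {A₁ A₂ c₁ c₂ p q : ℝ} (hq : 0 < q)
    (hc₁ : 0 < c₁) (hc₂ : 0 < c₂) {u v : EuclideanSpace ℝ (Fin n) → ℝ}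
    (hu : ∀ x, 0 < u x)
    (h₁ : ∀ x, x ≠ 0 → c₁ * ‖x‖ ^ A₁ * v x ^ q ≤ u x)
    (h₂ : ∀ x, x ≠ 0 → c₂ * ‖x‖ ^ A₂ * u x ^ p ≤ v x) :
    ∃ c > 0, ∀ x, x ≠ 0 → c * ‖x‖ ^ (A₁ + q * A₂) ≤ u x ^ (1 - p * q) := by
  refine ⟨c₁ * c₂ ^ q, by positivity, fun x hx => ?_⟩
  have hx0 : 0 < ‖x‖ := norm_pos_iff.2 hx
  have hux := hu x
  have h3 : c₁ * ‖x‖ ^ A₁ * (c₂ * ‖x‖ ^ A₂ * u x ^ p) ^ q ≤ u x := by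
    refine le_trans ?_ (h₁ x hx)
    gcongr
    exact h₂ x hx
  rw [Real.mul_rpow (by positivity) (by positivity), Real.mul_rpow (by positivity) (by positivity),
    ← Real.rpow_mul hx0.le, ← Real.rpow_mul hux.le] at h3
  rw [Real.rpow_sub hux, Real.rpow_one, le_div_iff₀ (by positivity), Real.rpow_add hx0,
    mul_comm q A₂]
  calc _ = _ := by ring
    _ ≤ _ := h3

theorem exists_power_decay {n : ℕ} {N e c : ℝ} (he : 1 < e) (hc : 0 < c)
    {u : EuclideanSpace ℝ (Fin n) → ℝ} (hu : ∀ x, 0 < u x)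
    (h : ∀ x, x ≠ 0 → c * ‖x‖ ^ N ≤ u x ^ (1 - e)) :
    ∃ C > 0, ∀ x, x ≠ 0 → u x ≤ C * ‖x‖ ^ (-(N / (e - 1))) := by
  refine ⟨c ^ (-(1 / (e - 1))), by positivity, fun x hx => ?_⟩
  have hx0 : 0 < ‖x‖ := norm_pos_iff.2 hx
  have he' : 0 < e - 1 := by linarith
  have h1 := Real.rpow_le_rpow_of_nonpos (by positivity) (h x hx)
    (by simpa using he'.le : -(1 / (e - 1)) ≤ 0)
  rw [← Real.rpow_mul (hu x).le, Real.mul_rpow hc.le (by positivity), ← Real.rpow_mul hx0.le,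
    show (1 - e) * -(1 / (e - 1)) = 1 by field_simp; ring, Real.rpow_one] at h1
  convert h1 using 3
  ring

/-- Local comparison of `u` with its dilations near the identity, uniform on balls. -/
theorem eventually_forall_closedBall_comp_smul {n : ℕ} {u : EuclideanSpace ℝ (Fin n) → ℝ}
    (hu : ∀ x, 0 < u x) (hcont : Continuous u) {p κ : ℝ} (hκ : κ < 1) (R : ℝ) :
    ∀ᶠ c : ℝ in 𝓝 1, ∀ x ∈ closedBall (0 : EuclideanSpace ℝ (Fin n)) R,
      κ * u (c • x) ^ p ≤ u x ^ p := by
  refine (isCompact_closedBall _ _).eventually_forall_of_forall_eventually fun x _ => ?_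
  have h1 : Continuous fun z : ℝ × EuclideanSpace ℝ (Fin n) => κ * u (z.1 • z.2) ^ p :=
    continuous_const.mul ((hcont.comp (continuous_fst.smul continuous_snd)).rpow_const
      fun z => Or.inl (hu _).ne')
  have h2 : Continuous fun z : ℝ × EuclideanSpace ℝ (Fin n) => u z.2 ^ p :=
    (hcont.comp continuous_snd).rpow_const fun z => Or.inl (hu _).ne'
  have hlt : κ * u ((1 : ℝ) • x) ^ p < u x ^ p := by
    have := Real.rpow_pos_of_pos (hu x) p
    rw [one_smul]
    nlinarith
  exact (h1.continuousAt.eventually_lt h2.continuousAt hlt).mono fun z hz => hz.le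

theorem exists_closedBall_energy_gt {n : ℕ} {σ p a C κ : ℝ} (hC : 0 < C)
    (hκ : κ < 1) (ham : n < (p + 1) * a + σ) {u : EuclideanSpace ℝ (Fin n) → ℝ}
    (hB : 0 < ∫ x, u x ^ (p + 1) * ‖x‖ ^ (-σ))
    (hi : Integrable fun x => u x ^ (p + 1) * ‖x‖ ^ (-σ)) :
    ∃ R > 0, κ * (∫ x, u x ^ (p + 1) * ‖x‖ ^ (-σ)) ≤
      (∫ x in closedBall (0 : EuclideanSpace ℝ (Fin n)) R, u x ^ (p + 1) * ‖x‖ ^ (-σ)) -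
        (C * (R / 2) ^ (-a)) ^ (p + 1) * (R ^ (n - σ) *
          ∫ x in closedBall (0 : EuclideanSpace ℝ (Fin n)) 1, ‖x‖ ^ (-σ)) := by
  set W := ∫ x in closedBall (0 : EuclideanSpace ℝ (Fin n)) 1, ‖x‖ ^ (-σ)
  have h1 := (aecover_closedBall (μ := volume) (x := (0 : EuclideanSpace ℝ (Fin n)))
    (tendsto_id (α := ℝ) (x := atTop))).integral_tendsto_of_countably_generated hi
  have h2 : Tendsto (fun R : ℝ => C ^ (p + 1) * 2 ^ (a * (p + 1)) * W *
      R ^ (-((p + 1) * a + σ - n))) atTop (𝓝 0) := by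
    simpa using (tendsto_rpow_neg_atTop (by linarith : 0 < (p + 1) * a + σ - n)).const_mul
      (C ^ (p + 1) * 2 ^ (a * (p + 1)) * W)
  have h3 := (h1.sub h2).eventually
    (lt_mem_nhds (by nlinarith : κ * (∫ x, u x ^ (p + 1) * ‖x‖ ^ (-σ)) < _ - 0))
  obtain ⟨R, hR, hR0⟩ := (h3.and (eventually_gt_atTop 0)).exists
  refine ⟨R, hR0, hR.le.trans (le_of_eq ?_)⟩
  rw [Real.mul_rpow hC.le (by positivity), ← Real.rpow_mul (by positivity),
    Real.div_rpow hR0.le (by norm_num),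
    show -((p + 1) * a + σ - n) = -a * (p + 1) + (n - σ) by ring, Real.rpow_add hR0,
    show -a * (p + 1) = -(a * (p + 1)) by ring, Real.rpow_neg (by norm_num : (0 : ℝ) ≤ 2)]
  simp only [id]
  field_simp

/-- Pohozaev-type obstruction: in the subcritical range the system admits no solution of finite
energy. -/
theorem riesz_system_false {n : ℕ} (hn : 1 ≤ n) {α σ₁ σ₂ p q a C : ℝ}
    (hσ₂ : σ₂ < n) (hp : 0 < p) (hq : 0 < q)
    (hsub : (n : ℝ) - α < ((n : ℝ) - σ₁) / (1 + q) + ((n : ℝ) - σ₂) / (1 + p))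
    {u v : EuclideanSpace ℝ (Fin n) → ℝ} (hu : ∀ x, 0 < u x) (hv : ∀ x, 0 < v x)
    (hmono : ∀ x y, ‖x‖ ≤ ‖y‖ → u y ≤ u x) (huc : Continuous u) (hvc : Continuous v)
    (hui : ∀ x, Integrable fun y => v y ^ q * ‖y‖ ^ (-σ₁) * ‖x - y‖ ^ (α - (n : ℝ)))
    (hvi : ∀ x, Integrable fun y => u y ^ p * ‖y‖ ^ (-σ₂) * ‖x - y‖ ^ (α - (n : ℝ)))
    (hue : ∀ x, u x = ∫ y, v y ^ q * ‖y‖ ^ (-σ₁) * ‖x - y‖ ^ (α - (n : ℝ)))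
    (hve : ∀ x, v x = ∫ y, u y ^ p * ‖y‖ ^ (-σ₂) * ‖x - y‖ ^ (α - (n : ℝ)))
    (ham : n < (p + 1) * a + σ₂) (ha : 0 < a) (hC : 0 < C)
    (hdec : ∀ x, x ≠ 0 → u x ≤ C * ‖x‖ ^ (-a)) : False := by
  have hum := huc.measurable
  have hvm := hvc.measurable
  have hfm : Measurable fun y => v y ^ q * ‖y‖ ^ (-σ₁) := by fun_prop
  have hgm : Measurable fun y => u y ^ p * ‖y‖ ^ (-σ₂) := by fun_prop
  have hf : ∀ y, 0 ≤ v y ^ q * ‖y‖ ^ (-σ₁) := fun y => by have := hv y; positivity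
  have hg : ∀ y, 0 ≤ u y ^ p * ‖y‖ ^ (-σ₂) := fun y => by have := hu y; positivity
  have hi : Integrable fun x => u x ^ (p + 1) * ‖x‖ ^ (-σ₂) :=
    integrable_rpow_mul_norm_rpow_of_decay hn hσ₂ (by linarith) ham hu huc hmono hC hdec
  have hpowu : ∀ x, u x ^ p * ‖x‖ ^ (-σ₂) * u x = u x ^ (p + 1) * ‖x‖ ^ (-σ₂) := fun x => by
    rw [Real.rpow_add (hu x), Real.rpow_one]; ring
  have hpowv : ∀ x, v x * (v x ^ q * ‖x‖ ^ (-σ₁)) = v x ^ (q + 1) * ‖x‖ ^ (-σ₁) := fun x => by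
    rw [Real.rpow_add (hv x), Real.rpow_one]; ring
  have hAB := integral_riesz_duality one_pos hg hf hgm hfm hvi hui hve hue hvm
    (by simpa [hpowu] using hi)
  simp only [inv_one, one_smul, Real.one_rpow, one_mul, hpowu, hpowv] at hAB
  have hB : 0 < ∫ x, u x ^ (p + 1) * ‖x‖ ^ (-σ₂) := by
    refine lt_of_lt_of_le ?_ (setIntegral_le_integral (s := closedBall 0 1) hi
      (Eventually.of_forall fun x => by have := hu x; positivity))
    exact setIntegral_closedBall_mul_norm_rpow_pos hn one_pos
      (fun x => Real.rpow_pos_of_pos (hu x) _) hi.integrableOn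
  set B := ∫ x, u x ^ (p + 1) * ‖x‖ ^ (-σ₂)
  obtain ⟨κ, hκ0, hκ1, hκ⟩ : ∃ κ : ℝ, 0 < κ ∧ κ < 1 ∧
      0 < (α - n) + (n - σ₁) / (q + 1) + κ * κ * (n - σ₂) / (p + 1) := by
    have hcont : Continuous fun κ : ℝ =>
        (α - n) + (n - σ₁) / (q + 1) + κ * κ * (n - σ₂) / (p + 1) := by fun_prop
    have h1 : 0 < (α - n) + (n - σ₁) / (q + 1) + 1 * 1 * (n - σ₂) / (p + 1) := by
      rw [add_comm q, add_comm p, one_mul, one_mul]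
      linarith
    have h2 := hcont.continuousAt.eventually (lt_mem_nhds h1)
    have h3 : ∀ᶠ κ : ℝ in 𝓝[<] 1, 0 < κ :=
      (lt_mem_nhds one_pos).filter_mono nhdsWithin_le_nhds
    obtain ⟨κ, ⟨hk, hk0⟩, hk1⟩ :=
      (((h2.filter_mono nhdsWithin_le_nhds).and h3).and self_mem_nhdsWithin).exists
    exact ⟨κ, hk0, hk1, hk⟩
  obtain ⟨R, hR, hRB⟩ := exists_closedBall_energy_gt hC hκ1 ham hB hi
  have hev := ((eventually_forall_closedBall_comp_smul hu huc (p := p) hκ1 R).and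
    (lt_mem_nhds (by norm_num : (1 / 2 : ℝ) < 1))).filter_mono
      (nhdsWithin_le_nhds (s := Set.Iio 1))
  obtain ⟨c, ⟨⟨hcu, hc2⟩, hcφ⟩, hc1⟩ :=
    ((hev.and (eventually_left_lt_of_exponents hq hκ)).and self_mem_nhdsWithin).exists
  have hc1 : c < 1 := hc1
  have hc : 0 < c := by linarith
  obtain ⟨hHi, hH⟩ := integral_rpow_mul_comp_inv_smul_le hq hc hv hvc hAB.1
  obtain ⟨hFi, hF⟩ := integral_riesz_duality hc hf hg hfm hgm hui hvi hue hve hum hHi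
  have hlow := le_integral_comp_smul_mul_rpow hn (D := (C * (R / 2) ^ (-a)) ^ (p + 1)) hp hσ₂ hc
    hc1 hR hκ0 hu hmono hi hFi hcu (fun x hx => by
      have hRx : R / 2 < ‖x‖ := by nlinarith
      have hx0 : 0 < ‖x‖ := by linarith
      have hux := hu x
      refine Real.rpow_le_rpow hux.le ((hdec x (norm_pos_iff.1 hx0)).trans ?_) (by linarith)
      gcongr ?_ * ?_
      exact Real.rpow_le_rpow_of_nonpos (by positivity) hRx.le (by linarith))
  have hcs : 1 ≤ c ^ (σ₂ - n) :=
    Real.one_le_rpow_of_pos_of_le_one_of_nonpos hc hc1.le (by linarith)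
  have h1 : κ / (p + 1) * ((c ^ (σ₂ - n) - 1) * (κ * B)) ≤
      c ^ (α - n) * ((q + c ^ (n - σ₁)) / (q + 1) * B) - B := by
    refine le_trans ?_ (hlow.trans ?_)
    · have := sub_nonneg.2 hcs
      gcongr
    · rw [hF]
      gcongr
      rwa [← hAB.2]
  rw [neg_sub] at hcφ
  have := mul_lt_mul_of_pos_right hcφ hB
  have e : κ * κ / (p + 1) * (c ^ (σ₂ - n) - 1) * B =
    κ / (p + 1) * ((c ^ (σ₂ - n) - 1) * (κ * B)) := by ring
  linarith

theorem RadiallyDecreasing.le_of_norm_le {n : ℕ} {w : EuclideanSpace ℝ (Fin n) → ℝ}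
    (h : RadiallyDecreasing w) {x y : EuclideanSpace ℝ (Fin n)} (hxy : ‖x‖ ≤ ‖y‖) :
    w y ≤ w x := by
  obtain ⟨W, hW, -, hw⟩ := h
  rw [hw, hw]
  exact hW (norm_nonneg x) (norm_nonneg y) hxy

theorem stmt_7 (n : ℕ) (hn : 3 ≤ n) (α σ₁ σ₂ p q : ℝ)
    (hα2 : 2 ≤ α) (hαn : α < n) (hσ₁ : σ₁ < α) (hσ₂ : σ₂ < α)
    (hp : 0 < p) (hq : 0 < q)
    (hcond : p * q ≤ 1 ∨
      (1 < p * q ∧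
        (n : ℝ) - α < ((n : ℝ) - σ₁) / (1 + q) + ((n : ℝ) - σ₂) / (1 + p))) :
    ¬ ∃ u v : EuclideanSpace ℝ (Fin n) → ℝ,
      (∀ x, 0 < u x) ∧ (∀ x, 0 < v x) ∧
      RadiallyDecreasing u ∧ RadiallyDecreasing v ∧
      Continuous u ∧ Continuous v ∧
      ContDiffOn ℝ 1 u {(0 : EuclideanSpace ℝ (Fin n))}ᶜ ∧
      ContDiffOn ℝ 1 v {(0 : EuclideanSpace ℝ (Fin n))}ᶜ ∧
      ∀ x : EuclideanSpace ℝ (Fin n),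
        Integrable (fun y => v y ^ q * ‖x - y‖ ^ (α - (n : ℝ)) * ‖y‖ ^ (-σ₁)) ∧
        Integrable (fun y => u y ^ p * ‖x - y‖ ^ (α - (n : ℝ)) * ‖y‖ ^ (-σ₂)) ∧
        u x = (∫ y, v y ^ q * ‖x - y‖ ^ (α - (n : ℝ)) * ‖y‖ ^ (-σ₁)) ∧
        v x = (∫ y, u y ^ p * ‖x - y‖ ^ (α - (n : ℝ)) * ‖y‖ ^ (-σ₂)) := by
  rintro ⟨u, v, hu, hv, hru, hrv, huc, hvc, -, -, hsys⟩
  have hn1 : 1 ≤ n := by omega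
  have hW₁ := setIntegral_closedBall_norm_rpow_pos hn1 (hσ₁.trans hαn) one_pos
  have hW₂ := setIntegral_closedBall_norm_rpow_pos hn1 (hσ₂.trans hαn) one_pos
  obtain ⟨c, hc, hcu⟩ := exists_power_lower_bound hq
    (mul_pos (by positivity : (0 : ℝ) < 2 ^ (α - n)) hW₁)
    (mul_pos (by positivity : (0 : ℝ) < 2 ^ (α - n)) hW₂) hu
    (fun x hx => (riesz_potential_lower_bound hn1 hαn hσ₁ hq hv
      (fun _ _ => hrv.le_of_norm_le) hx (hsys x).1).trans_eq (hsys x).2.2.1.symm)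
    (fun x hx => (riesz_potential_lower_bound hn1 hαn hσ₂ hp hu
      (fun _ _ => hru.le_of_norm_le) hx (hsys x).2.1).trans_eq (hsys x).2.2.2.symm)
  have hN : 0 < α - σ₁ + q * (α - σ₂) := by
    have := mul_pos hq (sub_pos.2 hσ₂)
    linarith
  rcases hcond with hpq | ⟨hpq, hsub⟩
  · obtain ⟨r, hr, hr0⟩ := (((tendsto_rpow_atTop hN).eventually_gt_atTop
      (u 0 ^ (1 - p * q) / c)).and (eventually_gt_atTop 0)).exists
    let x : EuclideanSpace ℝ (Fin n) := EuclideanSpace.single ⟨0, hn1⟩ r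
    have hxr : ‖x‖ = r := by simp [x, abs_of_pos hr0]
    have hx0 : x ≠ 0 := norm_pos_iff.1 (by rw [hxr]; exact hr0)
    have h := hcu x hx0
    rw [hxr] at h
    have h' : u x ^ (1 - p * q) ≤ u 0 ^ (1 - p * q) :=
      Real.rpow_le_rpow (hu x).le (hru.le_of_norm_le (by simp)) (by linarith)
    rw [div_lt_iff₀ hc] at hr
    linarith
  · obtain ⟨C, hC, hdec⟩ := exists_power_decay hpq hc hu hcu
    have hpq' : 0 < p * q - 1 := by linarith
    refine riesz_system_false hn1 (hσ₂.trans hαn) hp hq hsub hu hv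
      (fun _ _ => hru.le_of_norm_le) huc hvc ?_ ?_ ?_ ?_ ?_ (div_pos hN hpq') hC hdec
    · exact fun x => by simpa only [mul_right_comm] using (hsys x).1
    · exact fun x => by simpa only [mul_right_comm] using (hsys x).2.1
    · exact fun x => by simpa only [mul_right_comm] using (hsys x).2.2.1
    · exact fun x => by simpa only [mul_right_comm] using (hsys x).2.2.2
    · rw [div_add_div _ _ (by positivity) (by positivity), lt_div_iff₀ (by positivity)] at hsub
      rw [← sub_lt_iff_lt_add, ← mul_div_assoc, lt_div_iff₀ hpq']
      nlinarith
end
end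

section
/- Let n ≥ 3, α ∈ [2,n), σ < α and p > 1. Suppose u is a positive radially decreasing continuous function on ℝⁿ such that for every x ∈ ℝⁿ the integral ∫_{ℝⁿ} u(y)^p |x−y|^{α−n} |y|^{−σ} dy is finite and u(x) = ∫_{ℝⁿ} u(y)^p |x−y|^{α−n} |y|^{−σ} dy. Then there exists a constant C > 0 such that u(x) ≤ C |x|^{−(α−σ)/(p−1)} for all x ≠ 0. -/
open MeasureTheory

noncomputable section

/-- Lower bound for the Riesz-type integral of a radially decreasing function, obtained by
restricting to the ball of radius `‖x‖ / 4` around the midpoint of `0` and `x`. -/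
lemma RadiallyDecreasing.mul_rpow_le_integral {n : ℕ} {α σ p : ℝ} (hαn : α ≤ n) (hp : 0 ≤ p)
    {u : EuclideanSpace ℝ (Fin n) → ℝ} (hu : RadiallyDecreasing u)
    {x : EuclideanSpace ℝ (Fin n)} (hx : x ≠ 0)
    (hint : Integrable (fun y => u y ^ p * ‖x - y‖ ^ (α - (n : ℝ)) * ‖y‖ ^ (-σ))) :
    ((1 / 4 : ℝ) ^ |σ| * ((1 / 4 : ℝ) ^ n *
      volume.real (Metric.ball (0 : EuclideanSpace ℝ (Fin n)) 1))) * (u x ^ p * ‖x‖ ^ (α - σ)) ≤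
      ∫ y, u y ^ p * ‖x - y‖ ^ (α - (n : ℝ)) * ‖y‖ ^ (-σ) := by
  obtain ⟨W, hanti, hWpos, hW⟩ := hu
  have hupos : ∀ y, 0 < u y := fun y => hW y ▸ hWpos _ (norm_nonneg y)
  have hr : 0 < ‖x‖ := norm_pos_iff.mpr hx
  set c : EuclideanSpace ℝ (Fin n) := (1 / 2 : ℝ) • x with hc
  have hcn : ‖c‖ = ‖x‖ / 2 := by
    rw [hc, norm_smul, Real.norm_of_nonneg (by norm_num)]; ring
  have hxc : ‖x - c‖ = ‖x‖ / 2 := by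
    have h : x - c = c := by rw [hc]; module
    rw [h, hcn]
  set B := Metric.ball c (‖x‖ / 4) with hB
  set k : ℝ := u x ^ p * ‖x‖ ^ (α - (n : ℝ)) * ((1 / 4 : ℝ) ^ |σ| * ‖x‖ ^ (-σ)) with hk
  have hpt : ∀ y ∈ B, k ≤ u y ^ p * ‖x - y‖ ^ (α - (n : ℝ)) * ‖y‖ ^ (-σ) := by
    intro y hy
    rw [hB, mem_ball_iff_norm] at hy
    have hy_lower : ‖x‖ / 4 ≤ ‖y‖ := by
      have := norm_sub_norm_le c y
      rw [norm_sub_rev] at this; linarith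
    have hy_upper : ‖y‖ ≤ ‖x‖ := by
      have := norm_sub_norm_le y c
      linarith
    have hxy_upper : ‖x - y‖ ≤ ‖x‖ := by
      have := norm_sub_le_norm_sub_add_norm_sub x c y
      rw [norm_sub_rev c y] at this; linarith
    have hxy_pos : 0 < ‖x - y‖ := by
      have := norm_sub_le_norm_sub_add_norm_sub x y c
      linarith
    have hu_le : u x ≤ u y := by
      rw [hW, hW]
      exact hanti (norm_nonneg y) (norm_nonneg x) hy_upper
    have hkernel : ‖x‖ ^ (α - (n : ℝ)) ≤ ‖x - y‖ ^ (α - (n : ℝ)) :=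
      Real.rpow_le_rpow_of_nonpos hxy_pos hxy_upper (by linarith)
    have hweight : (1 / 4 : ℝ) ^ |σ| * ‖x‖ ^ (-σ) ≤ ‖y‖ ^ (-σ) := by
      have ht : 0 < ‖y‖ / ‖x‖ := by
        apply div_pos _ hr; linarith
      have ht_lower : 1 / 4 ≤ ‖y‖ / ‖x‖ := by rw [le_div_iff₀ hr]; linarith
      have ht_upper : ‖y‖ / ‖x‖ ≤ 1 := by rwa [div_le_one hr]
      calc (1 / 4 : ℝ) ^ |σ| * ‖x‖ ^ (-σ)
          ≤ (‖y‖ / ‖x‖) ^ |σ| * ‖x‖ ^ (-σ) := by gcongr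
        _ ≤ (‖y‖ / ‖x‖) ^ (-σ) * ‖x‖ ^ (-σ) :=
            mul_le_mul_of_nonneg_right
              (Real.rpow_le_rpow_of_exponent_ge ht ht_upper (neg_le_abs σ)) (by positivity)
        _ = ‖y‖ ^ (-σ) := by
            rw [← Real.mul_rpow ht.le hr.le, div_mul_cancel₀ _ hr.ne']
    have := (hupos x).le
    have := (hupos y).le
    rw [hk]
    gcongr
  have hvol : volume.real B = ‖x‖ ^ n *
      ((1 / 4 : ℝ) ^ n * volume.real (Metric.ball (0 : EuclideanSpace ℝ (Fin n)) 1)) := by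
    rw [hB, Measure.real, Measure.addHaar_ball_of_pos _ _ (by positivity), ENNReal.toReal_mul,
      ENNReal.toReal_ofReal (by positivity), finrank_euclideanSpace_fin, Measure.real,
      div_eq_mul_one_div, mul_pow, mul_assoc]
  calc ((1 / 4 : ℝ) ^ |σ| * ((1 / 4 : ℝ) ^ n *
      volume.real (Metric.ball (0 : EuclideanSpace ℝ (Fin n)) 1))) * (u x ^ p * ‖x‖ ^ (α - σ))
      = k * volume.real B := by
        have hpow : ‖x‖ ^ (α - σ) = ‖x‖ ^ (α - (n : ℝ)) * ‖x‖ ^ (-σ) * ‖x‖ ^ n := by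
          rw [← Real.rpow_natCast, ← Real.rpow_add hr, ← Real.rpow_add hr]
          congr 1; ring
        rw [hvol, hpow, hk]; ring
    _ = ∫ _ in B, k := by rw [setIntegral_const, smul_eq_mul, mul_comm]
    _ ≤ ∫ y in B, u y ^ p * ‖x - y‖ ^ (α - (n : ℝ)) * ‖y‖ ^ (-σ) :=
        setIntegral_mono_on (integrableOn_const measure_ball_lt_top.ne) hint.integrableOn
          measurableSet_ball hpt
    _ ≤ ∫ y, u y ^ p * ‖x - y‖ ^ (α - (n : ℝ)) * ‖y‖ ^ (-σ) :=
        setIntegral_le_integral hint (Filter.Eventually.of_forall fun y => by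
          have := (hupos y).le
          positivity)

/-- A positive `a` with `c * (a ^ p * r ^ s) ≤ a` decays like `r ^ (-s / (p - 1))`. -/
lemma le_mul_rpow_of_mul_rpow_le {a c r s p : ℝ} (ha : 0 < a) (hc : 0 < c) (hr : 0 < r)
    (hp : 1 < p) (h : c * (a ^ p * r ^ s) ≤ a) :
    a ≤ (c⁻¹) ^ (1 / (p - 1)) * r ^ (-s / (p - 1)) := by
  have hp1 : 0 < p - 1 := by linarith
  have hrs : 0 < r ^ s := Real.rpow_pos_of_pos hr s
  have hsplit : a ^ p = a ^ (p - 1) * a := by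
    rw [Real.rpow_sub_one ha.ne', div_mul_cancel₀ _ ha.ne']
  have hle : c * r ^ s * a ^ (p - 1) ≤ 1 := by
    refine le_of_mul_le_mul_right ?_ ha
    rw [hsplit] at h
    linarith
  have hpow : a ^ (p - 1) ≤ c⁻¹ * r ^ (-s) := by
    rw [Real.rpow_neg hr.le, ← mul_inv, ← one_div, le_div_iff₀ (by positivity)]
    linarith
  calc a = (a ^ (p - 1)) ^ (1 / (p - 1)) := by
        rw [← Real.rpow_mul ha.le, mul_one_div_cancel hp1.ne', Real.rpow_one]
    _ ≤ (c⁻¹ * r ^ (-s)) ^ (1 / (p - 1)) := by gcongr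
    _ = (c⁻¹) ^ (1 / (p - 1)) * r ^ (-s / (p - 1)) := by
        rw [Real.mul_rpow (by positivity) (by positivity), ← Real.rpow_mul hr.le, mul_one_div]

theorem stmt_8 (n : ℕ) (hn : 3 ≤ n) (α σ p : ℝ)
    (hα2 : 2 ≤ α) (hαn : α < n) (hσ : σ < α) (hp : 1 < p)
    (u : EuclideanSpace ℝ (Fin n) → ℝ)
    (hupos : ∀ x, 0 < u x) (hurad : RadiallyDecreasing u) (hucont : Continuous u)
    (hsol : ∀ x : EuclideanSpace ℝ (Fin n),
      Integrable (fun y => u y ^ p * ‖x - y‖ ^ (α - (n : ℝ)) * ‖y‖ ^ (-σ)) ∧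
      u x = ∫ y, u y ^ p * ‖x - y‖ ^ (α - (n : ℝ)) * ‖y‖ ^ (-σ)) :
    ∃ C : ℝ, 0 < C ∧ ∀ x : EuclideanSpace ℝ (Fin n), x ≠ 0 →
      u x ≤ C * ‖x‖ ^ (-(α - σ) / (p - 1)) := by
  set c : ℝ := (1 / 4 : ℝ) ^ |σ| * ((1 / 4 : ℝ) ^ n *
    volume.real (Metric.ball (0 : EuclideanSpace ℝ (Fin n)) 1))
  have hball : 0 < volume.real (Metric.ball (0 : EuclideanSpace ℝ (Fin n)) 1) :=
    ENNReal.toReal_pos (Metric.measure_ball_pos volume _ one_pos).ne' measure_ball_lt_top.ne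
  have hcpos : 0 < c := by positivity
  refine ⟨(c⁻¹) ^ (1 / (p - 1)), by positivity, fun x hx => ?_⟩
  obtain ⟨hint, hux⟩ := hsol x
  refine le_mul_rpow_of_mul_rpow_le (hupos x) hcpos (norm_pos_iff.mpr hx) hp ?_
  exact (hurad.mul_rpow_le_integral hαn.le (by linarith) hx hint).trans hux.ge
end
end

section
/- Let n ≥ 3, α ∈ [2,n), σ₁, σ₂ < α and p, q > 0 with pq > 1. Suppose (u, v) is a pair of positive radially decreasing continuous functions on ℝⁿ such that for every x ∈ ℝⁿ the integrals ∫_{ℝⁿ} v(y)^q |x−y|^{α−n} |y|^{−σ₁} dy and ∫_{ℝⁿ} u(y)^p |x−y|^{α−n} |y|^{−σ₂} dy are finite and u(x) = ∫_{ℝⁿ} v(y)^q |x−y|^{α−n} |y|^{−σ₁} dy and v(x) = ∫_{ℝⁿ} u(y)^p |x−y|^{α−n} |y|^{−σ₂} dy. Then there exists C > 0 such that u(x) ≤ C |x|^{−(α(1+q)−(σ₁+σ₂q))/(pq−1)} and v(x) ≤ C |x|^{−(α(1+p)−(σ₂+σ₁p))/(pq−1)} for all x ≠ 0. -/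
open MeasureTheory

noncomputable section

/-- A Riesz potential of a power of a positive radially decreasing function is bounded below
at `x` by the contribution of the ball of radius `‖x‖ / 4` around `(3 / 4) • x`. -/
theorem RadiallyDecreasing.exists_le_integral_rpow {n : ℕ} {α σ q : ℝ} (hαn : α < n)
    (hq : 0 < q) {w : EuclideanSpace ℝ (Fin n) → ℝ} (hw : RadiallyDecreasing w)
    (hint : ∀ x : EuclideanSpace ℝ (Fin n),
      Integrable (fun y => w y ^ q * ‖x - y‖ ^ (α - (n : ℝ)) * ‖y‖ ^ (-σ))) :
    ∃ c : ℝ, 0 < c ∧ ∀ x : EuclideanSpace ℝ (Fin n), x ≠ 0 →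
      c * w x ^ q * ‖x‖ ^ (α - σ) ≤
        ∫ y, w y ^ q * ‖x - y‖ ^ (α - (n : ℝ)) * ‖y‖ ^ (-σ) := by
  obtain ⟨W, hanti, hWpos, hwW⟩ := hw
  have hwpos (y) : 0 < w y := by
    rw [hwW]
    exact hWpos _ (norm_nonneg _)
  have hvol : 0 < volume.real (Metric.ball (0 : EuclideanSpace ℝ (Fin n)) 1) :=
    ENNReal.toReal_pos (Metric.measure_ball_pos _ _ one_pos).ne' measure_ball_lt_top.ne
  set b := volume.real (Metric.ball (0 : EuclideanSpace ℝ (Fin n)) 1) with hb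
  refine ⟨2 ^ (α - n) * 2 ^ (-|σ|) * (1 / 4) ^ n * b, by positivity, fun x hx => ?_⟩
  have hr : 0 < ‖x‖ := norm_pos_iff.mpr hx
  set r := ‖x‖ with hrdef
  set S := Metric.ball ((3 / 4 : ℝ) • x) (r / 4) with hS
  have hvolS : volume.real S = (r / 4) ^ n * b := by
    rw [hS, hb, measureReal_def, Measure.addHaar_ball_of_pos _ _ (by positivity),
      ENNReal.toReal_mul, ENNReal.toReal_ofReal (by positivity), measureReal_def]
    simp
  have hlower (y) (hy : y ∈ S) :
      w x ^ q * (2 * r) ^ (α - (n : ℝ)) * (2 ^ (-|σ|) * r ^ (-σ)) ≤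
        w y ^ q * ‖x - y‖ ^ (α - (n : ℝ)) * ‖y‖ ^ (-σ) := by
    rw [hS, mem_ball_iff_norm] at hy
    have hcenter : ‖(3 / 4 : ℝ) • x‖ = 3 / 4 * r := by
      rw [norm_smul, ← hrdef]
      norm_num
    have hxcenter : ‖x - (3 / 4 : ℝ) • x‖ = 1 / 4 * r := by
      rw [show x - (3 / 4 : ℝ) • x = (1 / 4 : ℝ) • x by module, norm_smul, ← hrdef]
      norm_num
    have hyr : ‖y‖ < r := by
      have := norm_sub_norm_le y ((3 / 4 : ℝ) • x)
      linarith
    have hry : r / 2 < ‖y‖ := by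
      have := norm_sub_norm_le ((3 / 4 : ℝ) • x) y
      rw [norm_sub_rev] at this
      linarith
    have hxy : 0 < ‖x - y‖ := by
      have := norm_sub_norm_le x y
      linarith
    have hxy2 : ‖x - y‖ ≤ 2 * r := by
      have := norm_sub_le x y
      linarith
    have hy0 : 0 < ‖y‖ := by linarith
    have hwxy : w x ≤ w y := by
      rw [hwW, hwW]
      exact hanti (norm_nonneg _) (norm_nonneg _) hyr.le
    have hweight : 2 ^ (-|σ|) * r ^ (-σ) ≤ ‖y‖ ^ (-σ) := by
      rcases le_total 0 σ with hσ | hσ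
      · calc (2 : ℝ) ^ (-|σ|) * r ^ (-σ) ≤ 1 * r ^ (-σ) := by
              gcongr
              exact Real.rpow_le_one_of_one_le_of_nonpos one_le_two (by simp)
          _ ≤ ‖y‖ ^ (-σ) := by
              rw [one_mul]
              exact Real.rpow_le_rpow_of_nonpos hy0 hyr.le (by linarith)
      · calc (2 : ℝ) ^ (-|σ|) * r ^ (-σ) = (r / 2) ^ (-σ) := by
              rw [abs_of_nonpos hσ, Real.div_rpow hr.le zero_le_two, Real.rpow_neg zero_le_two]
              field_simp
          _ ≤ ‖y‖ ^ (-σ) := Real.rpow_le_rpow (by positivity) hry.le (by linarith)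
    have hkernel : (2 * r) ^ (α - (n : ℝ)) ≤ ‖x - y‖ ^ (α - (n : ℝ)) :=
      Real.rpow_le_rpow_of_nonpos hxy hxy2 (by linarith)
    have hwx := hwpos x
    have hwy := hwpos y
    gcongr
  calc 2 ^ (α - n) * 2 ^ (-|σ|) * (1 / 4) ^ n * b * w x ^ q * r ^ (α - σ)
      = w x ^ q * (2 * r) ^ (α - (n : ℝ)) * (2 ^ (-|σ|) * r ^ (-σ)) * volume.real S := by
        have hpow : r ^ (α - σ) = r ^ (α - (n : ℝ)) * r ^ (-σ) * r ^ n := by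
          rw [← Real.rpow_natCast, ← Real.rpow_add hr, ← Real.rpow_add hr]
          ring_nf
        rw [hvolS, hpow, Real.mul_rpow zero_le_two hr.le, div_pow, div_pow]
        ring
    _ ≤ ∫ y in S, w y ^ q * ‖x - y‖ ^ (α - (n : ℝ)) * ‖y‖ ^ (-σ) :=
        setIntegral_ge_of_const_le_real Metric.isOpen_ball.measurableSet
          measure_ball_lt_top.ne hlower (hint x).integrableOn
    _ ≤ _ := setIntegral_le_integral (hint x) <| .of_forall fun y => by
        have := hwpos y
        positivity

/-- Two coupled superlinear power inequalities bound each unknown by a power of `r`. -/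
theorem le_mul_rpow_of_coupled_rpow_le {a b r c d s t p q : ℝ} (ha : 0 < a)
    (hr : 0 < r) (hc : 0 < c) (hd : 0 < d) (hq : 0 < q) (hpq : 1 < p * q)
    (hab : c * b ^ q * r ^ s ≤ a) (hba : d * a ^ p * r ^ t ≤ b) :
    a ≤ (c * d ^ q)⁻¹ ^ (p * q - 1)⁻¹ * r ^ (-(s + t * q) / (p * q - 1)) := by
  have hθ : 0 < p * q - 1 := by linarith
  have hmain : c * d ^ q * (a ^ (p * q - 1) * r ^ (s + t * q)) * a ≤ 1 * a := calc
    _ = c * (d * a ^ p * r ^ t) ^ q * r ^ s := by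
      rw [Real.mul_rpow (by positivity) (by positivity), Real.mul_rpow hd.le (by positivity),
        ← Real.rpow_mul ha.le, ← Real.rpow_mul hr.le, Real.rpow_sub_one ha.ne', Real.rpow_add hr]
      field_simp
    _ ≤ c * b ^ q * r ^ s := by gcongr
    _ ≤ 1 * a := by rwa [one_mul]
  have hpow : a ^ (p * q - 1) ≤ (c * d ^ q)⁻¹ * r ^ (-(s + t * q)) := by
    rw [Real.rpow_neg hr.le, ← mul_inv, ← one_div, le_div_iff₀ (by positivity)]
    linarith [le_of_mul_le_mul_right hmain ha]
  calc a = (a ^ (p * q - 1)) ^ (p * q - 1)⁻¹ := (Real.rpow_rpow_inv ha.le hθ.ne').symm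
    _ ≤ ((c * d ^ q)⁻¹ * r ^ (-(s + t * q))) ^ (p * q - 1)⁻¹ := by gcongr
    _ = _ := by
      rw [Real.mul_rpow (by positivity) (by positivity), ← Real.rpow_mul hr.le, div_eq_mul_inv]

theorem stmt_9 (n : ℕ) (hn : 3 ≤ n) (α σ₁ σ₂ p q : ℝ)
    (hα2 : 2 ≤ α) (hαn : α < n) (hσ₁ : σ₁ < α) (hσ₂ : σ₂ < α)
    (hp : 0 < p) (hq : 0 < q) (hpq : 1 < p * q)
    (u v : EuclideanSpace ℝ (Fin n) → ℝ)
    (hupos : ∀ x, 0 < u x) (hvpos : ∀ x, 0 < v x)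
    (hurad : RadiallyDecreasing u) (hvrad : RadiallyDecreasing v)
    (hucont : Continuous u) (hvcont : Continuous v)
    (hsol : ∀ x : EuclideanSpace ℝ (Fin n),
      Integrable (fun y => v y ^ q * ‖x - y‖ ^ (α - (n : ℝ)) * ‖y‖ ^ (-σ₁)) ∧
      Integrable (fun y => u y ^ p * ‖x - y‖ ^ (α - (n : ℝ)) * ‖y‖ ^ (-σ₂)) ∧
      u x = (∫ y, v y ^ q * ‖x - y‖ ^ (α - (n : ℝ)) * ‖y‖ ^ (-σ₁)) ∧
      v x = (∫ y, u y ^ p * ‖x - y‖ ^ (α - (n : ℝ)) * ‖y‖ ^ (-σ₂))) :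
    ∃ C : ℝ, 0 < C ∧ ∀ x : EuclideanSpace ℝ (Fin n), x ≠ 0 →
      u x ≤ C * ‖x‖ ^ (-(α * (1 + q) - (σ₁ + σ₂ * q)) / (p * q - 1)) ∧
      v x ≤ C * ‖x‖ ^ (-(α * (1 + p) - (σ₂ + σ₁ * p)) / (p * q - 1)) := by
  obtain ⟨c, hc, hcu⟩ := hvrad.exists_le_integral_rpow hαn hq fun x => (hsol x).1
  obtain ⟨d, hd, hdv⟩ := hurad.exists_le_integral_rpow hαn hp fun x => (hsol x).2.1
  refine ⟨max ((c * d ^ q)⁻¹ ^ (p * q - 1)⁻¹) ((d * c ^ p)⁻¹ ^ (q * p - 1)⁻¹),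
    lt_max_of_lt_left (by positivity), fun x hx => ?_⟩
  have hr : 0 < ‖x‖ := norm_pos_iff.mpr hx
  have hu := (hcu x hx).trans_eq (hsol x).2.2.1.symm
  have hv := (hdv x hx).trans_eq (hsol x).2.2.2.symm
  constructor
  · refine (le_mul_rpow_of_coupled_rpow_le (hupos x) hr hc hd hq hpq hu hv).trans ?_
    rw [show α - σ₁ + (α - σ₂) * q = α * (1 + q) - (σ₁ + σ₂ * q) by ring]
    gcongr
    exact le_max_left _ _
  · refine (le_mul_rpow_of_coupled_rpow_le (hvpos x) hr hd hc hp (by linarith) hv hu).trans ?_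
    rw [show α - σ₂ + (α - σ₁) * p = α * (1 + p) - (σ₂ + σ₁ * p) by ring, mul_comm q p]
    gcongr
    exact le_max_right _ _
end
end

section
/- Let k ≥ 1 be an integer, n > 2k, σ₁, σ₂ ∈ [0,2k) and p, q > 1. Then there exist double bounded functions c₁, c₂ on ℝⁿ and a pair (u, v) of functions, each positive, of class C^{2k} on ℝⁿ∖{0} and continuous on ℝⁿ, satisfying (−Δ)^k u(x) = c₁(x) |x|^{−σ₁} v(x)^q and (−Δ)^k v(x) = c₂(x) |x|^{−σ₂} u(x)^p for all x ∈ ℝⁿ∖{0}, if and only if max{ (2k(q+1) − (σ₁ + σ₂q))/(pq−1) , (2k(p+1) − (σ₂ + σ₁p))/(pq−1) } < n − 2k. -/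
open MeasureTheory

noncomputable section

/-- A function `c : ℝⁿ → ℝ` is double bounded if there is `C > 0`
with `1/C ≤ c x ≤ C` for all `x`. -/
def DoubleBounded {n : ℕ} (c : EuclideanSpace ℝ (Fin n) → ℝ) : Prop :=
  ∃ C : ℝ, 0 < C ∧ ∀ x, 1 / C ≤ c x ∧ c x ≤ C

/-- The Laplacian of `u : ℝⁿ → ℝ`: the sum of the pure second partial
derivatives along the coordinate directions. -/
def laplacian {n : ℕ} (u : EuclideanSpace ℝ (Fin n) → ℝ)
    (x : EuclideanSpace ℝ (Fin n)) : ℝ :=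
  ∑ i : Fin n,
    iteratedFDeriv ℝ 2 u x ![EuclideanSpace.single i 1, EuclideanSpace.single i 1]

/-- `(-Δ)^k`, the k-th iterate of the negative Laplacian. -/
def negLapPow {n : ℕ} (k : ℕ) (u : EuclideanSpace ℝ (Fin n) → ℝ) :
    EuclideanSpace ℝ (Fin n) → ℝ :=
  (fun v x => -laplacian v x)^[k] u

open Set Filter Topology
open scoped ContDiff

section Calculus

variable {n : ℕ}

/-! ### Elementary properties of the iterated Laplacian -/

lemma laplacian_eq_sum_fderiv (u : EuclideanSpace ℝ (Fin n) → ℝ)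
    (x : EuclideanSpace ℝ (Fin n)) :
    laplacian u x = ∑ i : Fin n, fderiv ℝ (fderiv ℝ u) x (EuclideanSpace.single i 1)
      (EuclideanSpace.single i 1) := by
  simp [laplacian, iteratedFDeriv_two_apply]

lemma negLapPow_zero (u : EuclideanSpace ℝ (Fin n) → ℝ) : negLapPow 0 u = u := rfl

lemma negLapPow_succ (k : ℕ) (u : EuclideanSpace ℝ (Fin n) → ℝ) :
    negLapPow (k + 1) u = fun x => -laplacian (negLapPow k u) x := by
  simp only [negLapPow, Function.iterate_succ_apply']

lemma negLapPow_succ' (k : ℕ) (u : EuclideanSpace ℝ (Fin n) → ℝ) :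
    negLapPow (k + 1) u = negLapPow k (fun x => -laplacian u x) := by
  simp only [negLapPow, Function.iterate_succ_apply]

lemma laplacian_congr {u v : EuclideanSpace ℝ (Fin n) → ℝ} {x : EuclideanSpace ℝ (Fin n)}
    (h : u =ᶠ[𝓝 x] v) : laplacian u x = laplacian v x := by
  simp only [laplacian, (h.iteratedFDeriv ℝ 2).eq_of_nhds]

lemma negLapPow_congr {u v : EuclideanSpace ℝ (Fin n) → ℝ} {U : Set (EuclideanSpace ℝ (Fin n))}
    (hU : IsOpen U) (h : EqOn u v U) (k : ℕ) : EqOn (negLapPow k u) (negLapPow k v) U := by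
  induction k with
  | zero => exact h
  | succ k ih =>
    intro x hx
    simp only [negLapPow_succ]
    rw [laplacian_congr (ih.eventuallyEq_of_mem (hU.mem_nhds hx))]

lemma laplacian_add {u v : EuclideanSpace ℝ (Fin n) → ℝ} {x : EuclideanSpace ℝ (Fin n)}
    (hu : ContDiffAt ℝ 2 u x) (hv : ContDiffAt ℝ 2 v x) :
    laplacian (fun y => u y + v y) x = laplacian u x + laplacian v x := by
  have := iteratedFDeriv_add_apply (i := 2) hu hv
  simp only [laplacian, ← Finset.sum_add_distrib]
  refine Finset.sum_congr rfl fun i _ => ?_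
  exact congrArg (fun L => L ![EuclideanSpace.single i 1, EuclideanSpace.single i 1]) this

lemma laplacian_const_mul {u : EuclideanSpace ℝ (Fin n) → ℝ} {x : EuclideanSpace ℝ (Fin n)}
    (c : ℝ) (hu : ContDiffAt ℝ 2 u x) :
    laplacian (fun y => c * u y) x = c * laplacian u x := by
  have := iteratedFDeriv_const_smul_apply (i := 2) (a := c) hu
  simp only [laplacian, Finset.mul_sum]
  refine Finset.sum_congr rfl fun i _ => ?_
  exact congrArg (fun L => L ![EuclideanSpace.single i 1, EuclideanSpace.single i 1]) this

lemma ContDiffOn.laplacian {u : EuclideanSpace ℝ (Fin n) → ℝ}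
    {U : Set (EuclideanSpace ℝ (Fin n))} (hU : IsOpen U) {m : WithTop ℕ∞}
    (hu : ContDiffOn ℝ (m + 2) u U) : ContDiffOn ℝ m (_root_.laplacian u) U := by
  have h1 : ContDiffOn ℝ (m + 1) (fderiv ℝ u) U :=
    hu.fderiv_of_isOpen hU (by rw [add_assoc, one_add_one_eq_two])
  have h2 : ContDiffOn ℝ m (fderiv ℝ (fderiv ℝ u)) U := h1.fderiv_of_isOpen hU le_rfl
  have h3 : _root_.laplacian u = fun x => ∑ i : Fin n, fderiv ℝ (fderiv ℝ u) x
      (EuclideanSpace.single i 1) (EuclideanSpace.single i 1) :=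
    funext fun x => laplacian_eq_sum_fderiv u x
  rw [h3]
  exact ContDiffOn.sum fun i _ => (h2.clm_apply contDiffOn_const).clm_apply contDiffOn_const

lemma ContDiffOn.negLapPow {u : EuclideanSpace ℝ (Fin n) → ℝ}
    {U : Set (EuclideanSpace ℝ (Fin n))} (hU : IsOpen U) {k : ℕ} {m : WithTop ℕ∞}
    (hu : ContDiffOn ℝ (m + 2 * k) u U) : ContDiffOn ℝ m (_root_.negLapPow k u) U := by
  induction k generalizing m with
  | zero => simpa [negLapPow_zero] using hu
  | succ k ih =>
    rw [negLapPow_succ]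
    refine (ContDiffOn.laplacian hU (ih ?_)).neg
    convert hu using 1
    push_cast
    ring

lemma ContDiff.negLapPow {u : EuclideanSpace ℝ (Fin n) → ℝ} {k : ℕ} {m : WithTop ℕ∞}
    (hu : ContDiff ℝ (m + 2 * k) u) : ContDiff ℝ m (_root_.negLapPow k u) :=
  contDiffOn_univ.1 (ContDiffOn.negLapPow isOpen_univ hu.contDiffOn)

lemma ContDiff.negLapPow_infty {u : EuclideanSpace ℝ (Fin n) → ℝ} {k : ℕ}
    (hu : ContDiff ℝ ∞ u) : ContDiff ℝ ∞ (_root_.negLapPow k u) := by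
  refine contDiff_infty.2 fun m => ContDiff.negLapPow ?_
  exact_mod_cast contDiff_infty.1 hu (m + 2 * k)

lemma negLapPow_add {u v : EuclideanSpace ℝ (Fin n) → ℝ} {U : Set (EuclideanSpace ℝ (Fin n))}
    (hU : IsOpen U) {k : ℕ} (hu : ContDiffOn ℝ (2 * k) u U) (hv : ContDiffOn ℝ (2 * k) v U) :
    EqOn (negLapPow k fun y => u y + v y) (fun x => negLapPow k u x + negLapPow k v x) U := by
  induction k with
  | zero => exact fun _ _ => rfl
  | succ k ih =>
    intro x hx
    have e : (2 : WithTop ℕ∞) * ((k + 1 : ℕ) : WithTop ℕ∞) = 2 + 2 * (k : WithTop ℕ∞) := by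
      push_cast; ring
    rw [e] at hu hv
    have hle : (2 : WithTop ℕ∞) * (k : WithTop ℕ∞) ≤ 2 + 2 * (k : WithTop ℕ∞) := le_add_self
    have ih' := ih (hu.of_le hle) (hv.of_le hle)
    simp only [negLapPow_succ]
    rw [laplacian_congr (ih'.eventuallyEq_of_mem (hU.mem_nhds hx)),
      laplacian_add ((ContDiffOn.negLapPow hU hu).contDiffAt (hU.mem_nhds hx))
        ((ContDiffOn.negLapPow hU hv).contDiffAt (hU.mem_nhds hx))]
    ring

lemma negLapPow_const_mul {u : EuclideanSpace ℝ (Fin n) → ℝ}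
    {U : Set (EuclideanSpace ℝ (Fin n))} (hU : IsOpen U) {k : ℕ} (c : ℝ)
    (hu : ContDiffOn ℝ (2 * k) u U) :
    EqOn (negLapPow k fun y => c * u y) (fun x => c * negLapPow k u x) U := by
  induction k with
  | zero => exact fun _ _ => rfl
  | succ k ih =>
    intro x hx
    have e : (2 : WithTop ℕ∞) * ((k + 1 : ℕ) : WithTop ℕ∞) = 2 + 2 * (k : WithTop ℕ∞) := by
      push_cast; ring
    rw [e] at hu
    have ih' := ih (hu.of_le le_add_self)
    simp only [negLapPow_succ]
    rw [laplacian_congr (ih'.eventuallyEq_of_mem (hU.mem_nhds hx)),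
      laplacian_const_mul c ((ContDiffOn.negLapPow hU hu).contDiffAt (hU.mem_nhds hx))]
    ring

lemma negLapPow_zero_fun (k : ℕ) :
    negLapPow k (fun _ : EuclideanSpace ℝ (Fin n) => (0 : ℝ)) = fun _ => 0 := by
  induction k with
  | zero => rfl
  | succ k ih =>
    rw [negLapPow_succ, ih]
    funext x
    simp [laplacian_eq_sum_fderiv]

lemma negLapPow_const {k : ℕ} (hk : 1 ≤ k) (c : ℝ) :
    negLapPow k (fun _ : EuclideanSpace ℝ (Fin n) => c) = fun _ => 0 := by
  obtain ⟨k, rfl⟩ := Nat.exists_eq_add_of_le' hk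
  rw [negLapPow_succ', show (fun x : EuclideanSpace ℝ (Fin n) => -laplacian (fun _ => c) x)
    = fun _ => 0 from funext fun x => by simp [laplacian_eq_sum_fderiv], negLapPow_zero_fun]

lemma laplacian_comp_smul {u : EuclideanSpace ℝ (Fin n) → ℝ} (hu : ContDiff ℝ 2 u) (r : ℝ)
    (x : EuclideanSpace ℝ (Fin n)) :
    laplacian (fun y => u (r • y)) x = r ^ 2 * laplacian u (r • x) := by
  simp only [laplacian, Finset.mul_sum]
  refine Finset.sum_congr rfl fun i _ => ?_
  have := congrFun (iteratedFDeriv_comp_const_smul (i := 2) r hu) x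
  rw [this]
  simp

lemma negLapPow_comp_smul {u : EuclideanSpace ℝ (Fin n) → ℝ} (hu : ContDiff ℝ ∞ u) (r : ℝ)
    (k : ℕ) : negLapPow k (fun y => u (r • y)) = fun x => r ^ (2 * k) * negLapPow k u (r • x) := by
  induction k with
  | zero => funext x; simp [negLapPow_zero]
  | succ k ih =>
    have hk : ContDiff ℝ 2 (negLapPow k u) := contDiff_infty.1 hu.negLapPow_infty 2
    funext x
    have hc : ContDiffAt ℝ 2 (fun y => negLapPow k u (r • y)) x :=
      (hk.comp (contDiff_const_smul r)).contDiffAt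
    simp only [negLapPow_succ, ih]
    rw [laplacian_const_mul _ hc, laplacian_comp_smul hk]
    ring

lemma tsupport_laplacian_subset (u : EuclideanSpace ℝ (Fin n) → ℝ) :
    tsupport (laplacian u) ⊆ tsupport u := by
  refine closure_minimal (fun x hx => ?_) isClosed_closure
  by_contra h
  refine hx ?_
  rw [laplacian_congr (v := fun _ => 0) (notMem_tsupport_iff_eventuallyEq.1 h)]
  simp [laplacian_eq_sum_fderiv]

lemma HasCompactSupport.laplacian {u : EuclideanSpace ℝ (Fin n) → ℝ} (hu : HasCompactSupport u) :
    HasCompactSupport (_root_.laplacian u) :=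
  hu.of_isClosed_subset isClosed_closure (tsupport_laplacian_subset u)

lemma HasCompactSupport.negLapPow {u : EuclideanSpace ℝ (Fin n) → ℝ} (hu : HasCompactSupport u)
    (k : ℕ) : HasCompactSupport (_root_.negLapPow k u) := by
  induction k with
  | zero => exact hu
  | succ k ih =>
    rw [negLapPow_succ]
    exact HasCompactSupport.neg (f := _root_.laplacian (_root_.negLapPow k u)) ih.laplacian

/-! ### Green's identity -/

lemma integral_mul_fderiv_fderiv_comm {φ u : EuclideanSpace ℝ (Fin n) → ℝ}
    (hφ : ContDiff ℝ 2 φ) (hφc : HasCompactSupport φ) (hu : ContDiff ℝ 2 u)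
    (e : EuclideanSpace ℝ (Fin n)) :
    ∫ x, φ x * fderiv ℝ (fderiv ℝ u) x e e = ∫ x, fderiv ℝ (fderiv ℝ φ) x e e * u x := by
  have hφ1 : ContDiff ℝ 1 (fun x => fderiv ℝ φ x e) :=
    (hφ.fderiv_right (m := 1) (by norm_num)).clm_apply contDiff_const
  have hu1 : ContDiff ℝ 1 (fun x => fderiv ℝ u x e) :=
    (hu.fderiv_right (m := 1) (by norm_num)).clm_apply contDiff_const
  have hφ_supp : HasCompactSupport (fun x => fderiv ℝ φ x e) := hφc.fderiv_apply ℝ e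
  have eφ (x) : fderiv ℝ (fun x => fderiv ℝ φ x e) x e = fderiv ℝ (fderiv ℝ φ) x e e := by
    rw [fderiv_clm_apply ((hφ.fderiv_right (m := 1) (by norm_num)).differentiable (by simp) x)
      (differentiableAt_const e)]
    simp
  have eu (x) : fderiv ℝ (fun x => fderiv ℝ u x e) x e = fderiv ℝ (fderiv ℝ u) x e e := by
    rw [fderiv_clm_apply ((hu.fderiv_right (m := 1) (by norm_num)).differentiable (by simp) x)
      (differentiableAt_const e)]
    simp
  have hφ2 : Continuous (fun x => fderiv ℝ (fun x => fderiv ℝ φ x e) x e) :=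
    (hφ1.continuous_fderiv (by simp)).clm_apply continuous_const
  have hu2 : Continuous (fun x => fderiv ℝ (fun x => fderiv ℝ u x e) x e) :=
    (hu1.continuous_fderiv (by simp)).clm_apply continuous_const
  have hφ_supp' : HasCompactSupport (fun x => fderiv ℝ (fun x => fderiv ℝ φ x e) x e) :=
    hφ_supp.fderiv_apply ℝ e
  have s1 : ∫ x, φ x * fderiv ℝ (fun x => fderiv ℝ u x e) x e
      = -∫ x, fderiv ℝ φ x e * fderiv ℝ u x e :=
    integral_mul_fderiv_eq_neg_fderiv_mul_of_integrable
      ((hφ1.continuous.mul hu1.continuous).integrable_of_hasCompactSupport hφ_supp.mul_right)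
      ((hφ.continuous.mul hu2).integrable_of_hasCompactSupport hφc.mul_right)
      ((hφ.continuous.mul hu1.continuous).integrable_of_hasCompactSupport hφc.mul_right)
      (fun x _ => hφ.differentiable (by simp) x) (fun x _ => hu1.differentiable (by simp) x)
  have s2 : ∫ x, fderiv ℝ φ x e * fderiv ℝ u x e
      = -∫ x, fderiv ℝ (fun x => fderiv ℝ φ x e) x e * u x :=
    integral_mul_fderiv_eq_neg_fderiv_mul_of_integrable
      ((hφ2.mul hu.continuous).integrable_of_hasCompactSupport hφ_supp'.mul_right)
      ((hφ1.continuous.mul hu1.continuous).integrable_of_hasCompactSupport hφ_supp.mul_right)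
      ((hφ1.continuous.mul hu.continuous).integrable_of_hasCompactSupport hφ_supp.mul_right)
      (fun x _ => hφ1.differentiable (by simp) x) (fun x _ => hu.differentiable (by simp) x)
  simp only [eφ, eu] at s1 s2
  rw [s1, s2, neg_neg]

lemma integral_mul_laplacian_comm {φ u : EuclideanSpace ℝ (Fin n) → ℝ}
    (hφ : ContDiff ℝ 2 φ) (hφc : HasCompactSupport φ) (hu : ContDiff ℝ 2 u) :
    ∫ x, φ x * laplacian u x = ∫ x, laplacian φ x * u x := by
  have hc {w : EuclideanSpace ℝ (Fin n) → ℝ} (hw : ContDiff ℝ 2 w)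
      (e : EuclideanSpace ℝ (Fin n)) : Continuous fun x => fderiv ℝ (fderiv ℝ w) x e e :=
    (((hw.fderiv_right (m := 1) (by norm_num)).continuous_fderiv (by simp)).clm_apply
      continuous_const).clm_apply continuous_const
  have hs (e : EuclideanSpace ℝ (Fin n)) :
      HasCompactSupport fun x => fderiv ℝ (fderiv ℝ φ) x e e :=
    ((hφc.fderiv ℝ).fderiv ℝ).comp_left
      (g := fun L : EuclideanSpace ℝ (Fin n) →L[ℝ] EuclideanSpace ℝ (Fin n) →L[ℝ] ℝ => L e e) rfl
  simp only [laplacian_eq_sum_fderiv, Finset.mul_sum, Finset.sum_mul]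
  rw [integral_finsetSum, integral_finsetSum]
  · exact Finset.sum_congr rfl fun i _ => integral_mul_fderiv_fderiv_comm hφ hφc hu _
  · exact fun i _ => ((hc hφ _).mul hu.continuous).integrable_of_hasCompactSupport
      (hs _).mul_right
  · exact fun i _ => (hφ.continuous.mul (hc hu _)).integrable_of_hasCompactSupport hφc.mul_right

lemma integral_mul_negLapPow_comm {φ u : EuclideanSpace ℝ (Fin n) → ℝ} {k : ℕ}
    (hφ : ContDiff ℝ ∞ φ) (hφc : HasCompactSupport φ) (hu : ContDiff ℝ (2 * k) u) :
    ∫ x, φ x * negLapPow k u x = ∫ x, negLapPow k φ x * u x := by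
  induction k generalizing φ with
  | zero => rfl
  | succ k ih =>
    have e : (2 : WithTop ℕ∞) * ((k + 1 : ℕ) : WithTop ℕ∞) = 2 + 2 * (k : WithTop ℕ∞) := by
      push_cast; ring
    rw [e] at hu
    have h1 : ContDiff ℝ 2 (negLapPow k u) := hu.negLapPow
    have h2 : ContDiff ℝ ∞ (negLapPow 1 φ) := hφ.negLapPow_infty
    rw [negLapPow_succ, negLapPow_succ' k φ]
    simp only [mul_neg, integral_neg]
    rw [integral_mul_laplacian_comm (contDiff_infty.1 hφ 2) hφc h1, ← integral_neg]
    simp only [← neg_mul]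
    exact ih (φ := fun x => -laplacian φ x) h2 (hφc.negLapPow 1) (hu.of_le le_add_self)

end Calculus

section Radial

variable {n : ℕ}

open Polynomial

/-! ### Laplacians of radial functions -/

/-- The Laplacian of a radial function, written as a function of the squared norm. -/
lemma laplacian_radial {w w' : ℝ → ℝ} {w'' : ℝ} {x : EuclideanSpace ℝ (Fin n)}
    (hw : ∀ᶠ s in 𝓝 (‖x‖ ^ 2), HasDerivAt w (w' s) s) (hw' : HasDerivAt w' w'' (‖x‖ ^ 2)) :
    laplacian (fun y => w (‖y‖ ^ 2)) x = 4 * (‖x‖ ^ 2 * w'' + n / 2 * w' (‖x‖ ^ 2)) := by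
  have hsq (y : EuclideanSpace ℝ (Fin n)) :
      HasFDerivAt (fun y : EuclideanSpace ℝ (Fin n) => ‖y‖ ^ 2) (2 • innerSL ℝ y) y :=
    (hasStrictFDerivAt_norm_sq y).hasFDerivAt
  have hcont : ContinuousAt (fun y : EuclideanSpace ℝ (Fin n) => ‖y‖ ^ 2) x := by fun_prop
  have h1 : fderiv ℝ (fun y : EuclideanSpace ℝ (Fin n) => w (‖y‖ ^ 2)) =ᶠ[𝓝 x]
      fun y => w' (‖y‖ ^ 2) • (2 • innerSL ℝ y) := by
    filter_upwards [hcont.eventually hw] with y hy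
    exact (HasDerivAt.comp_hasFDerivAt y hy (hsq y)).fderiv
  have hx : ‖x‖ ^ 2 = ∑ i, x i ^ 2 := by simp [EuclideanSpace.norm_sq_eq]
  have hinner (y : EuclideanSpace ℝ (Fin n)) (i : Fin n) :
      innerSL ℝ y (EuclideanSpace.single i (1 : ℝ)) = y i := by
    simp [innerSL_apply_apply, EuclideanSpace.inner_single_right]
  have hd : DifferentiableAt ℝ (fderiv ℝ fun y : EuclideanSpace ℝ (Fin n) => w (‖y‖ ^ 2)) x := by
    refine DifferentiableAt.congr_of_eventuallyEq ?_ h1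
    have ha : DifferentiableAt ℝ (fun y : EuclideanSpace ℝ (Fin n) => w' (‖y‖ ^ 2)) x :=
      (HasDerivAt.comp_hasFDerivAt x hw' (hsq x)).differentiableAt
    have hb : DifferentiableAt ℝ (fun y : EuclideanSpace ℝ (Fin n) => innerSL ℝ y) x :=
      (innerSL ℝ : EuclideanSpace ℝ (Fin n) →L[ℝ]
        EuclideanSpace ℝ (Fin n) →L[ℝ] ℝ).differentiableAt
    exact ha.smul (hb.const_smul 2)
  have hterm (i : Fin n) : fderiv ℝ (fderiv ℝ fun y : EuclideanSpace ℝ (Fin n) => w (‖y‖ ^ 2)) x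
      (EuclideanSpace.single i (1 : ℝ)) (EuclideanSpace.single i (1 : ℝ))
      = w'' * (2 * x i) * (2 * x i) + 2 * w' (‖x‖ ^ 2) := by
    have e1 : (fun y => fderiv ℝ (fun y : EuclideanSpace ℝ (Fin n) => w (‖y‖ ^ 2)) y
        (EuclideanSpace.single i (1 : ℝ))) =ᶠ[𝓝 x] fun y => w' (‖y‖ ^ 2) * (2 * y i) := by
      filter_upwards [h1] with y hy
      rw [hy]
      simp [hinner]
    have e2 : HasFDerivAt (fun y : EuclideanSpace ℝ (Fin n) => 2 * y i)
        ((2 : ℝ) • (EuclideanSpace.proj i : EuclideanSpace ℝ (Fin n) →L[ℝ] ℝ)) x :=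
      (EuclideanSpace.proj i : EuclideanSpace ℝ (Fin n) →L[ℝ] ℝ).hasFDerivAt.const_mul 2
    have e3 := (HasDerivAt.comp_hasFDerivAt x hw' (hsq x)).mul e2
    have e4 := hd.hasFDerivAt.clm_apply
      (hasFDerivAt_const (EuclideanSpace.single i (1 : ℝ)) x)
    have e5 := congrArg (fun L => L (EuclideanSpace.single i (1 : ℝ)))
      (e4.unique (e3.congr_of_eventuallyEq e1))
    simp [hinner] at e5
    rw [e5]
    ring
  rw [laplacian_eq_sum_fderiv]
  simp only [hterm, Finset.sum_add_distrib, Finset.sum_const, Finset.card_univ, Fintype.card_fin,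
    nsmul_eq_mul]
  have : ∑ i, w'' * (2 * x i) * (2 * x i) = 4 * w'' * ∑ i, x i ^ 2 := by
    rw [Finset.mul_sum]
    exact Finset.sum_congr rfl fun i _ => by ring
  rw [this, ← hx]
  ring

/-- The numerator of the derivative of `(1 + t) ^ (-N) * p t` over `(1 + t) ^ (-N - 1)`. -/
def bubbleDeriv (N : ℝ) (p : ℝ[X]) : ℝ[X] := (1 + X) * derivative p - C N * p

lemma hasDerivAt_bubble (N : ℝ) (p : ℝ[X]) {t : ℝ} (ht : 0 < 1 + t) :
    HasDerivAt (fun s => (1 + s) ^ (-N) * p.eval s)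
      ((1 + t) ^ (-(N + 1)) * (bubbleDeriv N p).eval t) t := by
  have h1 : HasDerivAt (fun s : ℝ => 1 + s) 1 t := (hasDerivAt_id t).const_add 1
  have h2 := (h1.rpow_const (p := -N) (Or.inl ht.ne')).mul (p.hasDerivAt t)
  refine h2.congr_deriv ?_
  have h3 : (1 + t) ^ (-N) = (1 + t) ^ (-N - 1) * (1 + t) := by
    rw [← Real.rpow_add_one ht.ne']; ring_nf
  rw [h3, show -(N + 1) = -N - 1 by ring]
  simp [bubbleDeriv]
  ring

/-- The numerator of `t w'' + c w'` for `w = (1 + t) ^ (-N) * p t` over `(1 + t) ^ (-N - 2)`. -/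
def bubbleLap (c N : ℝ) (p : ℝ[X]) : ℝ[X] :=
  (1 + X) * (X * derivative (bubbleDeriv N p) + C c * bubbleDeriv N p)
    - C (N + 1) * X * bubbleDeriv N p

lemma laplacian_bubble (N : ℝ) (p : ℝ[X]) (x : EuclideanSpace ℝ (Fin n)) :
    laplacian (fun y => (1 + ‖y‖ ^ 2) ^ (-N) * p.eval (‖y‖ ^ 2)) x
      = 4 * ((1 + ‖x‖ ^ 2) ^ (-(N + 2)) * (bubbleLap (n / 2) N p).eval (‖x‖ ^ 2)) := by
  have hx : 0 < 1 + ‖x‖ ^ 2 := by positivity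
  rw [laplacian_radial (w := fun s => (1 + s) ^ (-N) * p.eval s)
    (w' := fun s => (1 + s) ^ (-(N + 1)) * (bubbleDeriv N p).eval s) ?_
    (hasDerivAt_bubble (N + 1) (bubbleDeriv N p) hx)]
  · have h3 : (1 + ‖x‖ ^ 2) ^ (-(N + 1)) = (1 + ‖x‖ ^ 2) ^ (-(N + 2)) * (1 + ‖x‖ ^ 2) := by
      rw [← Real.rpow_add_one hx.ne']; ring_nf
    rw [h3, show -(N + 1 + 1) = -(N + 2) by ring]
    simp only [bubbleLap, bubbleDeriv, map_add, map_one, derivative_sub, derivative_mul,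
      derivative_one, derivative_X, derivative_C, eval_sub, eval_add, eval_mul,
      eval_one, eval_X, eval_C, eval_zero]
    ring
  · filter_upwards [lt_mem_nhds (show (-1 : ℝ) < ‖x‖ ^ 2 by linarith)] with s hs
    exact hasDerivAt_bubble N p (by linarith)

/-- The polynomials `p i` such that `∏_{j < i} (t d/dt + c + j)` maps `(1 + t) ^ (-a)` to
`(1 + t) ^ (-a - i) * p i t`. -/
def bubblePoly (c a : ℝ) : ℕ → ℝ[X]
  | 0 => 1
  | i + 1 => (1 + X) * (X * derivative (bubblePoly c a i) + C (c + i) * bubblePoly c a i)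
      - C (a + i) * X * bubblePoly c a i

lemma bubbleLap_bubblePoly (c a : ℝ) (i : ℕ) :
    bubbleLap c (a + i) (bubblePoly c a i) = - C a * bubblePoly c (a + 1) (i + 1) := by
  induction i with
  | zero =>
    simp only [bubbleLap, bubbleDeriv, bubblePoly, map_add, map_one, derivative_sub,
      derivative_mul, derivative_one, derivative_X, derivative_C,
      Nat.cast_zero, map_zero]
    ring
  | succ i ih =>
    have h : - C a * bubblePoly c (a + 1) (i + 2)
        = (1 + X) * (X * derivative (- C a * bubblePoly c (a + 1) (i + 1))
          + C (c + (i + 1 : ℕ)) * (- C a * bubblePoly c (a + 1) (i + 1)))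
          - C (a + 1 + (i + 1 : ℕ)) * X * (- C a * bubblePoly c (a + 1) (i + 1)) := by
      rw [bubblePoly]
      simp only [derivative_mul, derivative_neg, derivative_C]
      ring
    rw [h, ← ih, bubblePoly]
    simp only [bubbleLap, bubbleDeriv, map_add, map_one, derivative_sub, derivative_mul,
      derivative_one, derivative_X, derivative_C, derivative_zero, Nat.cast_add,
      Nat.cast_one]
    ring

lemma contDiff_bubble (N : ℝ) (p : ℝ[X]) :
    ContDiff ℝ ∞ fun y : EuclideanSpace ℝ (Fin n) => (1 + ‖y‖ ^ 2) ^ (-N) * p.eval (‖y‖ ^ 2) := by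
  have h1 : ContDiff ℝ ∞ fun y : EuclideanSpace ℝ (Fin n) => 1 + ‖y‖ ^ 2 :=
    contDiff_const.add (contDiff_norm_sq ℝ)
  have hp : ContDiff ℝ ∞ fun t : ℝ => p.eval t := by
    simpa only [coe_aeval_eq_eval] using p.contDiff_aeval (𝕜 := ℝ) ∞
  have h2 : ContDiff ℝ ∞ fun y : EuclideanSpace ℝ (Fin n) => p.eval (‖y‖ ^ 2) :=
    hp.comp (contDiff_norm_sq ℝ)
  exact (h1.rpow_const_of_ne fun y => by positivity).mul h2

lemma negLapPow_bubble (s : ℝ) (j : ℕ) :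
    negLapPow j (fun y : EuclideanSpace ℝ (Fin n) => (1 + ‖y‖ ^ 2) ^ (-s)) = fun x =>
      (4 ^ j * ∏ i ∈ Finset.range j, (s + i)) * ((1 + ‖x‖ ^ 2) ^ (-(s + j + j)) *
        (bubblePoly (n / 2) (s + j) j).eval (‖x‖ ^ 2)) := by
  induction j with
  | zero => funext x; simp [negLapPow_zero, bubblePoly]
  | succ j ih =>
    funext x
    simp only [negLapPow_succ, ih]
    rw [laplacian_const_mul _ ((contDiff_infty.1 (contDiff_bubble _ _) 2).contDiffAt),
      laplacian_bubble, bubbleLap_bubblePoly, Finset.prod_range_succ, pow_succ]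
    push_cast
    rw [show -(s + j + j + 2) = -(s + (j + 1) + (j + 1)) by ring,
      show s + (j : ℝ) + 1 = s + (j + 1) by ring]
    simp only [eval_mul, eval_neg, eval_C]
    ring

lemma coeff_bubblePoly_succ (c a : ℝ) (i m : ℕ) :
    (bubblePoly c a (i + 1)).coeff (m + 1) = (c + i + (m + 1)) * (bubblePoly c a i).coeff (m + 1)
      + (c - a + m) * (bubblePoly c a i).coeff m := by
  rw [bubblePoly]
  have e : (1 + X) * (X * derivative (bubblePoly c a i) + C (c + i) * bubblePoly c a i)
      - C (a + i) * X * bubblePoly c a i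
      = X * derivative (bubblePoly c a i) + X * (X * derivative (bubblePoly c a i))
        + C (c + i) * bubblePoly c a i + C (c + i) * (X * bubblePoly c a i)
        - C (a + i) * (X * bubblePoly c a i) := by ring
  rw [e]
  simp only [coeff_sub, coeff_add, coeff_C_mul, coeff_X_mul, coeff_derivative]
  cases m with
  | zero => simp [mul_coeff_zero]; ring
  | succ m =>
    simp only [coeff_X_mul, coeff_derivative]
    push_cast
    ring

lemma coeff_zero_bubblePoly_succ (c a : ℝ) (i : ℕ) :
    (bubblePoly c a (i + 1)).coeff 0 = (c + i) * (bubblePoly c a i).coeff 0 := by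
  rw [bubblePoly]
  simp [mul_coeff_zero]

lemma natDegree_bubblePoly_le (c a : ℝ) (i : ℕ) : (bubblePoly c a i).natDegree ≤ i := by
  rw [natDegree_le_iff_coeff_eq_zero]
  induction i with
  | zero =>
    intro N hN
    rw [bubblePoly, coeff_one, if_neg (by omega)]
  | succ i ih =>
    rintro (_ | N) hN
    · omega
    · rw [coeff_bubblePoly_succ, ih _ (by omega), ih _ (by omega)]
      ring

lemma coeff_bubblePoly_nonneg {c a : ℝ} (hc : 0 < c) (ha : a < c) (i m : ℕ) :
    0 ≤ (bubblePoly c a i).coeff m := by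
  induction i generalizing m with
  | zero => rw [bubblePoly, coeff_one]; split_ifs <;> norm_num
  | succ i ih =>
    rcases m with _ | m
    · rw [coeff_zero_bubblePoly_succ]
      exact mul_nonneg (by positivity) (ih 0)
    · rw [coeff_bubblePoly_succ]
      have : 0 < c - a := sub_pos.2 ha
      exact add_nonneg (mul_nonneg (by positivity) (ih _)) (mul_nonneg (by positivity) (ih _))

lemma coeff_zero_bubblePoly_pos {c : ℝ} (hc : 0 < c) (a : ℝ) (i : ℕ) :
    0 < (bubblePoly c a i).coeff 0 := by
  induction i with
  | zero => simp [bubblePoly]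
  | succ i ih => rw [coeff_zero_bubblePoly_succ]; positivity

lemma coeff_self_bubblePoly_pos {c a : ℝ} (ha : a < c) (i : ℕ) :
    0 < (bubblePoly c a i).coeff i := by
  induction i with
  | zero => simp [bubblePoly]
  | succ i ih =>
    rw [coeff_bubblePoly_succ, coeff_eq_zero_of_natDegree_lt
      (lt_of_le_of_lt (natDegree_bubblePoly_le c a i) (Nat.lt_succ_self i)), mul_zero, zero_add]
    have : 0 < c - a := sub_pos.2 ha
    positivity

lemma exists_bubblePoly_bounds {c a : ℝ} (hc : 0 < c) (ha : a < c) (k : ℕ) :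
    ∃ l L : ℝ, 0 < l ∧ 0 < L ∧ ∀ t : ℝ, 0 ≤ t → l * (1 + t) ^ k ≤ (bubblePoly c a k).eval t ∧
      (bubblePoly c a k).eval t ≤ L * (1 + t) ^ k := by
  set p := bubblePoly c a k with hp
  have hnn (m : ℕ) : 0 ≤ p.coeff m := coeff_bubblePoly_nonneg hc ha k m
  have h0 : 0 < p.coeff 0 := coeff_zero_bubblePoly_pos hc a k
  have hk : 0 < p.coeff k := coeff_self_bubblePoly_pos ha k
  have hev (t : ℝ) : p.eval t = ∑ m ∈ Finset.range (k + 1), p.coeff m * t ^ m :=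
    eval_eq_sum_range' (Nat.lt_succ_of_le (natDegree_bubblePoly_le c a k)) t
  refine ⟨min (p.coeff 0) (p.coeff k) / 2 ^ k, ∑ m ∈ Finset.range (k + 1), p.coeff m,
    by positivity, ?_, fun t ht => ⟨?_, ?_⟩⟩
  · exact h0.trans_le (Finset.single_le_sum (f := fun m => p.coeff m) (fun m _ => hnn m)
      (Finset.mem_range.2 (Nat.succ_pos k)))
  · have hsingle (m : ℕ) (hm : m ≤ k) : p.coeff m * t ^ m ≤ p.eval t := by
      rw [hev]
      exact Finset.single_le_sum (f := fun m => p.coeff m * t ^ m)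
        (fun m _ => mul_nonneg (hnn m) (pow_nonneg ht m)) (Finset.mem_range.2 (by omega))
    rw [div_mul_eq_mul_div, div_le_iff₀ (by positivity)]
    rcases le_total t 1 with h1 | h1
    · calc min (p.coeff 0) (p.coeff k) * (1 + t) ^ k ≤ p.coeff 0 * 2 ^ k := by
            gcongr
            · exact min_le_left _ _
            · linarith
        _ ≤ p.eval t * 2 ^ k := by
            gcongr
            simpa using hsingle 0 (Nat.zero_le k)
    · calc min (p.coeff 0) (p.coeff k) * (1 + t) ^ k ≤ p.coeff k * (t * 2) ^ k := by
            gcongr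
            · exact min_le_right _ _
            · linarith
        _ = p.coeff k * t ^ k * 2 ^ k := by rw [mul_pow]; ring
        _ ≤ p.eval t * 2 ^ k := by
            gcongr
            exact hsingle k le_rfl
  · rw [hev, Finset.sum_mul]
    refine Finset.sum_le_sum fun m hm => mul_le_mul_of_nonneg_left ?_ (hnn m)
    calc t ^ m ≤ (1 + t) ^ m := by gcongr; linarith
      _ ≤ (1 + t) ^ k := pow_le_pow_right₀ (by linarith) (by simpa [Nat.lt_succ_iff] using hm)

/-- For `0 < 2s < n - 2k`, the function `(-Δ)^k (1 + |x|²)^{-s}` is comparable to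
`(1 + |x|²)^{-s-k}`. -/
lemma exists_negLapPow_bubble_bounds {s : ℝ} {k : ℕ} (hs : 0 < s) (hsk : s + k < n / 2) :
    ∃ l L : ℝ, 0 < l ∧ 0 < L ∧ ∀ x : EuclideanSpace ℝ (Fin n),
      l * (1 + ‖x‖ ^ 2) ^ (-(s + k)) ≤ negLapPow k (fun y => (1 + ‖y‖ ^ 2) ^ (-s)) x ∧
      negLapPow k (fun y => (1 + ‖y‖ ^ 2) ^ (-s)) x ≤ L * (1 + ‖x‖ ^ 2) ^ (-(s + k)) := by
  have hc : (0 : ℝ) < n / 2 := lt_trans (by positivity) hsk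
  obtain ⟨l, L, hl, hL, h⟩ := exists_bubblePoly_bounds hc hsk k
  have hK : 0 < 4 ^ k * ∏ i ∈ Finset.range k, (s + i) :=
    mul_pos (by positivity) (Finset.prod_pos fun i _ => by positivity)
  set K := 4 ^ k * ∏ i ∈ Finset.range k, (s + i) with hKdef
  refine ⟨K * l, K * L, by positivity, by positivity, fun x => ?_⟩
  have hx : 0 < 1 + ‖x‖ ^ 2 := by positivity
  have e : (1 + ‖x‖ ^ 2) ^ (-(s + k)) = (1 + ‖x‖ ^ 2) ^ (-(s + k + k)) * (1 + ‖x‖ ^ 2) ^ k := by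
    rw [← Real.rpow_natCast (1 + ‖x‖ ^ 2) k, ← Real.rpow_add hx]; ring_nf
  have hpos : 0 < (1 + ‖x‖ ^ 2) ^ (-(s + k + k)) := Real.rpow_pos_of_pos hx _
  obtain ⟨h1, h2⟩ := h (‖x‖ ^ 2) (by positivity)
  rw [negLapPow_bubble, e]
  simp only [← hKdef]
  constructor
  · calc _ = K * ((1 + ‖x‖ ^ 2) ^ (-(s + k + k)) * (l * (1 + ‖x‖ ^ 2) ^ k)) := by ring
      _ ≤ _ := by gcongr
  · calc _ ≤ K * ((1 + ‖x‖ ^ 2) ^ (-(s + k + k)) * (L * (1 + ‖x‖ ^ 2) ^ k)) := by gcongr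
      _ = _ := by ring

/-! ### Powers with logarithms -/

lemma hasDerivAt_rpow_mul_log (s a b : ℝ) {t : ℝ} (ht : 0 < t) :
    HasDerivAt (fun r => r ^ s * (a + b * Real.log r))
      (t ^ (s - 1) * ((s * a + b) + s * b * Real.log t)) t := by
  have h1 := (Real.hasDerivAt_rpow_const (p := s) (Or.inl ht.ne')).mul
    (((Real.hasDerivAt_log ht.ne').const_mul b).const_add a)
  refine h1.congr_deriv ?_
  have h3 : t ^ s = t ^ (s - 1) * t := by rw [← Real.rpow_add_one ht.ne']; ring_nf
  rw [h3]
  field_simp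
  ring

lemma laplacian_rpow_mul_log (s a b : ℝ) {x : EuclideanSpace ℝ (Fin n)} (hx : x ≠ 0) :
    laplacian (fun y => (‖y‖ ^ 2) ^ (s + 1) * (a + b * Real.log (‖y‖ ^ 2))) x =
      (‖x‖ ^ 2) ^ s * (4 * ((s + n / 2) * ((s + 1) * a + b) + (s + 1) * b)
        + 4 * (s + n / 2) * (s + 1) * b * Real.log (‖x‖ ^ 2)) := by
  have hx : 0 < ‖x‖ ^ 2 := by positivity
  rw [laplacian_radial (w := fun r => r ^ (s + 1) * (a + b * Real.log r))
    (w' := fun r => r ^ s * (((s + 1) * a + b) + (s + 1) * b * Real.log r)) ?_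
    (hasDerivAt_rpow_mul_log s _ _ hx)]
  · have h3 : (‖x‖ ^ 2) ^ s = (‖x‖ ^ 2) ^ (s - 1) * ‖x‖ ^ 2 := by
      rw [← Real.rpow_add_one hx.ne']; ring_nf
    rw [h3]
    ring
  · filter_upwards [lt_mem_nhds hx] with r hr
    simpa using hasDerivAt_rpow_mul_log (s + 1) a b hr

lemma exists_negLapPow_eq_rpow {σ : ℝ} (hσn : σ < n) (j : ℕ) :
    ∃ a b : ℝ, (j - σ / 2 < 0 → b = 0) ∧ ∀ x : EuclideanSpace ℝ (Fin n), x ≠ 0 →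
      negLapPow j (fun y => (‖y‖ ^ 2) ^ (j - σ / 2) * (a + b * Real.log (‖y‖ ^ 2))) x
        = ‖x‖ ^ (-σ) := by
  induction j with
  | zero =>
    refine ⟨1, 0, fun _ => rfl, fun x hx => ?_⟩
    rw [negLapPow_zero, ← Real.rpow_natCast, ← Real.rpow_mul (norm_nonneg x)]
    norm_num
    ring_nf
  | succ j ih =>
    obtain ⟨a₀, b₀, hb₀, h⟩ := ih
    set s : ℝ := j - σ / 2 with hs
    have hsc : 0 < s + n / 2 := by
      have : (0 : ℝ) ≤ j := j.cast_nonneg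
      rw [hs]; linarith
    obtain ⟨a, b, hb, h1, h2⟩ : ∃ a b : ℝ, (s + 1 < 0 → b = 0) ∧
        -(4 * ((s + n / 2) * ((s + 1) * a + b) + (s + 1) * b)) = a₀ ∧
        -(4 * (s + n / 2) * (s + 1) * b) = b₀ := by
      generalize s + (n : ℝ) / 2 = d at hsc ⊢
      rcases eq_or_ne (s + 1) 0 with h0 | h0
      · refine ⟨0, -a₀ / (4 * d), fun h => absurd h0 h.ne, ?_, ?_⟩
        · rw [h0]; field_simp; ring
        · rw [h0, hb₀ (by linarith)]; ring
      · refine ⟨(-a₀ / 4 - (s + 1) * (-b₀ / (4 * d * (s + 1)))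
            - d * (-b₀ / (4 * d * (s + 1)))) / (d * (s + 1)),
          -b₀ / (4 * d * (s + 1)), fun h => ?_, ?_, ?_⟩
        · rw [hb₀ (by linarith)]; simp
        · field_simp; ring
        · field_simp
    have hs1 : ((j + 1 : ℕ) : ℝ) - σ / 2 = s + 1 := by rw [hs]; push_cast; ring
    rw [hs1]
    refine ⟨a, b, hb, fun x hx => ?_⟩
    rw [negLapPow_succ', ← h x hx]
    refine negLapPow_congr (U := {0}ᶜ) isOpen_compl_singleton (fun y hy => ?_) j hx
    rw [laplacian_rpow_mul_log s a b hy, ← h1, ← h2]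
    ring

lemma continuous_rpow_mul_log {s : ℝ} (hs : 0 < s) (a b : ℝ) :
    Continuous fun x : EuclideanSpace ℝ (Fin n) =>
      (‖x‖ ^ 2) ^ s * (a + b * Real.log (‖x‖ ^ 2)) := by
  have h1 : Continuous fun x : EuclideanSpace ℝ (Fin n) => (‖x‖ ^ 2) ^ s :=
    (continuous_norm.pow 2).rpow_const fun _ => Or.inr hs.le
  have h2 := ((continuous_const (y := a)).mul h1).add
    ((continuous_const (y := b / s)).mul (Real.continuous_mul_log.comp h1))
  refine h2.congr fun x => ?_
  rcases (by positivity : 0 ≤ ‖x‖ ^ 2).eq_or_lt with h0 | h0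
  · simp [← h0, Real.zero_rpow hs.ne']
  · change a * (‖x‖ ^ 2) ^ s + b / s * ((‖x‖ ^ 2) ^ s * Real.log ((‖x‖ ^ 2) ^ s)) = _
    rw [Real.log_rpow h0]
    field_simp

lemma contDiffOn_rpow_mul_log (s a b : ℝ) (m : WithTop ℕ∞) :
    ContDiffOn ℝ m (fun x : EuclideanSpace ℝ (Fin n) =>
      (‖x‖ ^ 2) ^ s * (a + b * Real.log (‖x‖ ^ 2))) {0}ᶜ := by
  intro x hx
  have hx : ‖x‖ ^ 2 ≠ 0 := by simpa using hx
  have h := (contDiff_norm_sq ℝ (E := EuclideanSpace ℝ (Fin n)) (n := m)).contDiffAt (x := x)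
  exact ((h.rpow_const_of_ne hx).mul
    (contDiffAt_const.add (contDiffAt_const.mul (h.log hx)))).contDiffWithinAt

end Radial

section Existence

variable {n : ℕ}

/-! ### Construction of solutions -/

/-- A continuous compactly supported function `h`, smooth off the origin, with
`(-Δ)^k h = |x|^{-σ}` near the origin. -/
lemma exists_local_solution {k : ℕ} {σ : ℝ} (hσk : σ < 2 * k) (hσn : σ < n) :
    ∃ h : EuclideanSpace ℝ (Fin n) → ℝ, Continuous h ∧ ContDiffOn ℝ (2 * k) h {0}ᶜ ∧
      (∀ x, 2 ≤ ‖x‖ → h x = 0) ∧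
      (∀ x, x ≠ 0 → ‖x‖ < 1 → negLapPow k h x = ‖x‖ ^ (-σ)) ∧
      (∃ K, ∀ x, |h x| ≤ K) ∧
      (∃ K, ∀ x, 1 ≤ ‖x‖ → |negLapPow k h x| ≤ K) ∧
      (∀ x, 2 < ‖x‖ → negLapPow k h x = 0) := by
  obtain ⟨a, b, -, hab⟩ := exists_negLapPow_eq_rpow (n := n) hσn k
  set g : EuclideanSpace ℝ (Fin n) → ℝ :=
    fun y => (‖y‖ ^ 2) ^ (k - σ / 2) * (a + b * Real.log (‖y‖ ^ 2)) with hg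
  have hgc : Continuous g := continuous_rpow_mul_log (by linarith) a b
  let χ : ContDiffBump (0 : EuclideanSpace ℝ (Fin n)) := ⟨1, 2, one_pos, one_lt_two⟩
  have hχ : ContDiff ℝ ∞ χ := χ.contDiff
  have hc : Continuous fun x => χ x * g x := χ.continuous.mul hgc
  have hd : ContDiffOn ℝ (2 * k) (fun x => χ x * g x) {0}ᶜ :=
    ((contDiff_infty.1 hχ (2 * k)).contDiffOn).mul (contDiffOn_rpow_mul_log _ a b _)
  have hsupp : HasCompactSupport fun x => χ x * g x := χ.hasCompactSupport.mul_right
  have hzero (x : EuclideanSpace ℝ (Fin n)) (hx : 2 ≤ ‖x‖) : χ x * g x = 0 := by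
    rw [χ.zero_of_le_dist (by simpa using hx), zero_mul]
  have hfar (x : EuclideanSpace ℝ (Fin n)) (hx : 2 < ‖x‖) :
      negLapPow k (fun x => χ x * g x) x = 0 := by
    have hU : IsOpen {x : EuclideanSpace ℝ (Fin n) | 2 < ‖x‖} :=
      isOpen_lt continuous_const continuous_norm
    rw [negLapPow_congr (v := fun _ => 0) hU (fun y hy => hzero y (le_of_lt hy)) k hx,
      negLapPow_zero_fun]
  refine ⟨fun x => χ x * g x, hc, hd, hzero, fun x hx hx1 => ?_, ?_, ?_, hfar⟩
  · rw [← hab x hx]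
    refine negLapPow_congr (U := Metric.ball 0 1) Metric.isOpen_ball (fun y hy => ?_) k (by simpa)
    rw [χ.one_of_mem_closedBall (Metric.ball_subset_closedBall hy), one_mul]
  · obtain ⟨K, hK⟩ := hsupp.exists_bound_of_continuous hc
    exact ⟨K, fun x => by simpa using hK x⟩
  · have hcont : ContinuousOn (negLapPow k fun x => χ x * g x) {0}ᶜ :=
      (ContDiffOn.negLapPow (m := 0) isOpen_compl_singleton (by simpa using hd)).continuousOn
    have hcomp : IsCompact (Metric.closedBall (0 : EuclideanSpace ℝ (Fin n)) 2 \ Metric.ball 0 1) :=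
      (isCompact_closedBall _ _).diff Metric.isOpen_ball
    obtain ⟨K, hK⟩ := hcomp.exists_bound_of_continuousOn (hcont.mono fun x hx => by
      rintro rfl
      simp at hx)
    refine ⟨max K 0, fun x hx => ?_⟩
    rcases le_or_gt ‖x‖ 2 with h2 | h2
    · exact le_max_of_le_left (hK x ⟨by simpa using h2, by simpa using hx⟩)
    · rw [hfar x h2, abs_zero]
      exact le_max_right _ _

/-- For `0 < α < n - 2k` there is a positive function comparable to `(1 + |x|²)^{-α/2}` whose
image under `(-Δ)^k` is comparable to `|x|^{-σ} (1 + |x|²)^{-(α + 2k - σ)/2}`. -/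
lemma exists_profile {k : ℕ} {σ α : ℝ} (hσ : 0 ≤ σ) (hσk : σ < 2 * k) (hα : 0 < α)
    (hαn : α < n - 2 * k) :
    ∃ u : EuclideanSpace ℝ (Fin n) → ℝ, Continuous u ∧ ContDiffOn ℝ (2 * k) u {0}ᶜ ∧
      ∃ c C : ℝ, 0 < c ∧ 0 < C ∧
        (∀ x, c * (1 + ‖x‖ ^ 2) ^ (-(α / 2)) ≤ u x ∧ u x ≤ C * (1 + ‖x‖ ^ 2) ^ (-(α / 2))) ∧
        ∀ x, x ≠ 0 →
          c * (‖x‖ ^ (-σ) * (1 + ‖x‖ ^ 2) ^ (-((α + 2 * k - σ) / 2))) ≤ negLapPow k u x ∧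
          negLapPow k u x ≤ C * (‖x‖ ^ (-σ) * (1 + ‖x‖ ^ 2) ^ (-((α + 2 * k - σ) / 2))) := by
  obtain ⟨h, hc, hd, hz, hin, ⟨K, hK⟩, ⟨K₁, hK₁⟩, hout⟩ :=
    exists_local_solution (n := n) (k := k) (σ := σ) hσk (by linarith)
  obtain ⟨l, L, hl, hL, hlL⟩ :=
    exists_negLapPow_bubble_bounds (n := n) (s := α / 2) (k := k) (by linarith) (by linarith)
  set W : EuclideanSpace ℝ (Fin n) → ℝ := fun y => (1 + ‖y‖ ^ 2) ^ (-(α / 2)) with hW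
  have hWd : ContDiff ℝ ∞ W := by simpa [hW] using contDiff_bubble (n := n) (α / 2) 1
  have h5 : (0 : ℝ) < 5 ^ (-(α / 2)) := by positivity
  have h5' : (0 : ℝ) < 5 ^ (-(α / 2 + k)) := by positivity
  obtain ⟨M, hM1, hMK, hMK₁⟩ : ∃ M : ℝ, 1 ≤ M ∧ K ≤ M / 2 * 5 ^ (-(α / 2)) ∧
      K₁ ≤ M / 2 * (l * 5 ^ (-(α / 2 + k))) := by
    refine ⟨max 1 (max (2 * K / 5 ^ (-(α / 2))) (2 * K₁ / (l * 5 ^ (-(α / 2 + k))))),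
      le_max_left _ _, ?_, ?_⟩
    · have := (le_max_left (2 * K / 5 ^ (-(α / 2))) (2 * K₁ / (l * 5 ^ (-(α / 2 + k))))).trans
        (le_max_right 1 _)
      rw [div_le_iff₀ h5] at this
      linarith
    · have := (le_max_right (2 * K / 5 ^ (-(α / 2))) (2 * K₁ / (l * 5 ^ (-(α / 2 + k))))).trans
        (le_max_right 1 _)
      rw [div_le_iff₀ (by positivity)] at this
      linarith
  have hM : 0 < M := by linarith
  have hneg (x : EuclideanSpace ℝ (Fin n)) (hx : x ≠ 0) :
      negLapPow k (fun y => M * W y + h y) x = M * negLapPow k W x + negLapPow k h x := by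
    have hW2 : ContDiffOn ℝ (2 * k) W {0}ᶜ := (contDiff_infty.1 hWd (2 * k)).contDiffOn
    refine (negLapPow_add isOpen_compl_singleton (contDiffOn_const.mul hW2) hd hx).trans ?_
    exact congrArg (· + negLapPow k h x) (negLapPow_const_mul isOpen_compl_singleton M hW2 hx)
  have hsmall (x : EuclideanSpace ℝ (Fin n)) : |h x| ≤ M / 2 * W x := by
    rcases le_or_gt 2 ‖x‖ with h2 | h2
    · rw [hz x h2, abs_zero]
      positivity
    · refine (hK x).trans (hMK.trans ?_)
      gcongr
      exact Real.rpow_le_rpow_of_nonpos (by positivity) (by nlinarith [norm_nonneg x])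
        (by linarith)
  have hfar (x : EuclideanSpace ℝ (Fin n)) (hx : 1 ≤ ‖x‖) :
      |negLapPow k h x| ≤ M / 2 * negLapPow k W x := by
    rcases lt_or_ge 2 ‖x‖ with h2 | h2
    · rw [hout x h2, abs_zero]
      have : 0 ≤ l * (1 + ‖x‖ ^ 2) ^ (-(α / 2 + k)) := by positivity
      have := this.trans (hlL x).1
      positivity
    · refine (hK₁ x hx).trans (hMK₁.trans ?_)
      refine mul_le_mul_of_nonneg_left (le_trans ?_ (hlL x).1) (by positivity)
      refine mul_le_mul_of_nonneg_left ?_ hl.le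
      exact Real.rpow_le_rpow_of_nonpos (by positivity) (by nlinarith [norm_nonneg x])
        (by linarith [k.cast_nonneg (α := ℝ)])
  -- Comparison of the two weights away from the origin and near the origin.
  have hT_far (x : EuclideanSpace ℝ (Fin n)) (hx : 1 ≤ ‖x‖) :
      (1 + ‖x‖ ^ 2) ^ (-(α / 2 + k)) ≤ ‖x‖ ^ (-σ) * (1 + ‖x‖ ^ 2) ^ (-((α + 2 * k - σ) / 2)) ∧
      ‖x‖ ^ (-σ) * (1 + ‖x‖ ^ 2) ^ (-((α + 2 * k - σ) / 2))
        ≤ 2 ^ (σ / 2) * (1 + ‖x‖ ^ 2) ^ (-(α / 2 + k)) := by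
    have hx0 : 0 < ‖x‖ := by linarith
    have e1 : (1 + ‖x‖ ^ 2) ^ (-((α + 2 * k - σ) / 2))
        = (1 + ‖x‖ ^ 2) ^ (-(α / 2 + k)) * (1 + ‖x‖ ^ 2) ^ (σ / 2) := by
      rw [← Real.rpow_add (by positivity)]; ring_nf
    have e2 : ‖x‖ ^ (-σ) = (‖x‖ ^ 2) ^ (-(σ / 2)) := by
      rw [← Real.rpow_natCast, ← Real.rpow_mul hx0.le]; push_cast; ring_nf
    have e3 : ‖x‖ ^ (-σ) * (1 + ‖x‖ ^ 2) ^ (σ / 2) = ((1 + ‖x‖ ^ 2) / ‖x‖ ^ 2) ^ (σ / 2) := by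
      rw [e2, Real.div_rpow (by positivity) (by positivity), Real.rpow_neg (by positivity)]
      field_simp
    have e4 : ‖x‖ ^ (-σ) * (1 + ‖x‖ ^ 2) ^ (-((α + 2 * k - σ) / 2)) =
        ((1 + ‖x‖ ^ 2) / ‖x‖ ^ 2) ^ (σ / 2) * (1 + ‖x‖ ^ 2) ^ (-(α / 2 + k)) := by
      rw [← e3, e1]; ring
    rw [e4]
    constructor
    · refine le_mul_of_one_le_left (by positivity) (Real.one_le_rpow ?_ (by linarith))
      rw [one_le_div (by positivity)]
      linarith
    · gcongr
      rw [div_le_iff₀ (by positivity)]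
      nlinarith
  have hnear (x : EuclideanSpace ℝ (Fin n)) (hx : x ≠ 0) (hx1 : ‖x‖ < 1) :
      1 ≤ ‖x‖ ^ (-σ) ∧ (1 + ‖x‖ ^ 2) ^ (-((α + 2 * k - σ) / 2)) ≤ 1 ∧
      (2 : ℝ) ^ (-((α + 2 * k - σ) / 2)) ≤ (1 + ‖x‖ ^ 2) ^ (-((α + 2 * k - σ) / 2)) ∧
      (1 + ‖x‖ ^ 2) ^ (-(α / 2 + k)) ≤ 1 := by
    have hx0 : 0 < ‖x‖ := norm_pos_iff.2 hx
    have hk0 : (0 : ℝ) ≤ k := k.cast_nonneg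
    refine ⟨Real.one_le_rpow_of_pos_of_le_one_of_nonpos hx0 hx1.le (by linarith),
      Real.rpow_le_one_of_one_le_of_nonpos (by nlinarith) (by linarith),
      Real.rpow_le_rpow_of_nonpos (by positivity) (by nlinarith) (by linarith),
      Real.rpow_le_one_of_one_le_of_nonpos (by nlinarith) (by linarith)⟩
  have hT2 : (0 : ℝ) < 2 ^ (-((α + 2 * k - σ) / 2)) := by positivity
  have hσ2 : (0 : ℝ) < 2 ^ (σ / 2) := by positivity
  set A : ℝ := 2 ^ (-((α + 2 * k - σ) / 2)) with hA
  set B : ℝ := 2 ^ (σ / 2) with hB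
  refine ⟨fun y => M * W y + h y, (continuous_const.mul hWd.continuous).add hc,
    (contDiffOn_const.mul (contDiff_infty.1 hWd (2 * k)).contDiffOn).add hd,
    min (M / 2) (min (M / 2 * l / B) 1),
    max (3 * M / 2) (max (3 * M / 2 * L) ((M * L + 1) / A)), by positivity, by positivity,
    fun x => ?_, fun x hx => ?_⟩
  · have hWx : 0 ≤ W x := by positivity
    have := abs_le.1 (hsmall x)
    constructor
    · refine (mul_le_mul_of_nonneg_right (min_le_left _ _) hWx).trans ?_
      linarith
    · refine le_trans ?_ (mul_le_mul_of_nonneg_right (le_max_left _ _) hWx)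
      linarith
  · rw [hneg x hx]
    have hT0 : 0 ≤ ‖x‖ ^ (-σ) * (1 + ‖x‖ ^ 2) ^ (-((α + 2 * k - σ) / 2)) := by positivity
    rcases le_or_gt 1 ‖x‖ with h1 | h1
    · obtain ⟨t1, t2⟩ := hT_far x h1
      obtain ⟨w1, w2⟩ := hlL x
      have := abs_le.1 (hfar x h1)
      constructor
      · refine (mul_le_mul_of_nonneg_right ((min_le_right _ _).trans (min_le_left _ _)) hT0).trans ?_
        calc M / 2 * l / B * (‖x‖ ^ (-σ) * (1 + ‖x‖ ^ 2) ^ (-((α + 2 * k - σ) / 2)))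
            ≤ M / 2 * l / B * (B * (1 + ‖x‖ ^ 2) ^ (-(α / 2 + k))) := by gcongr
          _ = M / 2 * (l * (1 + ‖x‖ ^ 2) ^ (-(α / 2 + k))) := by field_simp
          _ ≤ M / 2 * negLapPow k W x := by gcongr
          _ ≤ _ := by linarith
      · refine le_trans ?_ (mul_le_mul_of_nonneg_right
          ((le_max_left _ _).trans (le_max_right _ _)) hT0)
        calc M * negLapPow k W x + negLapPow k h x ≤ 3 * M / 2 * negLapPow k W x := by linarith
          _ ≤ 3 * M / 2 * (L * (1 + ‖x‖ ^ 2) ^ (-(α / 2 + k))) := by gcongr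
          _ ≤ 3 * M / 2 * (L * (‖x‖ ^ (-σ) * (1 + ‖x‖ ^ 2) ^ (-((α + 2 * k - σ) / 2)))) := by gcongr
          _ = _ := by ring
    · obtain ⟨r1, r2, r3, r4⟩ := hnear x hx h1
      obtain ⟨w1, w2⟩ := hlL x
      have hw0 : 0 ≤ negLapPow k W x := le_trans (by positivity) w1
      rw [hin x hx h1]
      constructor
      · refine (mul_le_mul_of_nonneg_right ((min_le_right _ _).trans (min_le_right _ _)) hT0).trans ?_
        calc 1 * (‖x‖ ^ (-σ) * (1 + ‖x‖ ^ 2) ^ (-((α + 2 * k - σ) / 2))) ≤ 1 * (‖x‖ ^ (-σ) * 1) := by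
              gcongr
          _ = ‖x‖ ^ (-σ) := by ring
          _ ≤ _ := le_add_of_nonneg_left (by positivity)
      · refine le_trans ?_ (mul_le_mul_of_nonneg_right
          ((le_max_right _ _).trans (le_max_right _ _)) hT0)
        calc M * negLapPow k W x + ‖x‖ ^ (-σ)
            ≤ M * (L * (1 + ‖x‖ ^ 2) ^ (-(α / 2 + k))) + ‖x‖ ^ (-σ) := by gcongr
          _ ≤ M * (L * 1) + ‖x‖ ^ (-σ) := by gcongr
          _ ≤ M * L * ‖x‖ ^ (-σ) + ‖x‖ ^ (-σ) := by
              nlinarith [mul_pos hM hL]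
          _ = (M * L + 1) / A * (‖x‖ ^ (-σ) * A) := by field_simp
          _ ≤ _ := by gcongr

lemma doubleBounded_ite_div {f g : EuclideanSpace ℝ (Fin n) → ℝ} {c C : ℝ} (hc : 0 < c)
    (hC : 0 < C) (hg : ∀ x, x ≠ 0 → 0 < g x) (h : ∀ x, x ≠ 0 → c * g x ≤ f x ∧ f x ≤ C * g x) :
    DoubleBounded fun x => if x = 0 then 1 else f x / g x := by
  refine ⟨max (max C 1) (1 / c), by positivity, fun x => ?_⟩
  have h1 : 1 / max (max C 1) (1 / c) ≤ c := by
    rw [div_le_iff₀ (by positivity)]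
    calc 1 = c * (1 / c) := by field_simp
      _ ≤ _ := by gcongr; exact le_max_right _ _
  have h2 : (1 : ℝ) ≤ max (max C 1) (1 / c) := (le_max_right _ _).trans (le_max_left _ _)
  have h3 : C ≤ max (max C 1) (1 / c) := (le_max_left _ _).trans (le_max_left _ _)
  by_cases hx : x = 0
  · simp only [hx, if_true]
    exact ⟨(div_le_one (by positivity)).2 h2, h2⟩
  · simp only [hx, if_false]
    obtain ⟨a, b⟩ := h x hx
    exact ⟨h1.trans ((le_div_iff₀ (hg x hx)).2 a), ((div_le_iff₀ (hg x hx)).2 b).trans h3⟩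

/-- The quotient of `(-Δ)^k u` by `|x|^{-σ} v^q` is double bounded when `u` and `v` have matching
decay. -/
lemma doubleBounded_quotient {σ β q γ c C d D : ℝ} {f v : EuclideanSpace ℝ (Fin n) → ℝ}
    (hc : 0 < c) (hC : 0 < C) (hd : 0 < d) (hD : 0 < D) (hq : 0 < q) (hγ : β * q = γ)
    (hv : ∀ x, d * (1 + ‖x‖ ^ 2) ^ (-(β / 2)) ≤ v x ∧ v x ≤ D * (1 + ‖x‖ ^ 2) ^ (-(β / 2)))
    (hf : ∀ x, x ≠ 0 → c * (‖x‖ ^ (-σ) * (1 + ‖x‖ ^ 2) ^ (-(γ / 2))) ≤ f x ∧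
      f x ≤ C * (‖x‖ ^ (-σ) * (1 + ‖x‖ ^ 2) ^ (-(γ / 2)))) :
    DoubleBounded fun x => if x = 0 then 1 else f x / (‖x‖ ^ (-σ) * v x ^ q) := by
  have hvpos (x) : 0 < v x := lt_of_lt_of_le (by positivity) (hv x).1
  have e (x : EuclideanSpace ℝ (Fin n)) :
      ((1 + ‖x‖ ^ 2) ^ (-(β / 2))) ^ q = (1 + ‖x‖ ^ 2) ^ (-(γ / 2)) := by
    rw [← Real.rpow_mul (by positivity), ← hγ]; ring_nf
  have hvq (x) : d ^ q * (1 + ‖x‖ ^ 2) ^ (-(γ / 2)) ≤ v x ^ q ∧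
      v x ^ q ≤ D ^ q * (1 + ‖x‖ ^ 2) ^ (-(γ / 2)) := by
    rw [← e x, ← Real.mul_rpow hd.le (by positivity), ← Real.mul_rpow hD.le (by positivity)]
    exact ⟨Real.rpow_le_rpow (by positivity) (hv x).1 hq.le,
      Real.rpow_le_rpow (hvpos x).le (hv x).2 hq.le⟩
  have hdq : 0 < d ^ q := by positivity
  have hDq : 0 < D ^ q := by positivity
  refine doubleBounded_ite_div (c := c / D ^ q) (C := C / d ^ q) (by positivity) (by positivity)
    (fun x hx => ?_) fun x hx => ⟨?_, ?_⟩
  · have := hvpos x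
    have := norm_pos_iff.2 hx
    positivity
  · refine le_trans ?_ (hf x hx).1
    calc c / D ^ q * (‖x‖ ^ (-σ) * v x ^ q)
        ≤ c / D ^ q * (‖x‖ ^ (-σ) * (D ^ q * (1 + ‖x‖ ^ 2) ^ (-(γ / 2)))) := by
          gcongr; exact (hvq x).2
      _ = _ := by field_simp
  · refine (hf x hx).2.trans ?_
    calc C * (‖x‖ ^ (-σ) * (1 + ‖x‖ ^ 2) ^ (-(γ / 2)))
        = C / d ^ q * (‖x‖ ^ (-σ) * (d ^ q * (1 + ‖x‖ ^ 2) ^ (-(γ / 2)))) := by field_simp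
      _ ≤ _ := by gcongr; exact (hvq x).1

lemma exists_solution {k : ℕ} {σ₁ σ₂ p q α β : ℝ} (hσ₁ : 0 ≤ σ₁ ∧ σ₁ < 2 * (k : ℝ))
    (hσ₂ : 0 ≤ σ₂ ∧ σ₂ < 2 * (k : ℝ)) (hp : 0 < p) (hq : 0 < q) (hα : 0 < α) (hβ : 0 < β)
    (hαn : α < n - 2 * k) (hβn : β < n - 2 * k) (h₁ : β * q = α + 2 * k - σ₁)
    (h₂ : α * p = β + 2 * k - σ₂) :
    ∃ c₁ c₂ u v : EuclideanSpace ℝ (Fin n) → ℝ,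
      DoubleBounded c₁ ∧ DoubleBounded c₂ ∧
      (∀ x, 0 < u x) ∧ (∀ x, 0 < v x) ∧ Continuous u ∧ Continuous v ∧
      ContDiffOn ℝ (2 * k) u {(0 : EuclideanSpace ℝ (Fin n))}ᶜ ∧
      ContDiffOn ℝ (2 * k) v {(0 : EuclideanSpace ℝ (Fin n))}ᶜ ∧
      ∀ x : EuclideanSpace ℝ (Fin n), x ≠ 0 →
        negLapPow k u x = c₁ x * ‖x‖ ^ (-σ₁) * v x ^ q ∧
        negLapPow k v x = c₂ x * ‖x‖ ^ (-σ₂) * u x ^ p := by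
  obtain ⟨u, hu, hud, c, C, hc, hC, hub, hLu⟩ := exists_profile (n := n) hσ₁.1 hσ₁.2 hα hαn
  obtain ⟨v, hv, hvd, d, D, hd, hD, hvb, hLv⟩ := exists_profile (n := n) hσ₂.1 hσ₂.2 hβ hβn
  have hupos (x) : 0 < u x := lt_of_lt_of_le (by positivity) (hub x).1
  have hvpos (x) : 0 < v x := lt_of_lt_of_le (by positivity) (hvb x).1
  refine ⟨fun x => if x = 0 then 1 else negLapPow k u x / (‖x‖ ^ (-σ₁) * v x ^ q),
    fun x => if x = 0 then 1 else negLapPow k v x / (‖x‖ ^ (-σ₂) * u x ^ p), u, v,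
    doubleBounded_quotient hc hC hd hD hq h₁ hvb hLu,
    doubleBounded_quotient hd hD hc hC hp h₂ hub hLv, hupos, hvpos, hu, hv, hud, hvd,
    fun x hx => ?_⟩
  have hx0 := norm_pos_iff.2 hx
  have h1 : ‖x‖ ^ (-σ₁) ≠ 0 := by positivity
  have h2 : ‖x‖ ^ (-σ₂) ≠ 0 := by positivity
  have h3 : v x ^ q ≠ 0 := (Real.rpow_pos_of_pos (hvpos x) q).ne'
  have h4 : u x ^ p ≠ 0 := (Real.rpow_pos_of_pos (hupos x) p).ne'
  simp only [hx, if_false]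
  constructor <;> field_simp

end Existence

section Cutoff

variable {n : ℕ}

/-! ### Cutoff functions -/

/-- Smooth cutoff functions equal to `1` on the unit ball and vanishing outside the ball of
radius `2`. -/
structure IsCutoff (Φ : EuclideanSpace ℝ (Fin n) → ℝ) : Prop where
  contDiff : ContDiff ℝ ∞ Φ
  nonneg : ∀ x, 0 ≤ Φ x
  le_one : ∀ x, Φ x ≤ 1
  eq_one : ∀ x, ‖x‖ ≤ 1 → Φ x = 1
  eq_zero : ∀ x, 2 ≤ ‖x‖ → Φ x = 0

lemma exists_fderiv_mul_pow {g ψ : EuclideanSpace ℝ (Fin n) → ℝ} (hg : ContDiff ℝ ∞ g)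
    (hψ : ContDiff ℝ ∞ ψ) (m : ℕ) (e : EuclideanSpace ℝ (Fin n)) :
    ∃ g' : EuclideanSpace ℝ (Fin n) → ℝ, ContDiff ℝ ∞ g' ∧
      (fun x => fderiv ℝ (fun y => g y * ψ y ^ (m + 1)) x e) = fun x => g' x * ψ x ^ m := by
  refine ⟨fun x => fderiv ℝ g x e * ψ x + (m + 1) * (g x * fderiv ℝ ψ x e), ?_, ?_⟩
  · have h1 : ContDiff ℝ ∞ fun x => fderiv ℝ g x e :=
      (hg.fderiv_right (m := ∞) (by simp)).clm_apply contDiff_const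
    have h2 : ContDiff ℝ ∞ fun x => fderiv ℝ ψ x e :=
      (hψ.fderiv_right (m := ∞) (by simp)).clm_apply contDiff_const
    exact (h1.mul hψ).add (contDiff_const.mul (hg.mul h2))
  · funext x
    have hgx := (hg.differentiable (by simp) x).hasFDerivAt
    have hψx := (hψ.differentiable (by simp) x).hasFDerivAt
    rw [(hgx.fun_mul (hψx.pow (m + 1))).fderiv]
    simp
    ring

lemma exists_laplacian_mul_pow {g ψ : EuclideanSpace ℝ (Fin n) → ℝ} (hg : ContDiff ℝ ∞ g)
    (hψ : ContDiff ℝ ∞ ψ) (m : ℕ) :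
    ∃ g' : EuclideanSpace ℝ (Fin n) → ℝ, ContDiff ℝ ∞ g' ∧
      (fun x => laplacian (fun y => g y * ψ y ^ (m + 2)) x) = fun x => g' x * ψ x ^ m := by
  have key (i : Fin n) : ∃ g' : EuclideanSpace ℝ (Fin n) → ℝ, ContDiff ℝ ∞ g' ∧
      (fun x => fderiv ℝ (fderiv ℝ fun y => g y * ψ y ^ (m + 2)) x (EuclideanSpace.single i 1)
        (EuclideanSpace.single i 1)) = fun x => g' x * ψ x ^ m := by
    obtain ⟨g₁, hg₁, h₁⟩ := exists_fderiv_mul_pow hg hψ (m + 1) (EuclideanSpace.single i 1)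
    obtain ⟨g₂, hg₂, h₂⟩ := exists_fderiv_mul_pow hg₁ hψ m (EuclideanSpace.single i 1)
    refine ⟨g₂, hg₂, ?_⟩
    rw [← h₂, ← h₁]
    funext x
    have hd : ContDiff ℝ ∞ (fderiv ℝ fun y => g y * ψ y ^ (m + 2)) :=
      (hg.mul (hψ.pow _)).fderiv_right (m := ∞) (by simp)
    rw [fderiv_clm_apply (hd.differentiable (by simp) x) (differentiableAt_const _)]
    simp
  choose G hG h using key
  refine ⟨fun x => ∑ i, G i x, ContDiff.sum fun i _ => hG i, ?_⟩
  funext x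
  rw [laplacian_eq_sum_fderiv, Finset.sum_mul]
  exact Finset.sum_congr rfl fun i _ => congrFun (h i) x

lemma exists_negLapPow_mul_pow {g ψ : EuclideanSpace ℝ (Fin n) → ℝ} (hg : ContDiff ℝ ∞ g)
    (hψ : ContDiff ℝ ∞ ψ) (m k : ℕ) :
    ∃ g' : EuclideanSpace ℝ (Fin n) → ℝ, ContDiff ℝ ∞ g' ∧
      negLapPow k (fun y => g y * ψ y ^ (m + 2 * k)) = fun x => g' x * ψ x ^ m := by
  induction k generalizing g with
  | zero => exact ⟨g, hg, by simp [negLapPow_zero]⟩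
  | succ k ih =>
    obtain ⟨g₁, hg₁, h₁⟩ := exists_laplacian_mul_pow hg hψ (m + 2 * k)
    obtain ⟨g₂, hg₂, h₂⟩ := ih hg₁.neg
    refine ⟨g₂, hg₂, ?_⟩
    rw [← h₂, negLapPow_succ']
    congr 1
    funext x
    have : laplacian (fun y => g y * ψ y ^ (m + 2 * k + 2)) x = _ := congrFun h₁ x
    rw [show m + 2 * (k + 1) = m + 2 * k + 2 by ring, this]
    simp

/-- There are cutoff functions `Φ` with `|(-Δ)^k Φ| ≤ K Φ^θ` for any given `θ < 1`. -/
lemma exists_isCutoff (n k : ℕ) {θ : ℝ} (hθ : θ < 1) :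
    ∃ Φ : EuclideanSpace ℝ (Fin n) → ℝ, IsCutoff Φ ∧
      ∃ K, 0 < K ∧ ∀ x, |negLapPow k Φ x| ≤ K * Φ x ^ θ := by
  let ψ : ContDiffBump (0 : EuclideanSpace ℝ (Fin n)) := ⟨1, 2, one_pos, one_lt_two⟩
  have hψ : ContDiff ℝ ∞ ψ := ψ.contDiff
  obtain ⟨m, hm⟩ := exists_nat_ge (2 * k * θ / (1 - θ))
  have hm' : ((m + 1 + 2 * k : ℕ) : ℝ) * θ ≤ (m + 1 : ℕ) := by
    rw [div_le_iff₀ (by linarith)] at hm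
    push_cast
    nlinarith
  obtain ⟨g, hg, hgk⟩ := exists_negLapPow_mul_pow (g := fun _ => 1) contDiff_const hψ (m + 1) k
  obtain ⟨K, hK⟩ := (isCompact_closedBall (0 : EuclideanSpace ℝ (Fin n)) 2).exists_bound_of_continuousOn
    hg.continuous.continuousOn
  have hzero (x : EuclideanSpace ℝ (Fin n)) (hx : 2 ≤ ‖x‖) : ψ x = 0 :=
    ψ.zero_of_le_dist (by simpa using hx)
  refine ⟨fun y => ψ y ^ (m + 1 + 2 * k), ⟨hψ.pow _, fun x => pow_nonneg ψ.nonneg _,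
    fun x => pow_le_one₀ ψ.nonneg ψ.le_one, fun x hx => ?_, fun x hx => ?_⟩, max K 1,
    by positivity, fun x => ?_⟩
  · rw [ψ.one_of_mem_closedBall (by simpa using hx), one_pow]
  · rw [hzero x hx, zero_pow (by omega)]
  · simp only [one_mul] at hgk
    have hψ0 : 0 ≤ ψ x := ψ.nonneg
    change _ ≤ max K 1 * (ψ x ^ (m + 1 + 2 * k)) ^ θ
    rw [hgk, abs_mul, abs_of_nonneg (pow_nonneg ψ.nonneg (m + 1))]
    rcases le_or_gt 2 ‖x‖ with hx | hx
    · rw [hzero x hx, zero_pow (by omega), mul_zero]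
      positivity
    · refine mul_le_mul (le_max_of_le_left (hK x (by simpa using hx.le))) ?_ (by positivity)
        (by positivity)
      have hpos : 0 < ψ x := ψ.pos_of_mem_ball (by simpa using hx)
      rw [← Real.rpow_natCast, ← Real.rpow_natCast, ← Real.rpow_mul hpos.le]
      exact Real.rpow_le_rpow_of_exponent_ge hpos ψ.le_one hm'

namespace IsCutoff

variable {Φ : EuclideanSpace ℝ (Fin n) → ℝ}

lemma hasCompactSupport (hΦ : IsCutoff Φ) : HasCompactSupport Φ := by
  refine HasCompactSupport.of_support_subset_isCompact (isCompact_closedBall 0 2) fun x hx => ?_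
  by_contra h
  exact hx (hΦ.eq_zero x (not_le.1 (by simpa using h)).le)

lemma scale_eq_one (hΦ : IsCutoff Φ) {R : ℝ} (hR : 0 < R) {x : EuclideanSpace ℝ (Fin n)}
    (hx : ‖x‖ ≤ R) : Φ (R⁻¹ • x) = 1 := by
  refine hΦ.eq_one _ ?_
  rw [norm_smul, norm_inv, Real.norm_of_nonneg hR.le, inv_mul_le_iff₀ hR]
  linarith

lemma scale_eq_zero (hΦ : IsCutoff Φ) {R : ℝ} (hR : 0 < R) {x : EuclideanSpace ℝ (Fin n)}
    (hx : 2 * R ≤ ‖x‖) : Φ (R⁻¹ • x) = 0 := by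
  refine hΦ.eq_zero _ ?_
  rw [norm_smul, norm_inv, Real.norm_of_nonneg hR.le, le_inv_mul_iff₀ hR]
  linarith

lemma contDiff_scale (hΦ : IsCutoff Φ) (R : ℝ) : ContDiff ℝ ∞ fun x => Φ (R⁻¹ • x) :=
  hΦ.contDiff.comp (contDiff_const_smul R⁻¹)

lemma hasCompactSupport_scale (hΦ : IsCutoff Φ) {R : ℝ} (hR : 0 < R) :
    HasCompactSupport fun x => Φ (R⁻¹ • x) :=
  hΦ.hasCompactSupport.comp_smul (inv_ne_zero hR.ne')

lemma scale_le_scale (hΦ : IsCutoff Φ) {R S : ℝ} (hS : 0 < S) (hSR : 2 * S ≤ R)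
    (x : EuclideanSpace ℝ (Fin n)) : Φ (S⁻¹ • x) ≤ Φ (R⁻¹ • x) := by
  rcases le_total ‖x‖ R with h | h
  · rw [hΦ.scale_eq_one (by linarith) h]
    exact hΦ.le_one _
  · rw [hΦ.scale_eq_zero hS (hSR.trans h)]
    exact hΦ.nonneg _

lemma scale_sub_scale_eq_zero (hΦ : IsCutoff Φ) {R S : ℝ} (hR : 0 < R) (hS : 0 < S)
    {x : EuclideanSpace ℝ (Fin n)} (hx : ‖x‖ ≤ min R S) : Φ (R⁻¹ • x) - Φ (S⁻¹ • x) = 0 := by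
  rw [hΦ.scale_eq_one hR (hx.trans (min_le_left _ _)),
    hΦ.scale_eq_one hS (hx.trans (min_le_right _ _)), sub_self]

lemma hasCompactSupport_scale_sub_mul (hΦ : IsCutoff Φ) {R S : ℝ} (hR : 0 < R) (hS : 0 < S)
    (f : EuclideanSpace ℝ (Fin n) → ℝ) :
    HasCompactSupport fun x => (Φ (R⁻¹ • x) - Φ (S⁻¹ • x)) * f x :=
  HasCompactSupport.mul_right
    ((hΦ.hasCompactSupport_scale hR).sub (hΦ.hasCompactSupport_scale hS))

lemma continuous_scale_sub_mul (hΦ : IsCutoff Φ) {R S : ℝ} (hR : 0 < R) (hS : 0 < S)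
    {f : EuclideanSpace ℝ (Fin n) → ℝ} (hf : ContinuousOn f {0}ᶜ) :
    Continuous fun x => (Φ (R⁻¹ • x) - Φ (S⁻¹ • x)) * f x := by
  rw [continuous_iff_continuousAt]
  intro x
  rcases eq_or_ne x 0 with rfl | hx
  · refine ContinuousAt.congr (f := fun _ => 0) continuousAt_const ?_
    filter_upwards [Metric.ball_mem_nhds 0 (lt_min hR hS)] with y hy
    rw [hΦ.scale_sub_scale_eq_zero hR hS (mem_ball_zero_iff.1 hy).le, zero_mul]
  · exact ((hΦ.contDiff_scale R).continuous.sub (hΦ.contDiff_scale S).continuous).continuousAt.mul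
      (hf.continuousAt (isOpen_compl_singleton.mem_nhds hx))

end IsCutoff

/-- The pairing of `u` with `(-Δ)^k` of a cutoff function at scale `R`. -/
def cutoffIntegral (k : ℕ) (Φ u : EuclideanSpace ℝ (Fin n) → ℝ) (R : ℝ) : ℝ :=
  ∫ x, negLapPow k (fun y => Φ (R⁻¹ • y)) x * u x

lemma integrable_negLapPow_scale_mul {k : ℕ} {Φ u : EuclideanSpace ℝ (Fin n) → ℝ}
    (hΦ : IsCutoff Φ) (hu : Continuous u) {R : ℝ} (hR : 0 < R) :
    Integrable fun x => negLapPow k (fun y => Φ (R⁻¹ • y)) x * u x :=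
  ((hΦ.contDiff_scale R).negLapPow_infty.continuous.mul hu).integrable_of_hasCompactSupport
    ((hΦ.hasCompactSupport_scale hR).negLapPow k).mul_right

/-- Green's identity for a function which is only smooth off the origin. -/
lemma cutoffIntegral_sub_cutoffIntegral {k : ℕ} {Φ u : EuclideanSpace ℝ (Fin n) → ℝ}
    (hΦ : IsCutoff Φ) (hu : Continuous u) (hud : ContDiffOn ℝ (2 * k) u {0}ᶜ) {R S : ℝ}
    (hR : 0 < R) (hS : 0 < S) :
    cutoffIntegral k Φ u R - cutoffIntegral k Φ u S
      = ∫ x, (Φ (R⁻¹ • x) - Φ (S⁻¹ • x)) * negLapPow k u x := by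
  set ρ := min R S with hρdef
  have hρ : 0 < ρ := lt_min hR hS
  have hρ2 : 0 < ρ / 2 := by linarith
  set φ : EuclideanSpace ℝ (Fin n) → ℝ := fun x => Φ (R⁻¹ • x) - Φ (S⁻¹ • x) with hφ
  have hφd : ContDiff ℝ ∞ φ := (hΦ.contDiff_scale R).sub (hΦ.contDiff_scale S)
  have hφc : HasCompactSupport φ :=
    (hΦ.hasCompactSupport_scale hR).sub (hΦ.hasCompactSupport_scale hS)
  set w : EuclideanSpace ℝ (Fin n) → ℝ := fun x => (1 - Φ ((ρ / 2)⁻¹ • x)) * u x with hw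
  have hwu (x : EuclideanSpace ℝ (Fin n)) (hx : ρ ≤ ‖x‖) : w x = u x := by
    simp only [hw]
    rw [hΦ.scale_eq_zero hρ2 (by linarith), sub_zero, one_mul]
  have hwd : ContDiff ℝ (2 * k) w := by
    rw [contDiff_iff_contDiffAt]
    intro x
    rcases eq_or_ne x 0 with rfl | hx
    · refine ContDiffAt.congr_of_eventuallyEq (f := fun _ => 0) contDiffAt_const ?_
      filter_upwards [Metric.ball_mem_nhds 0 hρ2] with y hy
      simp only [hw]
      rw [hΦ.scale_eq_one hρ2 (by simpa using (mem_ball_zero_iff.1 hy).le), sub_self, zero_mul]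
    · exact (contDiffAt_const.sub (contDiff_infty.1 (hΦ.contDiff_scale _) (2 * k)).contDiffAt).mul
        (hud.contDiffAt (isOpen_compl_singleton.mem_nhds hx))
  have h1 (x : EuclideanSpace ℝ (Fin n)) : φ x * negLapPow k u x = φ x * negLapPow k w x := by
    rcases le_or_gt ‖x‖ ρ with hx | hx
    · rw [show φ x = 0 from hΦ.scale_sub_scale_eq_zero hR hS hx, zero_mul, zero_mul]
    · have hU : IsOpen {x : EuclideanSpace ℝ (Fin n) | ρ < ‖x‖} :=
        isOpen_lt continuous_const continuous_norm
      rw [negLapPow_congr hU (fun y hy => (hwu y (le_of_lt hy)).symm) k hx]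
  have h2 (x : EuclideanSpace ℝ (Fin n)) : negLapPow k φ x * w x = negLapPow k φ x * u x := by
    rcases lt_or_ge ‖x‖ ρ with hx | hx
    · rw [negLapPow_congr (v := fun _ => 0) (Metric.isOpen_ball (x := 0) (ε := ρ))
        (fun y hy => hΦ.scale_sub_scale_eq_zero hR hS (mem_ball_zero_iff.1 hy).le) k (by simpa),
        negLapPow_zero_fun, zero_mul, zero_mul]
    · rw [hwu x hx]
  have h3 (x : EuclideanSpace ℝ (Fin n)) : negLapPow k φ x
      = negLapPow k (fun y => Φ (R⁻¹ • y)) x - negLapPow k (fun y => Φ (S⁻¹ • y)) x := by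
    have hRd : ContDiffOn ℝ (2 * k) (fun y => Φ (R⁻¹ • y)) univ :=
      (contDiff_infty.1 (hΦ.contDiff_scale R) (2 * k)).contDiffOn
    have hSd : ContDiffOn ℝ (2 * k) (fun y => Φ (S⁻¹ • y)) univ :=
      (contDiff_infty.1 (hΦ.contDiff_scale S) (2 * k)).contDiffOn
    have e : φ = fun y => Φ (R⁻¹ • y) + (-1) * Φ (S⁻¹ • y) := by
      funext y; simp only [hφ]; ring
    rw [e]
    refine (negLapPow_add isOpen_univ hRd (contDiffOn_const.mul hSd) (mem_univ x)).trans ?_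
    refine (congrArg (negLapPow k (fun y => Φ (R⁻¹ • y)) x + ·)
      (negLapPow_const_mul isOpen_univ (-1) hSd (mem_univ x))).trans ?_
    ring
  rw [cutoffIntegral, cutoffIntegral, ← integral_sub (integrable_negLapPow_scale_mul hΦ hu hR)
    (integrable_negLapPow_scale_mul hΦ hu hS)]
  calc _ = ∫ x, negLapPow k φ x * u x := by
        refine integral_congr_ae (Eventually.of_forall fun x => ?_)
        simp only [h3]
        ring
    _ = ∫ x, φ x * negLapPow k u x := by
        simp only [← h2, h1]
        exact (integral_mul_negLapPow_comm hφd hφc hwd).symm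

/-- The pairing at scale `R`, rescaled to the unit scale. -/
lemma cutoffIntegral_eq {k : ℕ} (hn : 2 * k < n) {Φ : EuclideanSpace ℝ (Fin n) → ℝ}
    (hΦ : IsCutoff Φ) (u : EuclideanSpace ℝ (Fin n) → ℝ) {R : ℝ} (hR : 0 < R) :
    cutoffIntegral k Φ u R = R ^ (n - 2 * k) * ∫ y, negLapPow k Φ y * u (R • y) := by
  have h := Measure.integral_comp_inv_smul_of_nonneg volume
    (fun y : EuclideanSpace ℝ (Fin n) => negLapPow k Φ y * u (R • y)) hR.le
  simp only [smul_inv_smul₀ hR.ne', finrank_euclideanSpace, Fintype.card_fin, smul_eq_mul] at h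
  rw [cutoffIntegral, negLapPow_comp_smul hΦ.contDiff, pow_sub₀ R hR.ne' hn.le]
  simp only [mul_assoc]
  rw [integral_const_mul, h, inv_pow]
  ring

lemma tendsto_cutoffIntegral_zero {k : ℕ} (hn : 2 * k < n)
    {Φ u : EuclideanSpace ℝ (Fin n) → ℝ} (hΦ : IsCutoff Φ) (hu : Continuous u) :
    Tendsto (cutoffIntegral k Φ u) (𝓝[>] 0) (𝓝 0) := by
  obtain ⟨K, hK⟩ := (isCompact_closedBall (0 : EuclideanSpace ℝ (Fin n)) 2).exists_bound_of_continuousOn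
    hu.continuousOn
  have hGc : Continuous (negLapPow k Φ) := hΦ.contDiff.negLapPow_infty.continuous
  have hGs : HasCompactSupport (negLapPow k Φ) := hΦ.hasCompactSupport.negLapPow k
  have hGi : Integrable fun y => |negLapPow k Φ y| :=
    (hGc.integrable_of_hasCompactSupport hGs).abs
  have hGz (y : EuclideanSpace ℝ (Fin n)) (hy : 2 < ‖y‖) : negLapPow k Φ y = 0 := by
    have hU : IsOpen {x : EuclideanSpace ℝ (Fin n) | 2 < ‖x‖} :=
      isOpen_lt continuous_const continuous_norm
    rw [negLapPow_congr (v := fun _ => 0) hU (fun y hy => hΦ.eq_zero y (le_of_lt hy)) k hy,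
      negLapPow_zero_fun]
  have hbound : ∀ᶠ R in 𝓝[>] (0 : ℝ), ‖cutoffIntegral k Φ u R‖
      ≤ R ^ (n - 2 * k) * ∫ y, |negLapPow k Φ y| * K := by
    filter_upwards [Ioo_mem_nhdsGT one_pos] with R hR
    rw [cutoffIntegral_eq hn hΦ u hR.1, norm_mul, Real.norm_of_nonneg (pow_nonneg hR.1.le _)]
    refine mul_le_mul_of_nonneg_left ?_ (pow_nonneg hR.1.le _)
    refine norm_integral_le_of_norm_le (hGi.mul_const K) (Eventually.of_forall fun y => ?_)
    rcases le_or_gt ‖y‖ 2 with hy | hy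
    · rw [norm_mul, Real.norm_eq_abs]
      refine mul_le_mul_of_nonneg_left (hK _ ?_) (abs_nonneg _)
      rw [mem_closedBall_zero_iff, norm_smul, Real.norm_of_nonneg hR.1.le]
      nlinarith [hR.2, norm_nonneg y]
    · simp [hGz y hy]
  refine squeeze_zero_norm' hbound ?_
  have : Tendsto (fun R : ℝ => R ^ (n - 2 * k) * ∫ y, |negLapPow k Φ y| * K) (𝓝 0)
      (𝓝 (0 ^ (n - 2 * k) * ∫ y, |negLapPow k Φ y| * K)) :=
    ((continuous_pow _).tendsto 0).mul_const _
  rw [zero_pow (by omega), zero_mul] at this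
  exact this.mono_left nhdsWithin_le_nhds

end Cutoff

section Nonexistence

variable {n k : ℕ} {Φ u v : EuclideanSpace ℝ (Fin n) → ℝ}

/-! ### Nonexistence -/

lemma continuousOn_negLapPow (hu : ContDiffOn ℝ (2 * k) u {0}ᶜ) :
    ContinuousOn (negLapPow k u) {0}ᶜ :=
  (ContDiffOn.negLapPow (m := 0) isOpen_compl_singleton (by simpa using hu)).continuousOn

lemma scale_sub_mul_nonneg (hΦ : IsCutoff Φ) (hf : ∀ x, x ≠ 0 → 0 < negLapPow k u x) {R S : ℝ}
    (hS : 0 < S) (hSR : 2 * S ≤ R) (x : EuclideanSpace ℝ (Fin n)) :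
    0 ≤ (Φ (R⁻¹ • x) - Φ (S⁻¹ • x)) * negLapPow k u x := by
  rcases eq_or_ne x 0 with rfl | hx
  · simp
  · exact mul_nonneg (sub_nonneg.2 (hΦ.scale_le_scale hS hSR x)) (hf x hx).le

lemma cutoffIntegral_le_cutoffIntegral (hΦ : IsCutoff Φ) (hu : Continuous u)
    (hud : ContDiffOn ℝ (2 * k) u {0}ᶜ) (hf : ∀ x, x ≠ 0 → 0 < negLapPow k u x) {R S : ℝ}
    (hS : 0 < S) (hSR : 2 * S ≤ R) : cutoffIntegral k Φ u S ≤ cutoffIntegral k Φ u R := by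
  rw [← sub_nonneg, cutoffIntegral_sub_cutoffIntegral hΦ hu hud (by linarith) hS]
  exact integral_nonneg fun x => scale_sub_mul_nonneg hΦ hf hS hSR x

lemma cutoffIntegral_nonneg (hn : 2 * k < n) (hΦ : IsCutoff Φ) (hu : Continuous u)
    (hud : ContDiffOn ℝ (2 * k) u {0}ᶜ) (hf : ∀ x, x ≠ 0 → 0 < negLapPow k u x) {R : ℝ}
    (hR : 0 < R) : 0 ≤ cutoffIntegral k Φ u R := by
  refine le_of_tendsto (tendsto_cutoffIntegral_zero hn hΦ hu) ?_
  filter_upwards [Ioo_mem_nhdsGT (half_pos hR)] with S hS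
  exact cutoffIntegral_le_cutoffIntegral hΦ hu hud hf hS.1 (by linarith [hS.2])

lemma cutoffIntegral_pos (hn : 2 * k < n) (hΦ : IsCutoff Φ) (hu : Continuous u)
    (hud : ContDiffOn ℝ (2 * k) u {0}ᶜ) (hf : ∀ x, x ≠ 0 → 0 < negLapPow k u x) {R : ℝ}
    (hR : 0 < R) : 0 < cutoffIntegral k Φ u R := by
  have h2 : 0 < R / 2 := half_pos hR
  have h0 := cutoffIntegral_nonneg hn hΦ hu hud hf h2
  refine h0.trans_lt ?_
  rw [← sub_pos, cutoffIntegral_sub_cutoffIntegral hΦ hu hud hR h2]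
  set x : EuclideanSpace ℝ (Fin n) := EuclideanSpace.single ⟨0, by omega⟩ R with hx
  have hxn : ‖x‖ = R := by rw [hx, PiLp.norm_single, Real.norm_of_nonneg hR.le]
  have hx0 : x ≠ 0 := norm_pos_iff.1 (hxn ▸ hR)
  refine (hΦ.continuous_scale_sub_mul hR h2
    (continuousOn_negLapPow hud)).integral_pos_of_hasCompactSupport_nonneg_nonzero
    (hΦ.hasCompactSupport_scale_sub_mul hR h2 _)
    (fun x => scale_sub_mul_nonneg hΦ hf h2 (by linarith) x) (x := x) ?_
  rw [hΦ.scale_eq_one hR hxn.le, hΦ.scale_eq_zero h2 (by linarith)]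
  simpa using ne_of_gt (hf x hx0)

/-- The closed annulus of radii `1` and `2`. -/
def annulus (n : ℕ) : Set (EuclideanSpace ℝ (Fin n)) := Metric.closedBall 0 2 \ Metric.ball 0 1

lemma mem_annulus {x : EuclideanSpace ℝ (Fin n)} : x ∈ annulus n ↔ 1 ≤ ‖x‖ ∧ ‖x‖ ≤ 2 := by
  simp [annulus, and_comm]

lemma isCompact_annulus (n : ℕ) : IsCompact (annulus n) :=
  (isCompact_closedBall _ _).diff Metric.isOpen_ball

lemma negLapPow_eq_zero_of_notMem_annulus (hk : 1 ≤ k) (hΦ : IsCutoff Φ)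
    {x : EuclideanSpace ℝ (Fin n)} (hx : x ∉ annulus n) : negLapPow k Φ x = 0 := by
  rw [mem_annulus, not_and_or, not_le, not_le] at hx
  rcases hx with hx | hx
  · rw [negLapPow_congr (v := fun _ => 1) (Metric.isOpen_ball (x := 0) (ε := 1))
      (fun y hy => hΦ.eq_one y (mem_ball_zero_iff.1 hy).le) k (by simpa), negLapPow_const hk]
  · have hU : IsOpen {x : EuclideanSpace ℝ (Fin n) | 2 < ‖x‖} :=
      isOpen_lt continuous_const continuous_norm
    rw [negLapPow_congr (v := fun _ => 0) hU (fun y hy => hΦ.eq_zero y (le_of_lt hy)) k hx,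
      negLapPow_zero_fun]

/-- Hölder's inequality against the constant function on a compact set. -/
lemma setIntegral_le_rpow {X : Type*} [TopologicalSpace X] [MeasurableSpace X] [BorelSpace X]
    [T2Space X] {μ : Measure X} [IsFiniteMeasureOnCompacts μ] {s : Set X} (hs : IsCompact s) {p : ℝ}
    (hp : 1 < p) {g : X → ℝ} (hg : Continuous g) (hg0 : ∀ x, 0 ≤ g x) :
    ∫ x in s, g x ∂μ ≤ (∫ x in s, g x ^ p ∂μ) ^ (1 / p) * μ.real s ^ (1 - 1 / p) := by
  have hpq := Real.HolderConjugate.conjExponent hp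
  have : IsFiniteMeasure (μ.restrict s) := ⟨by simpa using hs.measure_lt_top⟩
  obtain ⟨K, hK⟩ := hs.exists_bound_of_continuousOn hg.continuousOn
  have hgL : MemLp g (ENNReal.ofReal p) (μ.restrict s) :=
    MemLp.of_bound (hg.continuousOn.aestronglyMeasurable hs.measurableSet) K
      ((ae_restrict_iff' hs.measurableSet).2 (Eventually.of_forall hK))
  have h := integral_mul_le_Lp_mul_Lq_of_nonneg hpq (μ := μ.restrict s) (f := g)
    (g := fun _ => 1) (Eventually.of_forall hg0) (Eventually.of_forall fun _ => zero_le_one) hgL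
    (memLp_const 1)
  have e : 1 / p.conjExponent = 1 - 1 / p := by
    rw [one_div, one_div, hpq.one_sub_inv]
  simpa [e] using h

/-- The pairing with `u` is controlled by the growth of the pairing with `v` when
`(-Δ)^k v ≥ c |x|^{-σ} u^p`. -/
lemma exists_cutoffIntegral_le (hk : 1 ≤ k) (hn : 2 * k < n) (hΦ : IsCutoff Φ) {p σ K c : ℝ}
    (hp : 1 < p) (hσ : 0 ≤ σ) (hK : 0 < K) (hG : ∀ x, |negLapPow k Φ x| ≤ K * Φ x ^ (1 / p))
    (hu : Continuous u) (hu0 : ∀ x, 0 < u x) (hv : Continuous v)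
    (hvd : ContDiffOn ℝ (2 * k) v {0}ᶜ) (hc : 0 < c)
    (hf : ∀ x, x ≠ 0 → c * (‖x‖ ^ (-σ) * u x ^ p) ≤ negLapPow k v x) :
    ∃ M, 0 < M ∧ ∀ R, 0 < R → cutoffIntegral k Φ u R ≤ M * R ^ (n - 2 * k - (n - σ) / p) *
      (cutoffIntegral k Φ v R - cutoffIntegral k Φ v (R / 2)) ^ (1 / p) := by
  have hf0 (x : EuclideanSpace ℝ (Fin n)) (hx : x ≠ 0) : 0 < negLapPow k v x := by
    have := hu0 x
    have := norm_pos_iff.2 hx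
    exact lt_of_lt_of_le (by positivity) (hf x hx)
  have hp0 : 0 < p := by linarith
  set V : ℝ := volume.real (annulus n) ^ (1 - 1 / p) with hV
  have hV0 : 0 ≤ V := by positivity
  refine ⟨K * (V + 1) * (2 ^ σ / c) ^ (1 / p), by positivity, fun R hR => ?_⟩
  have h2 : 0 < R / 2 := half_pos hR
  have hΦc : Continuous Φ := hΦ.contDiff.continuous
  have hun : Continuous fun y => u (R • y) := hu.comp (continuous_const_smul R)
  have hgc : Continuous fun y => Φ y ^ (1 / p) * u (R • y) :=
    (hΦc.rpow_const fun _ => Or.inr (by positivity)).mul hun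
  set J : ℝ := ∫ y in annulus n, Φ y * u (R • y) ^ p with hJ
  have hJ0 : 0 ≤ J := integral_nonneg fun y => mul_nonneg (hΦ.nonneg y)
    (Real.rpow_nonneg (hu0 _).le _)
  have hmeas : MeasurableSet (annulus n) := (isCompact_annulus n).measurableSet
  -- Upper bound for the pairing with `u`.
  have hupper : cutoffIntegral k Φ u R ≤ R ^ (n - 2 * k : ℝ) * (K * (J ^ (1 / p) * V)) := by
    have e : (R : ℝ) ^ (n - 2 * k : ℝ) = R ^ (n - 2 * k) := by
      rw [← Real.rpow_natCast, Nat.cast_sub hn.le]; push_cast; rfl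
    rw [cutoffIntegral_eq hn hΦ u hR, e]
    refine mul_le_mul_of_nonneg_left ?_ (by positivity)
    rw [← setIntegral_eq_integral_of_forall_compl_eq_zero (s := annulus n) fun y hy => by
      rw [negLapPow_eq_zero_of_notMem_annulus hk hΦ hy, zero_mul]]
    calc ∫ y in annulus n, negLapPow k Φ y * u (R • y)
        ≤ ∫ y in annulus n, K * (Φ y ^ (1 / p) * u (R • y)) := by
          refine setIntegral_mono_on ?_ ?_ hmeas fun y _ => ?_
          · exact (hΦ.contDiff.negLapPow_infty.continuous.mul hun).continuousOn.integrableOn_compact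
              (isCompact_annulus n)
          · exact (continuous_const.mul hgc).continuousOn.integrableOn_compact
              (isCompact_annulus n)
          · rw [← mul_assoc]
            exact mul_le_mul_of_nonneg_right ((le_abs_self _).trans (hG y)) (hu0 _).le
      _ = K * ∫ y in annulus n, Φ y ^ (1 / p) * u (R • y) := integral_const_mul _ _
      _ ≤ K * (J ^ (1 / p) * V) := by
          refine mul_le_mul_of_nonneg_left ?_ hK.le
          refine (setIntegral_le_rpow (isCompact_annulus n) hp hgc fun y => mul_nonneg
            (Real.rpow_nonneg (hΦ.nonneg y) _) (hu0 _).le).trans_eq ?_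
          congr 2
          refine integral_congr_ae (Eventually.of_forall fun y => ?_)
          simp only
          rw [Real.mul_rpow (Real.rpow_nonneg (hΦ.nonneg y) _) (hu0 _).le,
            ← Real.rpow_mul (hΦ.nonneg y), one_div_mul_cancel hp0.ne', Real.rpow_one]
  -- Lower bound for the growth of the pairing with `v`.
  set D : ℝ := cutoffIntegral k Φ v R - cutoffIntegral k Φ v (R / 2) with hD
  have hlower : R ^ (n : ℝ) * (c * ((2 * R) ^ (-σ) * J)) ≤ D := by
    have hs := Measure.integral_comp_inv_smul_of_nonneg volume
      (fun y : EuclideanSpace ℝ (Fin n) => (Φ y - Φ ((2 : ℝ) • y)) * negLapPow k v (R • y)) hR.le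
    have e (x : EuclideanSpace ℝ (Fin n)) : (2 : ℝ) • R⁻¹ • x = (R / 2)⁻¹ • x := by
      rw [smul_smul]; congr 1; field_simp
    simp only [smul_inv_smul₀ hR.ne', finrank_euclideanSpace, Fintype.card_fin, smul_eq_mul, e]
      at hs
    rw [hD, cutoffIntegral_sub_cutoffIntegral hΦ hv hvd hR h2, hs, Real.rpow_natCast]
    refine mul_le_mul_of_nonneg_left ?_ (by positivity)
    have hf_int : Integrable fun y : EuclideanSpace ℝ (Fin n) =>
        (Φ y - Φ ((2 : ℝ) • y)) * negLapPow k v (R • y) := by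
      have h := ((hΦ.continuous_scale_sub_mul hR h2
        (continuousOn_negLapPow hvd)).integrable_of_hasCompactSupport
        (hΦ.hasCompactSupport_scale_sub_mul hR h2 _) (μ := volume)).comp_smul hR.ne'
      refine h.congr (Eventually.of_forall fun y => ?_)
      simp only
      rw [← e, inv_smul_smul₀ hR.ne']
    have hnn (y : EuclideanSpace ℝ (Fin n)) :
        0 ≤ (Φ y - Φ ((2 : ℝ) • y)) * negLapPow k v (R • y) := by
      have h := scale_sub_mul_nonneg hΦ hf0 h2 (show 2 * (R / 2) ≤ R by linarith) (R • y)
      rwa [← e, inv_smul_smul₀ hR.ne'] at h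
    calc c * ((2 * R) ^ (-σ) * J)
        = ∫ y in annulus n, c * (2 * R) ^ (-σ) * (Φ y * u (R • y) ^ p) := by
          rw [integral_const_mul, hJ]; ring
      _ ≤ ∫ y in annulus n, (Φ y - Φ ((2 : ℝ) • y)) * negLapPow k v (R • y) := by
          refine setIntegral_mono_on ?_ hf_int.integrableOn hmeas fun y hy => ?_
          · exact (continuous_const.mul (hΦc.mul (hun.rpow_const fun y =>
              Or.inl (hu0 _).ne'))).continuousOn.integrableOn_compact (isCompact_annulus n)
          · obtain ⟨y1, y2⟩ := mem_annulus.1 hy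
            have hy0 : R • y ≠ 0 := smul_ne_zero hR.ne' (norm_pos_iff.1 (by linarith))
            have hyn : ‖R • y‖ = R * ‖y‖ := by rw [norm_smul, Real.norm_of_nonneg hR.le]
            have hz : Φ ((2 : ℝ) • y) = 0 := hΦ.eq_zero _ (by
              rw [norm_smul]; norm_num; linarith)
            rw [hz, sub_zero]
            have hpow : (2 * R) ^ (-σ) ≤ ‖R • y‖ ^ (-σ) :=
              Real.rpow_le_rpow_of_nonpos (norm_pos_iff.2 hy0) (by rw [hyn]; nlinarith)
                (by linarith)
            have hup : 0 < u (R • y) ^ p := Real.rpow_pos_of_pos (hu0 _) _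
            calc c * (2 * R) ^ (-σ) * (Φ y * u (R • y) ^ p)
                = Φ y * (c * ((2 * R) ^ (-σ) * u (R • y) ^ p)) := by ring
              _ ≤ Φ y * (c * (‖R • y‖ ^ (-σ) * u (R • y) ^ p)) := by
                  have := hΦ.nonneg y
                  gcongr
              _ ≤ Φ y * negLapPow k v (R • y) :=
                  mul_le_mul_of_nonneg_left (hf _ hy0) (hΦ.nonneg y)
      _ ≤ _ := setIntegral_le_integral hf_int (Eventually.of_forall hnn)
  have hD0 : 0 ≤ D := le_trans (by positivity) hlower
  have hJD : J ≤ 2 ^ σ / c * R ^ (σ - n) * D := by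
    have e : R ^ (n : ℝ) * (c * ((2 * R) ^ (-σ) * J)) = J / (2 ^ σ / c * R ^ (σ - n)) := by
      rw [Real.mul_rpow two_pos.le hR.le, Real.rpow_neg two_pos.le, Real.rpow_neg hR.le,
        Real.rpow_sub hR]
      field_simp
    rw [e, div_le_iff₀ (by positivity)] at hlower
    linarith
  have hJp : J ^ (1 / p) ≤ (2 ^ σ / c) ^ (1 / p) * R ^ ((σ - n) / p) * D ^ (1 / p) := by
    refine (Real.rpow_le_rpow hJ0 hJD (by positivity)).trans_eq ?_
    rw [Real.mul_rpow (by positivity) hD0, Real.mul_rpow (by positivity) (by positivity),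
      ← Real.rpow_mul hR.le, mul_one_div]
  calc cutoffIntegral k Φ u R ≤ R ^ (n - 2 * k : ℝ) * (K * (J ^ (1 / p) * V)) := hupper
    _ ≤ R ^ (n - 2 * k : ℝ) * (K * (((2 ^ σ / c) ^ (1 / p) * R ^ ((σ - n) / p) * D ^ (1 / p))
          * (V + 1))) := by
        gcongr
        linarith
    _ = K * (V + 1) * (2 ^ σ / c) ^ (1 / p) * (R ^ (n - 2 * k : ℝ) * R ^ ((σ - n) / p))
          * D ^ (1 / p) := by ring
    _ = _ := by
        rw [← Real.rpow_add hR]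
        congr 3
        ring

/-- An increasing positive sequence cannot satisfy `x_{j+1}^s ≤ C (x_{j+1} - x_j)` with
`s > 1`. -/
lemma false_of_rpow_le_sub {x : ℕ → ℝ} {C s : ℝ} (hs : 1 < s) (hx0 : ∀ j, 0 < x j)
    (hmono : Monotone x) (h : ∀ j, x (j + 1) ^ s ≤ C * (x (j + 1) - x j)) : False := by
  have hC : 0 < C := by
    by_contra! hC
    have := hmono (Nat.le_succ 0)
    have h1 := h 0
    have h2 := Real.rpow_pos_of_pos (hx0 1) s
    simp only [Nat.succ_eq_add_one, zero_add] at *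
    nlinarith
  have hbdd (j : ℕ) : x (j + 1) ≤ C ^ (1 / (s - 1)) := by
    have h1 : x (j + 1) ^ (s - 1) ≤ C := by
      rw [Real.rpow_sub_one (hx0 _).ne', div_le_iff₀ (hx0 _)]
      refine (h j).trans ?_
      nlinarith [hx0 j]
    have h2 := Real.rpow_le_rpow (Real.rpow_nonneg (hx0 _).le _) h1
      (show 0 ≤ 1 / (s - 1) by have : 0 < s - 1 := by linarith
                               positivity)
    rwa [← Real.rpow_mul (hx0 _).le, mul_one_div_cancel (by linarith), Real.rpow_one] at h2
  have hd : 0 < x 0 ^ s / C := div_pos (Real.rpow_pos_of_pos (hx0 0) s) hC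
  have hgrow (j : ℕ) : j * (x 0 ^ s / C) ≤ x j := by
    induction j with
    | zero => simpa using (hx0 0).le
    | succ j ih =>
      have h1 : x 0 ^ s ≤ C * (x (j + 1) - x j) :=
        (Real.rpow_le_rpow (hx0 0).le (hmono (Nat.zero_le _)) (by linarith)).trans (h j)
      have h2 : x 0 ^ s / C ≤ x (j + 1) - x j := by
        rw [div_le_iff₀ hC]; linarith
      push_cast
      linarith
  obtain ⟨N, hN⟩ := exists_nat_gt (C ^ (1 / (s - 1)) / (x 0 ^ s / C))
  rw [div_lt_iff₀ hd] at hN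
  have h1 := hgrow (N + 1)
  have h2 := hbdd N
  push_cast at h1
  linarith

/-- Positive functions with `(-Δ)^k u ≥ c |x|^{-σ₁} v^q` and `(-Δ)^k v ≥ d |x|^{-σ₂} u^p` do not
exist in the critical and subcritical ranges. -/
lemma false_of_negLapPow_ge (hk : 1 ≤ k) (hn : 2 * k < n) {σ₁ σ₂ p q c d : ℝ} (hσ₁ : 0 ≤ σ₁)
    (hσ₂ : 0 ≤ σ₂) (hp : 1 < p) (hq : 1 < q) (hu : Continuous u) (hv : Continuous v)
    (hud : ContDiffOn ℝ (2 * k) u {0}ᶜ) (hvd : ContDiffOn ℝ (2 * k) v {0}ᶜ)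
    (hu0 : ∀ x, 0 < u x) (hv0 : ∀ x, 0 < v x) (hc : 0 < c) (hd : 0 < d)
    (hLu : ∀ x, x ≠ 0 → c * (‖x‖ ^ (-σ₁) * v x ^ q) ≤ negLapPow k u x)
    (hLv : ∀ x, x ≠ 0 → d * (‖x‖ ^ (-σ₂) * u x ^ p) ≤ negLapPow k v x)
    (hE : (n - 2 * k : ℝ) * (p * q - 1) ≤ 2 * k * (q + 1) - (σ₁ + σ₂ * q)) : False := by
  have hp0 : 0 < p := by linarith
  have hq0 : 0 < q := by linarith
  have hLu0 (x : EuclideanSpace ℝ (Fin n)) (hx : x ≠ 0) : 0 < negLapPow k u x := by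
    have := hv0 x
    have := norm_pos_iff.2 hx
    exact lt_of_lt_of_le (by positivity) (hLu x hx)
  have hLv0 (x : EuclideanSpace ℝ (Fin n)) (hx : x ≠ 0) : 0 < negLapPow k v x := by
    have := hu0 x
    have := norm_pos_iff.2 hx
    exact lt_of_lt_of_le (by positivity) (hLv x hx)
  obtain ⟨Φ, hΦ, K, hK, hG⟩ := exists_isCutoff n k (θ := max (1 / p) (1 / q))
    (max_lt ((div_lt_one hp0).2 hp) ((div_lt_one hq0).2 hq))
  have hG' {θ : ℝ} (hθ : 0 < θ) (hle : θ ≤ max (1 / p) (1 / q)) (x : EuclideanSpace ℝ (Fin n)) :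
      |negLapPow k Φ x| ≤ K * Φ x ^ θ :=
    (hG x).trans (mul_le_mul_of_nonneg_left
      (Real.rpow_le_rpow_of_exponent_ge_of_imp (hΦ.nonneg x) (hΦ.le_one x) hle
        fun _ h => absurd h (hθ.trans_le hle).ne') hK.le)
  obtain ⟨M₁, hM₁, h₁⟩ := exists_cutoffIntegral_le hk hn hΦ hp hσ₂ hK
    (hG' (by positivity) (le_max_left _ _)) hu hu0 hv hvd hd hLv
  obtain ⟨M₂, hM₂, h₂⟩ := exists_cutoffIntegral_le hk hn hΦ hq hσ₁ hK
    (hG' (by positivity) (le_max_right _ _)) hv hv0 hu hud hc hLu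
  have hIu {R : ℝ} (hR : 0 < R) := cutoffIntegral_pos hn hΦ hu hud hLu0 hR
  have hIv {R : ℝ} (hR : 0 < R) := cutoffIntegral_pos hn hΦ hv hvd hLv0 hR
  have hmono {R : ℝ} (hR : 0 < R) : cutoffIntegral k Φ u (R / 2) ≤ cutoffIntegral k Φ u R :=
    cutoffIntegral_le_cutoffIntegral hΦ hu hud hLu0 (half_pos hR) (by linarith)
  have hmono' {R : ℝ} (hR : 0 < R) : cutoffIntegral k Φ v (R / 2) ≤ cutoffIntegral k Φ v R :=
    cutoffIntegral_le_cutoffIntegral hΦ hv hvd hLv0 (half_pos hR) (by linarith)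
  have key {R : ℝ} (hR : 1 ≤ R) : cutoffIntegral k Φ u R ^ (p * q)
      ≤ M₁ ^ (p * q) * M₂ ^ q * (cutoffIntegral k Φ u R - cutoffIntegral k Φ u (R / 2)) := by
    have hR0 : 0 < R := by linarith
    set a : ℝ := n - 2 * k - (n - σ₂) / p with ha
    set b : ℝ := n - 2 * k - (n - σ₁) / q with hb
    have hab : a * (p * q) + b * q ≤ 0 := by
      have : a * (p * q) + b * q
          = (n - 2 * k : ℝ) * (p * q - 1) - (2 * k * (q + 1) - (σ₁ + σ₂ * q)) := by
        rw [ha, hb]; field_simp; ring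
      linarith
    have hDv : 0 ≤ cutoffIntegral k Φ v R - cutoffIntegral k Φ v (R / 2) :=
      sub_nonneg.2 (hmono' hR0)
    have hDu : 0 ≤ cutoffIntegral k Φ u R - cutoffIntegral k Φ u (R / 2) :=
      sub_nonneg.2 (hmono hR0)
    have hv1 := h₂ R hR0
    have hu1 := h₁ R hR0
    have hv0' := hIv (half_pos hR0)
    set x := cutoffIntegral k Φ u R with hx
    set y := cutoffIntegral k Φ v R with hy
    set D := x - cutoffIntegral k Φ u (R / 2) with hD
    have hx0 : 0 < x := hIu hR0
    have hy0 : 0 < y := hIv hR0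
    have hxy : x ≤ M₁ * R ^ a * y ^ (1 / p) := by
      refine hu1.trans (mul_le_mul_of_nonneg_left ?_ (by positivity))
      exact Real.rpow_le_rpow hDv (by linarith) (by positivity)
    have hyq : y ^ q ≤ M₂ ^ q * R ^ (b * q) * D := by
      refine (Real.rpow_le_rpow hy0.le hv1 hq0.le).trans_eq ?_
      rw [Real.mul_rpow (by positivity) (by positivity), Real.mul_rpow hM₂.le (by positivity),
        ← Real.rpow_mul hR0.le, ← Real.rpow_mul hDu, one_div_mul_cancel hq0.ne', Real.rpow_one]
    have hxpq : x ^ (p * q) ≤ M₁ ^ (p * q) * R ^ (a * (p * q)) * y ^ q := by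
      refine (Real.rpow_le_rpow hx0.le hxy (by positivity)).trans_eq ?_
      rw [Real.mul_rpow (by positivity) (by positivity), Real.mul_rpow hM₁.le (by positivity),
        ← Real.rpow_mul hR0.le, ← Real.rpow_mul hy0.le,
        show 1 / p * (p * q) = q by field_simp]
    calc x ^ (p * q) ≤ M₁ ^ (p * q) * R ^ (a * (p * q)) * y ^ q := hxpq
      _ ≤ M₁ ^ (p * q) * R ^ (a * (p * q)) * (M₂ ^ q * R ^ (b * q) * D) := by gcongr
      _ = M₁ ^ (p * q) * M₂ ^ q * D * R ^ (a * (p * q) + b * q) := by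
          rw [Real.rpow_add hR0]; ring
      _ ≤ M₁ ^ (p * q) * M₂ ^ q * D :=
          mul_le_of_le_one_right (by positivity) (Real.rpow_le_one_of_one_le_of_nonpos hR hab)
  have hpow (j : ℕ) : (2 : ℝ) ^ (j + 1) / 2 = 2 ^ j := by rw [pow_succ]; field_simp
  refine false_of_rpow_le_sub (x := fun j : ℕ => cutoffIntegral k Φ u (2 ^ j))
    (C := M₁ ^ (p * q) * M₂ ^ q) (s := p * q) (by nlinarith) (fun j => hIu (by positivity))
    (monotone_nat_of_le_succ fun j => ?_) fun j => ?_
  · rw [← hpow j]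
    exact hmono (by positivity)
  · have h := key (R := 2 ^ (j + 1)) (one_le_pow₀ one_le_two)
    rwa [hpow j] at h

lemma DoubleBounded.exists_pos_le {c : EuclideanSpace ℝ (Fin n) → ℝ} (hc : DoubleBounded c) :
    ∃ d, 0 < d ∧ ∀ x, d ≤ c x := by
  obtain ⟨C, hC, h⟩ := hc
  exact ⟨1 / C, by positivity, fun x => (h x).1⟩

end Nonexistence

theorem stmt_19 (n k : ℕ) (hk : 1 ≤ k) (hn : 2 * k < n) (σ₁ σ₂ p q : ℝ)
    (hσ₁ : 0 ≤ σ₁ ∧ σ₁ < 2 * (k : ℝ)) (hσ₂ : 0 ≤ σ₂ ∧ σ₂ < 2 * (k : ℝ))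
    (hp : 1 < p) (hq : 1 < q) :
    (∃ c₁ c₂ u v : EuclideanSpace ℝ (Fin n) → ℝ,
      DoubleBounded c₁ ∧ DoubleBounded c₂ ∧
      (∀ x, 0 < u x) ∧ (∀ x, 0 < v x) ∧ Continuous u ∧ Continuous v ∧
      ContDiffOn ℝ (2 * k) u {(0 : EuclideanSpace ℝ (Fin n))}ᶜ ∧
      ContDiffOn ℝ (2 * k) v {(0 : EuclideanSpace ℝ (Fin n))}ᶜ ∧
      ∀ x : EuclideanSpace ℝ (Fin n), x ≠ 0 →
        negLapPow k u x = c₁ x * ‖x‖ ^ (-σ₁) * v x ^ q ∧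
        negLapPow k v x = c₂ x * ‖x‖ ^ (-σ₂) * u x ^ p)
    ↔ max ((2 * (k : ℝ) * (q + 1) - (σ₁ + σ₂ * q)) / (p * q - 1))
        ((2 * (k : ℝ) * (p + 1) - (σ₂ + σ₁ * p)) / (p * q - 1)) < (n : ℝ) - 2 * (k : ℝ) := by
  have hpq : 0 < p * q - 1 := by nlinarith
  constructor
  · rintro ⟨c₁, c₂, u, v, hc₁, hc₂, hu0, hv0, hu, hv, hud, hvd, hsol⟩
    obtain ⟨d₁, hd₁, hc₁⟩ := hc₁.exists_pos_le
    obtain ⟨d₂, hd₂, hc₂⟩ := hc₂.exists_pos_le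
    have hLu (x : EuclideanSpace ℝ (Fin n)) (hx : x ≠ 0) :
        d₁ * (‖x‖ ^ (-σ₁) * v x ^ q) ≤ negLapPow k u x := by
      have := hv0 x
      rw [(hsol x hx).1, mul_assoc]
      exact mul_le_mul_of_nonneg_right (hc₁ x) (by positivity)
    have hLv (x : EuclideanSpace ℝ (Fin n)) (hx : x ≠ 0) :
        d₂ * (‖x‖ ^ (-σ₂) * u x ^ p) ≤ negLapPow k v x := by
      have := hu0 x
      rw [(hsol x hx).2, mul_assoc]
      exact mul_le_mul_of_nonneg_right (hc₂ x) (by positivity)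
    refine max_lt (lt_of_not_ge fun h => ?_) (lt_of_not_ge fun h => ?_)
    · rw [le_div_iff₀ hpq] at h
      exact false_of_negLapPow_ge hk hn hσ₁.1 hσ₂.1 hp hq hu hv hud hvd hu0 hv0 hd₁ hd₂ hLu hLv h
    · rw [le_div_iff₀ hpq, mul_comm p q] at h
      exact false_of_negLapPow_ge hk hn hσ₂.1 hσ₁.1 hq hp hv hu hvd hud hv0 hu0 hd₂ hd₁ hLv hLu h
  · intro h
    obtain ⟨h₁, h₂⟩ := max_lt_iff.1 h
    refine exists_solution hσ₁ hσ₂ (by linarith) (by linarith) (div_pos ?_ hpq) (div_pos ?_ hpq)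
      h₁ h₂ ?_ ?_
    · nlinarith [hσ₁.2, hσ₂.2]
    · nlinarith [hσ₁.2, hσ₂.2]
    · field_simp
      ring
    · rw [div_mul_eq_mul_div, div_add' _ _ _ hpq.ne', div_sub' hpq.ne', div_left_inj' hpq.ne']
      ring
end
end
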